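/- Assume the dilations are isotropic, a_j = α_j I with α_j real nonzero and |α_j| → ∞. Suppose ψ ∈ L¹(ℝ^d) with ∫ ψ dx = 1 and ‖ψ − ψ(·−y)‖_{H¹} → 0 as y → 0, and suppose φ is a Schwartz function with φ̂ supported in C₀ b^{-1} and ∫ φ dx = 1. Let f ∈ H¹(ℝ^d). (a) If Pψ = 1 a.e. then S_j T_j f → f in H¹ as j → ∞. (b) If moreover the dilations expand exponentially (∃ δ ∈ (0,1) with ‖a_j a_{j+1}^{-1}‖ ≤ δ for all j), then (1/J) Σ_{j=1}^J S_j T_j f → f in H¹ as J → ∞. -/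

import Mathlib

open MeasureTheory Filter Matrix Set
open scoped ENNReal NNReal Topology

noncomputable section

namespace AffinePaper

/-- Embed an integer lattice point `k ∈ ℤ^d` into `ℝ^d`. -/
def intVec {d : ℕ} (k : Fin d → ℤ) : Fin d → ℝ := fun i => (k i : ℝ)

/-- Euclidean norm `|x|` on `ℝ^d`. -/
def eucNorm {d : ℕ} (x : Fin d → ℝ) : ℝ := Real.sqrt (∑ i, x i ^ 2)

/-- The constant `C_d = Γ((d+1)/2) π^{-(d+1)/2}` of the Riesz kernel. -/
def rieszConst (d : ℕ) : ℝ :=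
  Real.Gamma (((d : ℝ) + 1) / 2) / Real.pi ^ (((d : ℝ) + 1) / 2)

/-- The (vector-valued) Riesz kernel `Z(x) = C_d x / |x|^{d+1}`, with `Z(0) = 0`. -/
def rieszKernel (d : ℕ) (x : Fin d → ℝ) : Fin d → ℝ :=
  if x = 0 then 0 else fun i => rieszConst d * x i / eucNorm x ^ (d + 1)

/-- The truncated singular integral `∫_{|y| > ε} f(x-y) Z(y) dy` (vector-valued). -/
def truncRiesz {d : ℕ} (f : (Fin d → ℝ) → ℂ) (x : Fin d → ℝ) (ε : ℝ) : Fin d → ℂ :=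
  ∫ y in {y : Fin d → ℝ | ε < eucNorm y}, (fun i => f (x - y) * ((rieszKernel d y i : ℝ) : ℂ))

/-- `g` is the Riesz transform `Rf = f * Z` of `f`, in the principal value sense:
for a.e. `x` the truncated integrals converge to `g(x)` as `ε → 0+`. -/
def HasRiesz {d : ℕ} (f : (Fin d → ℝ) → ℂ) (g : (Fin d → ℝ) → Fin d → ℂ) : Prop :=
  ∀ᵐ x : Fin d → ℝ, Tendsto (fun ε : ℝ => truncRiesz f x ε) (𝓝[>] 0) (𝓝 (g x))

/-- Membership in the Hardy space `H¹(ℝ^d) = { f ∈ L¹ : Rf ∈ L¹ }`. -/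
def MemH1 {d : ℕ} (f : (Fin d → ℝ) → ℂ) : Prop :=
  Integrable f volume ∧ ∃ g : (Fin d → ℝ) → Fin d → ℂ, Integrable g volume ∧ HasRiesz f g

/-- The Hardy norm `‖f‖_{H¹} = ‖f‖₁ + ‖Rf‖₁`, as a value in `[0,∞]` (equal to `∞` when
`f` admits no integrable Riesz transform; the Riesz transform is a.e. unique, so the
infimum below is over a set of at most one value). -/
def hardyNorm {d : ℕ} (f : (Fin d → ℝ) → ℂ) : ℝ≥0∞ :=
  ENNReal.ofReal (∫ x : Fin d → ℝ, ‖f x‖) +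
    sInf {r : ℝ≥0∞ | ∃ g : (Fin d → ℝ) → Fin d → ℂ,
      Integrable g volume ∧ HasRiesz f g ∧ r = ENNReal.ofReal (∫ x : Fin d → ℝ, ‖g x‖)}

/-- The centered open unit cube `C₀ = (-1/2, 1/2)^d`. -/
def centeredCube (d : ℕ) : Set (Fin d → ℝ) :=
  Set.univ.pi fun _ => Set.Ioo (-(1/2) : ℝ) (1/2)

/-- `ν` is a smooth cut-off function: supported in the centered unit cube `C₀` and
identically `1` near the origin. -/
structure IsCutoff (d : ℕ) (ν : (Fin d → ℝ) → ℝ) : Prop where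
  smooth : ContDiff ℝ (⊤ : ℕ∞) ν
  supp : tsupport ν ⊆ centeredCube d
  one_near_zero : ∀ᶠ ξ in 𝓝 0, ν ξ = 1

/-- The periodic function `ζ(ξ) = -i (ξ b⁻¹ / |ξ b⁻¹|) ν(ξ)` (vector-valued), whose Fourier
coefficients define the discrete Riesz kernel. -/
def zetaFn {d : ℕ} (b : Matrix (Fin d) (Fin d) ℝ) (ν : (Fin d → ℝ) → ℝ)
    (ξ : Fin d → ℝ) : Fin d → ℂ :=
  fun i => -Complex.I * ((((ξ ᵥ* b⁻¹) i / eucNorm (ξ ᵥ* b⁻¹) : ℝ)) : ℂ) * ((ν ξ : ℝ) : ℂ)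

/-- The discrete Riesz kernel `z = {z_k}`, defined through its Fourier series
`Σ_k z_k e^{-2πi ξ k} = ζ(ξ)`, `ξ ∈ C₀`; that is, `z_k = ∫_{C₀} ζ(ξ) e^{2πi ξ k} dξ`. -/
def zKernel {d : ℕ} (b : Matrix (Fin d) (Fin d) ℝ) (ν : (Fin d → ℝ) → ℝ)
    (k : Fin d → ℤ) : Fin d → ℂ :=
  ∫ ξ in centeredCube d,
    Complex.exp (((2 * Real.pi * ∑ i, ξ i * (k i : ℝ) : ℝ)) * Complex.I) • zetaFn b ν ξ

/-- Discrete convolution `(s * z)_k = Σ_l s_{k-l} z_l` of a scalar sequence with the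
(vector-valued) kernel `z`, in the `k`-index. -/
def dConv {d : ℕ} (s : (Fin d → ℤ) → ℂ) (z : (Fin d → ℤ) → Fin d → ℂ)
    (k : Fin d → ℤ) : Fin d → ℂ :=
  ∑' l : Fin d → ℤ, s (k - l) • z l

/-- The discrete Hardy norm `‖s‖_{h¹} = ‖s‖_{ℓ¹} + ‖s * z‖_{ℓ¹}` (value in `[0,∞]`). -/
def h1Norm {d : ℕ} (b : Matrix (Fin d) (Fin d) ℝ) (ν : (Fin d → ℝ) → ℝ)
    (s : (Fin d → ℤ) → ℂ) : ℝ≥0∞ :=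
  (∑' k : Fin d → ℤ, (‖s k‖₊ : ℝ≥0∞)) +
    ∑' k : Fin d → ℤ, (‖dConv s (zKernel b ν) k‖₊ : ℝ≥0∞)

/-- The mixed norm `‖c‖_{ℓ¹(h¹)} = Σ_j ‖c_j‖_{h¹}` (value in `[0,∞]`). -/
def l1h1Norm {d : ℕ} (b : Matrix (Fin d) (Fin d) ℝ) (ν : (Fin d → ℝ) → ℝ)
    (c : ℕ → (Fin d → ℤ) → ℂ) : ℝ≥0∞ :=
  ∑' j : ℕ, h1Norm b ν (c j)

/-- `ψ_{j,k}(x) = |det a_j| ψ(a_j x - bk)` for isotropic dilations `a_j = α_j I`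
(Hardy-space normalization, `p = 1`). -/
def rescH {d : ℕ} (α : ℕ → ℝ) (b : Matrix (Fin d) (Fin d) ℝ) (ψ : (Fin d → ℝ) → ℂ)
    (j : ℕ) (k : Fin d → ℤ) (x : Fin d → ℝ) : ℂ :=
  ((|α j| ^ d : ℝ) : ℂ) * ψ (α j • x - b *ᵥ intVec k)

/-- The synthesis series `Sc = Σ_j Σ_k c_{j,k} ψ_{j,k}` converges to `f` in `H¹`:
for each `j` the sum over `k` converges absolutely in `L¹` to a function belonging to
`H¹`, and the sum over `j` converges absolutely in `H¹`, with limit `f`. -/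
def H1SynthesisTo {d : ℕ} (α : ℕ → ℝ) (b : Matrix (Fin d) (Fin d) ℝ)
    (ψ : (Fin d → ℝ) → ℂ) (c : ℕ → (Fin d → ℤ) → ℂ) (f : (Fin d → ℝ) → ℂ) : Prop :=
  (∀ j : ℕ, Summable fun k : Fin d → ℤ => ∫ x : Fin d → ℝ, ‖c j k * rescH α b ψ j k x‖) ∧
  (∀ j : ℕ, MemH1 (fun x => ∑' k : Fin d → ℤ, c j k * rescH α b ψ j k x)) ∧
  Summable (fun j : ℕ =>
    (hardyNorm (fun x => ∑' k : Fin d → ℤ, c j k * rescH α b ψ j k x)).toReal) ∧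
  Tendsto (fun J : ℕ => hardyNorm
      (fun x => f x - ∑ j ∈ Finset.range J, ∑' k : Fin d → ℤ, c j k * rescH α b ψ j k x))
    atTop (𝓝 0)

/-- Analysis operator at scale `j` in the Hardy-space setting (`p = 1`, `q = ∞`):
`(T_j f)_k = |det b| ⟨f, φ_{j,k}⟩` with `φ_{j,k}(x) = φ(α_j x - bk)`. -/
def TjH {d : ℕ} (α : ℕ → ℝ) (b : Matrix (Fin d) (Fin d) ℝ) (φ : (Fin d → ℝ) → ℂ)
    (f : (Fin d → ℝ) → ℂ) (j : ℕ) (k : Fin d → ℤ) : ℂ :=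
  ((|b.det| : ℝ) : ℂ) *
    ∫ x : Fin d → ℝ, f x * (starRingEnd ℂ) (φ (α j • x - b *ᵥ intVec k))

/-- Dot product of row vector `ξ` and column vector `x`. -/
def dotP {d : ℕ} (ξ x : Fin d → ℝ) : ℝ := ∑ i, ξ i * x i

/-- Fourier transform `f̂(ξ) = ∫ f(x) e^{-2πi ξ x} dx`. -/
def ft {d : ℕ} (f : (Fin d → ℝ) → ℂ) (ξ : Fin d → ℝ) : ℂ :=
  ∫ x : Fin d → ℝ, Complex.exp ((-(2 * Real.pi * dotP ξ x) : ℝ) * Complex.I) * f x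

/-- Inverse Fourier transform `ǧ(x) = ∫ g(ξ) e^{2πi ξ x} dξ`. -/
def ftInv {d : ℕ} (g : (Fin d → ℝ) → ℂ) (x : Fin d → ℝ) : ℂ :=
  ∫ ξ : Fin d → ℝ, Complex.exp (((2 * Real.pi * dotP ξ x) : ℝ) * Complex.I) * g ξ

/-- `f` is a Schwartz function. -/
def IsSchwartz {d : ℕ} (f : (Fin d → ℝ) → ℂ) : Prop :=
  ∃ Φ : SchwartzMap (Fin d → ℝ) ℂ, ∀ x, f x = Φ x

/-- Convolution `(f * g)(x) = ∫ f(y) g(x - y) dy`. -/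
def conv {d : ℕ} (f g : (Fin d → ℝ) → ℂ) (x : Fin d → ℝ) : ℂ :=
  ∫ y : Fin d → ℝ, f y * g (x - y)

/-- The periodization `Pg(x) = |det b| Σ_{k ∈ ℤ^d} g(x - bk)` of a real-valued function. -/
def periodization {d : ℕ} (b : Matrix (Fin d) (Fin d) ℝ) (g : (Fin d → ℝ) → ℝ)
    (x : Fin d → ℝ) : ℝ :=
  |b.det| * ∑' k : Fin d → ℤ, g (x - b *ᵥ intVec k)

section Subordination

/-! ### Subordination integrals -/

lemma hasDerivAt_mul_sub_div (ε ρ : ℝ) {s : ℝ} (hs : 0 < s) :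
    HasDerivAt (fun s : ℝ => ε * s - ρ / s) (ε + ρ / s ^ 2) s := by
  have h1 := (hasDerivAt_id s).const_mul ε
  have h2 := (hasDerivAt_inv hs.ne').const_mul ρ
  have h3 := h1.sub h2
  refine (h3.congr_deriv ?_).congr_of_eventuallyEq (Eventually.of_forall fun t => ?_)
  · ring
  · simp [div_eq_mul_inv]

lemma image_mul_sub_div {ε ρ : ℝ} (hε : 0 < ε) (hρ : 0 < ρ) :
    (fun s : ℝ => ε * s - ρ / s) '' Ioi 0 = univ := by
  refine eq_univ_of_forall fun u => ?_
  have hpos : 0 < u ^ 2 + 4 * ε * ρ := by positivity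
  have h1 : |u| < √(u ^ 2 + 4 * ε * ρ) := by
    rw [← Real.sqrt_sq_eq_abs]
    exact Real.sqrt_lt_sqrt (sq_nonneg u) (by nlinarith [mul_pos hε hρ])
  have h2 : 0 < u + √(u ^ 2 + 4 * ε * ρ) := by linarith [neg_abs_le u]
  refine ⟨(u + √(u ^ 2 + 4 * ε * ρ)) / (2 * ε), by simp only [mem_Ioi]; positivity, ?_⟩
  have h3 := Real.sq_sqrt hpos.le
  simp only
  generalize √(u ^ 2 + 4 * ε * ρ) = r at h2 h3
  have h4 : ρ = (r - u) * (u + r) / (4 * ε) := by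
    field_simp
    linarith
  rw [h4]
  field_simp
  ring

lemma injOn_mul_sub_div {ε ρ : ℝ} (hε : 0 < ε) (hρ : 0 < ρ) :
    InjOn (fun s : ℝ => ε * s - ρ / s) (Ioi 0) := by
  intro a ha b hb h
  simp only [mem_Ioi] at ha hb
  simp only at h
  have : (a - b) * (ε * (a * b) + ρ) = 0 := by
    field_simp at h
    linarith
  rcases mul_eq_zero.1 this with h' | h'
  · linarith
  · have : 0 < ε * (a * b) + ρ := by positivity
    linarith

lemma integral_subordination_aux {ε ρ : ℝ} (hε : 0 < ε) (hρ : 0 < ρ) :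
    IntegrableOn (fun s : ℝ => Real.exp (-Real.pi * (ε * s - ρ / s) ^ 2)) (Ioi 0) ∧
    IntegrableOn (fun s : ℝ => (s ^ 2)⁻¹ * Real.exp (-Real.pi * (ε * s - ρ / s) ^ 2)) (Ioi 0) ∧
    ∫ s in Ioi (0 : ℝ), Real.exp (-Real.pi * (ε * s - ρ / s) ^ 2) = 1 / (2 * ε) ∧
    ∫ s in Ioi (0 : ℝ), (s ^ 2)⁻¹ * Real.exp (-Real.pi * (ε * s - ρ / s) ^ 2) = 1 / (2 * ρ) := by
  set g : ℝ → ℝ := fun s => Real.exp (-Real.pi * (ε * s - ρ / s) ^ 2) with hg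
  have hgm : Measurable g := by fun_prop
  have hgauss : Integrable (fun u : ℝ => Real.exp (-Real.pi * u ^ 2)) :=
    integrable_exp_neg_mul_sq Real.pi_pos
  have hd : ∀ s ∈ Ioi (0 : ℝ),
      HasDerivWithinAt (fun s : ℝ => ε * s - ρ / s) (ε + ρ / s ^ 2) (Ioi 0) s :=
    fun s hs => (hasDerivAt_mul_sub_div ε ρ hs).hasDerivWithinAt
  have habs : ∀ s ∈ Ioi (0 : ℝ), |ε + ρ / s ^ 2| • Real.exp (-Real.pi * (ε * s - ρ / s) ^ 2)
      = ε * g s + ρ * ((s ^ 2)⁻¹ * g s) := by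
    intro s hs
    rw [abs_of_pos (by positivity), smul_eq_mul]
    simp only [hg]
    ring
  have hI1 : IntegrableOn g (Ioi 0) := by
    have : Integrable (fun s : ℝ => Real.exp (2 * Real.pi * ε * ρ) *
        Real.exp (-(Real.pi * ε ^ 2) * s ^ 2)) :=
      (integrable_exp_neg_mul_sq (by positivity)).const_mul _
    refine this.integrableOn.mono' hgm.aestronglyMeasurable ?_
    refine (ae_restrict_iff' measurableSet_Ioi).2 (Eventually.of_forall fun s hs => ?_)
    have hs' : (0 : ℝ) < s := hs
    rw [Real.norm_of_nonneg (Real.exp_nonneg _), ← Real.exp_add]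
    refine Real.exp_le_exp.2 ?_
    have : (ε * s - ρ / s) ^ 2 = ε ^ 2 * s ^ 2 - 2 * ε * ρ + (ρ / s) ^ 2 := by
      field_simp
      ring
    rw [this]
    nlinarith [mul_nonneg Real.pi_pos.le (sq_nonneg (ρ / s))]
  have htot : IntegrableOn (fun s => ε * g s + ρ * ((s ^ 2)⁻¹ * g s)) (Ioi 0) := by
    have h := (integrableOn_image_iff_integrableOn_abs_deriv_smul measurableSet_Ioi hd
      (injOn_mul_sub_div hε hρ) (fun u : ℝ => Real.exp (-Real.pi * u ^ 2))).1
      hgauss.integrableOn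
    exact h.congr_fun habs measurableSet_Ioi
  have hI2 : IntegrableOn (fun s => (s ^ 2)⁻¹ * g s) (Ioi 0) := by
    have h := (htot.sub (hI1.const_mul ε)).const_mul ρ⁻¹
    refine h.congr (Eventually.of_forall fun s => ?_)
    simp only [Pi.sub_apply]
    field_simp
    ring
  have hsum : ε * (∫ s in Ioi 0, g s) + ρ * (∫ s in Ioi 0, (s ^ 2)⁻¹ * g s) = 1 := by
    have h := integral_image_eq_integral_abs_deriv_smul measurableSet_Ioi hd
      (injOn_mul_sub_div hε hρ) (fun u : ℝ => Real.exp (-Real.pi * u ^ 2))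
    rw [image_mul_sub_div hε hρ, setIntegral_univ, integral_gaussian,
      setIntegral_congr_fun measurableSet_Ioi habs, integral_add (hI1.const_mul _)
      (hI2.const_mul _), integral_const_mul, integral_const_mul, div_self Real.pi_pos.ne',
      Real.sqrt_one] at h
    exact h.symm
  have hinv : (∫ s in Ioi 0, g s) = ρ / ε * ∫ s in Ioi 0, (s ^ 2)⁻¹ * g s := by
    have him : (fun s : ℝ => ρ / ε / s) '' Ioi 0 = Ioi 0 := by
      ext t
      constructor
      · rintro ⟨s, hs, rfl⟩
        have hs' : (0 : ℝ) < s := hs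
        simp only [mem_Ioi]
        positivity
      · intro ht
        have ht' : (0 : ℝ) < t := ht
        refine ⟨ρ / ε / t, by simp only [mem_Ioi]; positivity, ?_⟩
        simp only
        field_simp
    have h := integral_image_eq_integral_abs_deriv_smul (s := Ioi (0 : ℝ))
      (f := fun s : ℝ => ρ / ε / s) (f' := fun s => -(ρ / ε / s ^ 2)) measurableSet_Ioi
      (fun s hs => by
        have h2 := (hasDerivAt_inv (ne_of_gt (show (0 : ℝ) < s from hs))).const_mul (ρ / ε)
        refine HasDerivAt.hasDerivWithinAt ?_
        refine (h2.congr_deriv ?_).congr_of_eventuallyEq (Eventually.of_forall fun t => ?_)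
        · ring
        · simp [div_eq_mul_inv])
      (fun a ha b hb hab => by
        simp only [mem_Ioi] at ha hb
        simp only at hab
        field_simp at hab
        exact hab.symm) g
    rw [him] at h
    rw [h, ← integral_const_mul]
    refine setIntegral_congr_fun measurableSet_Ioi fun s hs => ?_
    have hs' : (0 : ℝ) < s := hs
    simp only [smul_eq_mul, abs_neg]
    rw [abs_of_pos (by positivity)]
    have : g (ρ / ε / s) = g s := by
      simp only [hg]
      congr 1
      field_simp
      ring
    rw [this]
    field_simp
  rw [hinv] at hsum
  have hB : ∫ s in Ioi 0, (s ^ 2)⁻¹ * g s = 1 / (2 * ρ) := by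
    field_simp at hsum ⊢
    linarith
  refine ⟨hI1, hI2, ?_, hB⟩
  rw [hinv, hB]
  field_simp

lemma exp_subordination_eq {ε ρ s : ℝ} (hs : 0 < s) :
    Real.exp (-Real.pi * (ρ ^ 2 / s ^ 2 + ε ^ 2 * s ^ 2)) =
      Real.exp (-2 * Real.pi * ε * ρ) * Real.exp (-Real.pi * (ε * s - ρ / s) ^ 2) := by
  rw [← Real.exp_add]
  congr 1
  field_simp
  ring

lemma integral_subordination {ε ρ : ℝ} (hε : 0 < ε) (hρ : 0 ≤ ρ) :
    ∫ s in Ioi (0 : ℝ), Real.exp (-Real.pi * (ρ ^ 2 / s ^ 2 + ε ^ 2 * s ^ 2)) =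
      Real.exp (-2 * Real.pi * ε * ρ) / (2 * ε) := by
  rcases hρ.eq_or_lt with rfl | hρ
  · have := integral_gaussian_Ioi (Real.pi * ε ^ 2)
    simp only [ne_eq, OfNat.ofNat_ne_zero, not_false_eq_true, zero_pow, zero_div, zero_add,
      mul_zero, Real.exp_zero]
    rw [show Real.pi / (Real.pi * ε ^ 2) = (1 / ε) ^ 2 by field_simp,
      Real.sqrt_sq (by positivity)] at this
    rw [show (1 : ℝ) / (2 * ε) = 1 / ε / 2 by field_simp, ← this]
    congr 1 with s
    ring_nf
  · rw [setIntegral_congr_fun measurableSet_Ioi fun s hs => exp_subordination_eq hs,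
      integral_const_mul, (integral_subordination_aux hε hρ).2.2.1]
    ring

lemma integral_inv_sq_subordination {ε ρ : ℝ} (hε : 0 < ε) (hρ : 0 < ρ) :
    ∫ s in Ioi (0 : ℝ), (s ^ 2)⁻¹ * Real.exp (-Real.pi * (ρ ^ 2 / s ^ 2 + ε ^ 2 * s ^ 2)) =
      Real.exp (-2 * Real.pi * ε * ρ) / (2 * ρ) := by
  rw [setIntegral_congr_fun (g := fun s => Real.exp (-2 * Real.pi * ε * ρ) *
    ((s ^ 2)⁻¹ * Real.exp (-Real.pi * (ε * s - ρ / s) ^ 2))) measurableSet_Ioi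
    fun s hs => by simp only [exp_subordination_eq (ε := ε) (ρ := ρ) hs]; ring,
    integral_const_mul, (integral_subordination_aux hε hρ).2.2.2]
  ring

end Subordination

section Poisson

open scoped FourierTransform RealInnerProductSpace

/-- The Poisson kernel. -/
def poissonK (d : ℕ) (ε : ℝ) (x : EuclideanSpace ℝ (Fin d)) : ℝ :=
  rieszConst d * ε / Real.sqrt (‖x‖ ^ 2 + ε ^ 2) ^ (d + 1)

/-- The conjugate Poisson kernel in the coordinate `i`. -/
def conjK {d : ℕ} (i : Fin d) (ε : ℝ) (x : EuclideanSpace ℝ (Fin d)) : ℝ :=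
  rieszConst d * x i / Real.sqrt (‖x‖ ^ 2 + ε ^ 2) ^ (d + 1)

/-- The symbol of the Poisson kernel. -/
def poissonM (d : ℕ) (ε : ℝ) (ξ : EuclideanSpace ℝ (Fin d)) : ℂ :=
  (Real.exp (-2 * Real.pi * ε * ‖ξ‖) : ℝ)

/-- The symbol of the conjugate Poisson kernel. -/
def conjM {d : ℕ} (i : Fin d) (ε : ℝ) (ξ : EuclideanSpace ℝ (Fin d)) : ℂ :=
  -Complex.I * ((ξ i / ‖ξ‖ * Real.exp (-2 * Real.pi * ε * ‖ξ‖) : ℝ) : ℂ)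

lemma rieszConst_pos (d : ℕ) : 0 < rieszConst d := by
  unfold rieszConst
  have : 0 < Real.Gamma (((d : ℝ) + 1) / 2) := Real.Gamma_pos_of_pos (by positivity)
  positivity

/-- The Gamma integral producing the constant of the Riesz kernel. -/
lemma integral_pow_mul_gaussian (d : ℕ) {D : ℝ} (hD : 0 < D) :
    ∫ s in Ioi (0 : ℝ), s ^ d * Real.exp (-Real.pi * (D ^ 2 * s ^ 2)) =
      rieszConst d / 2 / D ^ (d + 1) := by
  have h := integral_rpow_mul_exp_neg_mul_rpow (p := 2) (q := d) (b := Real.pi * D ^ 2)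
    (by norm_num) (by linarith [(Nat.cast_nonneg d : (0 : ℝ) ≤ d)]) (by positivity)
  have h2 : ∀ s : ℝ, s ^ (d : ℝ) * Real.exp (-(Real.pi * D ^ 2) * s ^ (2 : ℝ)) =
      s ^ d * Real.exp (-Real.pi * (D ^ 2 * s ^ 2)) := by
    intro s
    rw [Real.rpow_natCast, Real.rpow_ofNat]
    ring_nf
  simp_rw [h2] at h
  rw [h, rieszConst, Real.mul_rpow (by positivity) (by positivity), ← Real.rpow_natCast D 2,
    ← Real.rpow_mul hD.le, ← Real.rpow_natCast D (d + 1), neg_div, Real.rpow_neg (by positivity),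
    show ((2 : ℕ) : ℝ) * -(((d : ℝ) + 1) / 2) = -((d + 1 : ℕ) : ℝ) by push_cast; ring,
    Real.rpow_neg hD.le]
  field_simp

variable {d : ℕ}

lemma integrable_gaussianE {s : ℝ} (hs : 0 < s) :
    Integrable (fun ξ : EuclideanSpace ℝ (Fin d) =>
      ((Real.exp (-Real.pi * (‖ξ‖ ^ 2 / s ^ 2)) : ℝ) : ℂ)) := by
  have := GaussianFourier.integrable_cexp_neg_mul_sq_norm_add
    (V := EuclideanSpace ℝ (Fin d)) (b := ((Real.pi / s ^ 2 : ℝ) : ℂ)) (by rw [Complex.ofReal_re]; positivity) 0 0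
  refine this.congr (ae_of_all _ fun ξ => ?_)
  simp only [inner_zero_left]
  push_cast
  congr 1
  ring

lemma fourierInv_gaussianE {s : ℝ} (hs : 0 < s) (x : EuclideanSpace ℝ (Fin d)) :
    𝓕⁻ (fun ξ : EuclideanSpace ℝ (Fin d) =>
      ((Real.exp (-Real.pi * (‖ξ‖ ^ 2 / s ^ 2)) : ℝ) : ℂ)) x =
      ((s ^ d * Real.exp (-Real.pi * (s ^ 2 * ‖x‖ ^ 2)) : ℝ) : ℂ) := by
  have := fourier_gaussian_innerProductSpace' (V := EuclideanSpace ℝ (Fin d))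
    (b := ((Real.pi / s ^ 2 : ℝ) : ℂ)) (by rw [Complex.ofReal_re]; positivity) 0 (-x)
  rw [Real.fourierInv_eq_fourier_neg]
  simp only [inner_zero_left, zero_sub, neg_neg, finrank_euclideanSpace, Fintype.card_fin] at this
  have e : (fun ξ : EuclideanSpace ℝ (Fin d) =>
      ((Real.exp (-Real.pi * (‖ξ‖ ^ 2 / s ^ 2)) : ℝ) : ℂ)) =
      fun v => Complex.exp (-((Real.pi / s ^ 2 : ℝ) : ℂ) * ‖v‖ ^ 2 + 2 * Real.pi * Complex.I * ((0 : ℝ) : ℂ)) := by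
    funext ξ
    push_cast
    congr 1
    ring
  rw [e, this]
  push_cast
  have h1 : (Real.pi : ℂ) / (Real.pi / s ^ 2) = ((s ^ 2 : ℝ) : ℂ) := by
    have : (Real.pi : ℂ) ≠ 0 := by exact_mod_cast Real.pi_ne_zero
    have : (s : ℂ) ≠ 0 := by exact_mod_cast hs.ne'
    push_cast
    field_simp
  rw [h1]
  congr 1
  · rw [show ((d : ℂ) / 2) = (((d : ℝ) / 2 : ℝ) : ℂ) by push_cast; rfl,
      ← Complex.ofReal_cpow (by positivity), ← Real.rpow_natCast s 2, ← Real.rpow_mul hs.le]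
    rw [← Complex.ofReal_pow, ← Real.rpow_natCast s d]
    congr 2
    push_cast; ring
  · congr 1
    have : (Real.pi : ℂ) ≠ 0 := by exact_mod_cast Real.pi_ne_zero
    have : (s : ℂ) ≠ 0 := by exact_mod_cast hs.ne'
    field_simp

lemma integrable_norm_mul_gaussianE {s : ℝ} (hs : 0 < s) :
    Integrable (fun ξ : EuclideanSpace ℝ (Fin d) =>
      ‖ξ‖ * ‖((Real.exp (-Real.pi * (‖ξ‖ ^ 2 / s ^ 2)) : ℝ) : ℂ)‖) := by
  have h2 : (0 : ℝ) < Real.sqrt 2 * s := by positivity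
  refine ((integrable_gaussianE (d := d) h2).norm.const_mul s).mono' (by fun_prop)
    (ae_of_all _ fun ξ => ?_)
  rw [Complex.norm_real, Complex.norm_real, norm_mul, norm_norm, norm_norm,
    Real.norm_of_nonneg (Real.exp_pos _).le, Real.norm_of_nonneg (Real.exp_pos _).le, mul_pow,
    Real.sq_sqrt (by norm_num)]
  set t := ‖ξ‖ / s with ht
  have e1 : ‖ξ‖ = s * t := by rw [ht]; field_simp
  have e2 : -Real.pi * (‖ξ‖ ^ 2 / s ^ 2) = -Real.pi * (‖ξ‖ ^ 2 / (2 * s ^ 2)) + (-(Real.pi * t ^ 2 / 2)) := by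
    rw [e1]; field_simp; ring
  rw [e2, Real.exp_add, e1, mul_comm (Real.exp _), ← mul_assoc, mul_assoc s]
  have h0 : 0 ≤ t := by positivity
  have : t * Real.exp (-(Real.pi * t ^ 2 / 2)) ≤ 1 := by
    rw [Real.exp_neg, ← div_eq_mul_inv, div_le_one (Real.exp_pos _)]
    have := Real.add_one_le_exp (Real.pi * t ^ 2 / 2)
    nlinarith [Real.pi_gt_three, sq_nonneg (t - 1)]
  have := mul_le_mul_of_nonneg_left this hs.le
  have := mul_le_mul_of_nonneg_right this (Real.exp_pos (-Real.pi * ((s * t) ^ 2 / (2 * s ^ 2)))).le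
  simpa using this

lemma fourierInv_coord_gaussianE (i : Fin d) {s : ℝ} (hs : 0 < s) (x : EuclideanSpace ℝ (Fin d)) :
    𝓕⁻ (fun ξ : EuclideanSpace ℝ (Fin d) =>
      ((ξ i * Real.exp (-Real.pi * (‖ξ‖ ^ 2 / s ^ 2)) : ℝ) : ℂ)) x =
      Complex.I * ((x i * (s ^ (d + 2) * Real.exp (-Real.pi * (s ^ 2 * ‖x‖ ^ 2))) : ℝ) : ℂ) := by
  set G : EuclideanSpace ℝ (Fin d) → ℂ := fun ξ =>
      ((Real.exp (-Real.pi * (‖ξ‖ ^ 2 / s ^ 2)) : ℝ) : ℂ) with hG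
  have hd := Real.hasFDerivAt_fourier (integrable_gaussianE (d := d) hs)
    (integrable_norm_mul_gaussianE hs) (-x)
  set e : EuclideanSpace ℝ (Fin d) := EuclideanSpace.single i 1 with he
  have hline : HasDerivAt (fun t : ℝ => -x + t • e) e 0 := by
    simpa using ((hasDerivAt_id (0 : ℝ)).smul_const e).const_add (-x)
  rw [show -x = -x + (0 : ℝ) • e by rw [zero_smul, add_zero], ← hG] at hd
  have hd1 := HasFDerivAt.comp_hasDerivAt (0 : ℝ) (f := fun t : ℝ => -x + t • e) hd hline
  rw [zero_smul, add_zero] at hd1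
  have hF : ∀ y, 𝓕 G y = ((s ^ d * Real.exp (-Real.pi * (s ^ 2 * ‖y‖ ^ 2)) : ℝ) : ℂ) := by
    intro y
    have := fourierInv_gaussianE hs (-y)
    rwa [Real.fourierInv_eq_fourier_neg, neg_neg, norm_neg] at this
  have hd2 : HasDerivAt (fun t : ℝ => ((s ^ d * Real.exp (-Real.pi * (s ^ 2 *
      (‖x‖ ^ 2 - 2 * t * x i + t ^ 2))) : ℝ) : ℂ))
      ((s ^ d * (Real.exp (-Real.pi * (s ^ 2 * ‖x‖ ^ 2)) * (-Real.pi * (s ^ 2 * (-2 * x i)))) : ℝ) : ℂ) 0 := by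
    refine HasDerivAt.ofReal_comp ?_
    have : HasDerivAt (fun t : ℝ => -Real.pi * (s ^ 2 * (‖x‖ ^ 2 - 2 * t * x i + t ^ 2)))
      (-Real.pi * (s ^ 2 * (-2 * x i))) 0 := by
      have h1 : HasDerivAt (fun t : ℝ => ‖x‖ ^ 2 - 2 * t * x i + t ^ 2) (-2 * x i) 0 := by
        have := (((hasDerivAt_id (0 : ℝ)).const_mul 2).mul_const (x i)).const_sub (‖x‖ ^ 2)
        exact (this.add (hasDerivAt_pow 2 (0 : ℝ))).congr_deriv (by simp)
      exact (h1.const_mul _).const_mul _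
    exact ((this.exp).const_mul (s ^ d)).congr_deriv (by simp)
  have heq : (𝓕 G ∘ fun t : ℝ => -x + t • e) = fun t : ℝ => ((s ^ d * Real.exp (-Real.pi * (s ^ 2 *
      (‖x‖ ^ 2 - 2 * t * x i + t ^ 2))) : ℝ) : ℂ) := by
    funext t
    rw [Function.comp_apply, hF, @norm_add_sq_real]
    congr 5
    rw [norm_neg, inner_neg_left, inner_smul_right, norm_smul, he]
    simp [EuclideanSpace.inner_single_right]
    ring
  rw [heq] at hd1
  have hu := hd1.unique hd2
  rw [Real.fourier_eq', ContinuousLinearMap.integral_apply] at hu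
  · rw [Real.fourierInv_eq']
    have h3 : ∀ v : EuclideanSpace ℝ (Fin d),
      (Complex.exp (↑(-2 * Real.pi * ⟪v, -x⟫) * Complex.I) •
        VectorFourier.fourierSMulRight (innerSL ℝ) G v) e =
      (-(2 * Real.pi * Complex.I)) * (Complex.exp (↑(2 * Real.pi * ⟪v, x⟫) * Complex.I) •
        (((v i * Real.exp (-Real.pi * (‖v‖ ^ 2 / s ^ 2)) : ℝ) : ℂ))) := by
      intro v
      rw [_root_.smul_apply, VectorFourier.fourierSMulRight_apply]
      have h5 : (innerSL ℝ v) e = v i := by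
        change ⟪v, e⟫ = v i
        simp [he, EuclideanSpace.inner_single_right]
      rw [h5]
      simp only [hG, inner_neg_right]
      simp
      ring
    simp_rw [h3] at hu
    rw [integral_const_mul] at hu
    have hpi : (-(2 * Real.pi * Complex.I)) ≠ 0 := by simp [Real.pi_ne_zero]
    refine mul_left_cancel₀ hpi (hu.trans ?_)
    push_cast
    linear_combination (2 * Real.pi * (s : ℂ) ^ d * Complex.exp (-Real.pi * (s ^ 2 * ‖x‖ ^ 2)) * s ^ 2 * x i) * (Complex.I_sq)
  · refine (((integrable_norm_mul_gaussianE (d := d) hs).const_mul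
      (2 * Real.pi * ‖innerSL ℝ (E := EuclideanSpace ℝ (Fin d))‖)).mono' ?_ (ae_of_all _ fun v => ?_))
    · exact (by fun_prop : Continuous fun v : EuclideanSpace ℝ (Fin d) =>
        Complex.exp (((-2 * Real.pi * ⟪v, -x⟫ : ℝ) : ℂ) * Complex.I)).aestronglyMeasurable.smul
        (AEStronglyMeasurable.fourierSMulRight (L := innerSL ℝ)
          (integrable_gaussianE hs).aestronglyMeasurable)
    · rw [norm_smul, Complex.norm_exp_ofReal_mul_I, one_mul]
      exact (VectorFourier.norm_fourierSMulRight_le (innerSL ℝ) G v).trans_eq (by ring)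

lemma integrable_exp_neg_mul_norm {c : ℝ} (hc : 0 < c) :
    Integrable (fun ξ : EuclideanSpace ℝ (Fin d) => Real.exp (-c * ‖ξ‖)) := by
  obtain ⟨n, hn⟩ : ∃ n : ℕ, n = d + 1 := ⟨_, rfl⟩
  have hI := integrable_one_add_norm (E := EuclideanSpace ℝ (Fin d)) (μ := volume)
    (r := n) (by rw [finrank_euclideanSpace, Fintype.card_fin, hn]; push_cast; linarith)
  refine (hI.const_mul (n.factorial / min c 1 ^ n * Real.exp 1)).mono'
    (by fun_prop) (ae_of_all _ fun ξ => ?_)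
  rw [Real.norm_of_nonneg (Real.exp_pos _).le, Real.rpow_neg (by positivity), Real.rpow_natCast]
  set m := min c 1
  have hm : 0 < m := lt_min hc one_pos
  have h1 : Real.exp (-c * ‖ξ‖) ≤ Real.exp 1 * Real.exp (-(m * (1 + ‖ξ‖))) := by
    rw [← Real.exp_add]
    apply Real.exp_le_exp.2
    nlinarith [min_le_left c 1, min_le_right c 1, norm_nonneg ξ]
  have h2 : (m * (1 + ‖ξ‖)) ^ n / n.factorial ≤ Real.exp (m * (1 + ‖ξ‖)) :=
    Real.pow_div_factorial_le_exp _ (by positivity) n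
  rw [mul_pow] at h2
  refine h1.trans ?_
  rw [mul_comm _ (Real.exp 1), mul_assoc]
  refine mul_le_mul_of_nonneg_left ?_ (Real.exp_pos _).le
  rw [Real.exp_neg, inv_le_comm₀ (Real.exp_pos _) (by positivity)]
  refine le_trans (le_of_eq ?_) h2
  field_simp

lemma norm_poissonM {ε : ℝ} (ξ : EuclideanSpace ℝ (Fin d)) :
    ‖poissonM d ε ξ‖ = Real.exp (-2 * Real.pi * ε * ‖ξ‖) := by
  rw [poissonM, Complex.norm_real, Real.norm_of_nonneg (Real.exp_pos _).le]

lemma abs_coord_div_norm_le (i : Fin d) (ξ : EuclideanSpace ℝ (Fin d)) : |ξ i / ‖ξ‖| ≤ 1 := by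
  rw [abs_div, abs_norm]
  exact div_le_one_of_le₀ (by simpa using EuclideanSpace.norm_eq ξ ▸ PiLp.norm_apply_le ξ i)
    (norm_nonneg _)

lemma norm_conjM_le (i : Fin d) {ε : ℝ} (ξ : EuclideanSpace ℝ (Fin d)) :
    ‖conjM i ε ξ‖ ≤ Real.exp (-2 * Real.pi * ε * ‖ξ‖) := by
  rw [conjM, norm_mul, norm_neg, Complex.norm_I, one_mul, Complex.norm_real, norm_mul,
    Real.norm_of_nonneg (Real.exp_pos _).le]
  exact mul_le_of_le_one_left (Real.exp_pos _).le (abs_coord_div_norm_le i ξ)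

lemma integrable_poissonM {ε : ℝ} (hε : 0 < ε) : Integrable (poissonM d ε) := by
  have := (integrable_exp_neg_mul_norm (d := d) (c := 2 * Real.pi * ε) (by positivity)).ofReal (𝕜 := ℂ)
  refine this.congr (ae_of_all _ fun ξ => ?_)
  simp [poissonM]

lemma measurable_conjM (i : Fin d) (ε : ℝ) : Measurable (conjM i ε) := by
  unfold conjM
  fun_prop

lemma integrable_conjM (i : Fin d) {ε : ℝ} (hε : 0 < ε) : Integrable (conjM i ε) := by
  refine (integrable_poissonM hε).norm.mono' (measurable_conjM i ε).aestronglyMeasurable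
    (ae_of_all _ fun ξ => ?_)
  rw [norm_poissonM]
  exact norm_conjM_le i ξ

/-- Superposition of Fourier integrals. -/
lemma fourierInv_integral_comm {F : ℝ → EuclideanSpace ℝ (Fin d) → ℝ}
    (hm : Measurable (Function.uncurry F))
    (hint : ∀ᵐ ξ, IntegrableOn (fun s => F s ξ) (Ioi 0))
    (hint2 : Integrable (fun ξ => ∫ s in Ioi (0 : ℝ), |F s ξ|))
    (x : EuclideanSpace ℝ (Fin d)) :
    𝓕⁻ (fun ξ => ((∫ s in Ioi (0 : ℝ), F s ξ : ℝ) : ℂ)) x =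
      ∫ s in Ioi (0 : ℝ), 𝓕⁻ (fun ξ => ((F s ξ : ℝ) : ℂ)) x := by
  simp_rw [Real.fourierInv_eq', smul_eq_mul, ← integral_complex_ofReal, ← integral_const_mul]
  refine integral_integral_swap (f := fun ξ s => Complex.exp (((2 * Real.pi * ⟪ξ, x⟫ : ℝ) : ℂ) * Complex.I)
    * ((F s ξ : ℝ) : ℂ)) ?_
  have hms : Measurable (Function.uncurry fun (ξ : EuclideanSpace ℝ (Fin d)) (s : ℝ) =>
      Complex.exp (((2 * Real.pi * ⟪ξ, x⟫ : ℝ) : ℂ) * Complex.I) * ((F s ξ : ℝ) : ℂ)) := by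
    refine Measurable.mul (f := fun z : EuclideanSpace ℝ (Fin d) × ℝ =>
      Complex.exp (((2 * Real.pi * ⟪z.1, x⟫ : ℝ) : ℂ) * Complex.I))
      (g := fun z : EuclideanSpace ℝ (Fin d) × ℝ => ((F z.2 z.1 : ℝ) : ℂ)) (by fun_prop) ?_
    exact Complex.measurable_ofReal.comp (hm.comp measurable_swap)
  rw [integrable_prod_iff hms.aestronglyMeasurable]
  refine ⟨?_, ?_⟩
  · filter_upwards [hint] with ξ hξ
    exact (hξ.ofReal (𝕜 := ℂ)).const_mul (Complex.exp (((2 * Real.pi * ⟪ξ, x⟫ : ℝ) : ℂ) * Complex.I))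
  · refine hint2.congr (ae_of_all _ fun ξ => ?_)
    refine integral_congr_ae (ae_of_all _ fun s => ?_)
    simp only [Function.uncurry, norm_mul, Complex.norm_exp_ofReal_mul_I, one_mul,
      Complex.norm_real, Real.norm_eq_abs]

lemma integrableOn_of_integral_pos {f : ℝ → ℝ} {c : ℝ} (h : ∫ s in Ioi (0 : ℝ), f s = c)
    (hc : 0 < c) : IntegrableOn f (Ioi 0) := by
  by_contra h'
  have := integral_undef h'
  linarith

lemma exp_sub_eq_mul {s t ε : ℝ} : Real.exp (-Real.pi * (t ^ 2 / s ^ 2 + ε ^ 2 * s ^ 2)) =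
    Real.exp (-Real.pi * (ε ^ 2 * s ^ 2)) * Real.exp (-Real.pi * (t ^ 2 / s ^ 2)) := by
  rw [← Real.exp_add]; ring_nf

lemma fourierInv_poissonM {ε : ℝ} (hε : 0 < ε) (x : EuclideanSpace ℝ (Fin d)) :
    𝓕⁻ (poissonM d ε) x = (poissonK d ε x : ℂ) := by
  set F : ℝ → EuclideanSpace ℝ (Fin d) → ℝ := fun s ξ =>
    2 * ε * Real.exp (-Real.pi * (‖ξ‖ ^ 2 / s ^ 2 + ε ^ 2 * s ^ 2)) with hF
  have hval : ∀ ξ : EuclideanSpace ℝ (Fin d), ∫ s in Ioi (0 : ℝ), F s ξ =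
      Real.exp (-2 * Real.pi * ε * ‖ξ‖) := by
    intro ξ
    simp only [hF]
    rw [integral_const_mul, integral_subordination hε (norm_nonneg _)]
    field_simp
  have hpos : ∀ s ξ, 0 ≤ F s ξ := fun s ξ => by simp only [hF]; positivity
  have h := fourierInv_integral_comm (F := F) (by simp only [hF, Function.uncurry_def]; fun_prop)
    (ae_of_all _ fun ξ => integrableOn_of_integral_pos (hval ξ) (Real.exp_pos _))
    (by
      simp_rw [fun s ξ => abs_of_nonneg (hpos s ξ), hval]
      simpa [norm_poissonM] using (integrable_poissonM (d := d) hε).norm) x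
  simp_rw [hval] at h
  change 𝓕⁻ (fun ξ => poissonM d ε ξ) x = _
  unfold poissonM
  rw [h]
  set D := Real.sqrt (‖x‖ ^ 2 + ε ^ 2) with hD
  have hDpos : 0 < D := Real.sqrt_pos.2 (by positivity)
  have hD2 : D ^ 2 = ‖x‖ ^ 2 + ε ^ 2 := Real.sq_sqrt (by positivity)
  have h2 : ∀ s ∈ Ioi (0 : ℝ), 𝓕⁻ (fun ξ => ((F s ξ : ℝ) : ℂ)) x =
      ((2 * ε * (s ^ d * Real.exp (-Real.pi * (D ^ 2 * s ^ 2))) : ℝ) : ℂ) := by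
    intro s hs
    have h3 : (fun ξ => ((F s ξ : ℝ) : ℂ)) = fun ξ : EuclideanSpace ℝ (Fin d) =>
        ((2 * ε * Real.exp (-Real.pi * (ε ^ 2 * s ^ 2)) : ℝ) : ℂ) •
          ((Real.exp (-Real.pi * (‖ξ‖ ^ 2 / s ^ 2)) : ℝ) : ℂ) := by
      funext ξ
      simp only [hF, exp_sub_eq_mul, smul_eq_mul, ← Complex.ofReal_mul]
      congr 1; ring
    have h4 := fourierInv_gaussianE hs x
    rw [h3]
    rw [Real.fourierInv_eq'] at h4 ⊢
    simp_rw [smul_comm _ ((2 * ε * Real.exp (-Real.pi * (ε ^ 2 * s ^ 2)) : ℝ) : ℂ)]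
    rw [integral_smul, h4, smul_eq_mul, ← Complex.ofReal_mul, hD2, add_mul, mul_add, Real.exp_add]
    congr 1
    rw [mul_comm (‖x‖ ^ 2)]
    ring
  rw [setIntegral_congr_fun measurableSet_Ioi h2, integral_complex_ofReal, integral_const_mul,
    integral_pow_mul_gaussian d hDpos, poissonK, ← hD]
  congr 1
  field_simp

lemma fourierInv_conjM (i : Fin d) {ε : ℝ} (hε : 0 < ε) (x : EuclideanSpace ℝ (Fin d)) :
    𝓕⁻ (conjM i ε) x = (conjK i ε x : ℂ) := by
  set F : ℝ → EuclideanSpace ℝ (Fin d) → ℝ := fun s ξ =>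
    2 * ξ i * ((s ^ 2)⁻¹ * Real.exp (-Real.pi * (‖ξ‖ ^ 2 / s ^ 2 + ε ^ 2 * s ^ 2))) with hF
  have hval0 : ∀ ξ : EuclideanSpace ℝ (Fin d), ∀ c : ℝ, (ξ = 0 → c = 0) → ∫ s in Ioi (0 : ℝ), 2 * c *
      ((s ^ 2)⁻¹ * Real.exp (-Real.pi * (‖ξ‖ ^ 2 / s ^ 2 + ε ^ 2 * s ^ 2))) =
      c / ‖ξ‖ * Real.exp (-2 * Real.pi * ε * ‖ξ‖) := by
    intro ξ c hc
    rcases eq_or_ne ξ 0 with h0 | h0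
    · simp [hc h0]
    · have := norm_pos_iff.2 h0
      rw [integral_const_mul, integral_inv_sq_subordination hε this]
      field_simp
  have hi : ∀ ξ : EuclideanSpace ℝ (Fin d), ξ = 0 → ξ i = 0 := by rintro _ rfl; rfl
  have hval : ∀ ξ : EuclideanSpace ℝ (Fin d), ∫ s in Ioi (0 : ℝ), F s ξ =
      ξ i / ‖ξ‖ * Real.exp (-2 * Real.pi * ε * ‖ξ‖) := fun ξ => hval0 ξ _ (hi ξ)
  have habs : ∀ s ξ, |F s ξ| = 2 * |ξ i| * ((s ^ 2)⁻¹ *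
      Real.exp (-Real.pi * (‖ξ‖ ^ 2 / s ^ 2 + ε ^ 2 * s ^ 2))) := fun s ξ => by
    simp only [hF]
    rw [abs_mul, abs_mul, abs_two, abs_of_nonneg (a := (s ^ 2)⁻¹ * _) (by positivity)]
  have hval' : ∀ ξ : EuclideanSpace ℝ (Fin d), ∫ s in Ioi (0 : ℝ), |F s ξ| =
      |ξ i| / ‖ξ‖ * Real.exp (-2 * Real.pi * ε * ‖ξ‖) := by
    intro ξ
    simp_rw [habs]
    exact hval0 ξ _ fun h => by rw [hi ξ h, abs_zero]
  have h := fourierInv_integral_comm (F := F) (by simp only [hF, Function.uncurry_def]; fun_prop)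
    (ae_of_all _ fun ξ => by
      rcases eq_or_ne ξ 0 with h0 | h0
      · have : (fun s => F s ξ) = fun _ => 0 := by
          funext s; simp [hF, hi ξ h0]
        rw [this]; exact integrableOn_zero
      · have hp := norm_pos_iff.2 h0
        exact (integrableOn_of_integral_pos (integral_inv_sq_subordination hε hp)
          (by positivity)).const_mul _)
    (by
      simp_rw [hval']
      refine (integrable_poissonM (d := d) hε).norm.mono' (by fun_prop) (ae_of_all _ fun ξ => ?_)
      rw [norm_poissonM, norm_mul, Real.norm_of_nonneg (Real.exp_pos _).le]
      refine mul_le_of_le_one_left (Real.exp_pos _).le ?_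
      have := abs_coord_div_norm_le i ξ
      rwa [Real.norm_eq_abs, abs_div, abs_abs, ← abs_div]) x
  simp_rw [hval] at h
  set D := Real.sqrt (‖x‖ ^ 2 + ε ^ 2) with hD
  have hDpos : 0 < D := Real.sqrt_pos.2 (by positivity)
  have hD2 : D ^ 2 = ‖x‖ ^ 2 + ε ^ 2 := Real.sq_sqrt (by positivity)
  have h2 : ∀ s ∈ Ioi (0 : ℝ), 𝓕⁻ (fun ξ => ((F s ξ : ℝ) : ℂ)) x =
      Complex.I * ((2 * x i * (s ^ d * Real.exp (-Real.pi * (D ^ 2 * s ^ 2))) : ℝ) : ℂ) := by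
    intro s hs
    have hs' : s ≠ 0 := ne_of_gt hs
    have h3 : (fun ξ => ((F s ξ : ℝ) : ℂ)) = fun ξ : EuclideanSpace ℝ (Fin d) =>
        ((2 * (s ^ 2)⁻¹ * Real.exp (-Real.pi * (ε ^ 2 * s ^ 2)) : ℝ) : ℂ) •
          ((ξ i * Real.exp (-Real.pi * (‖ξ‖ ^ 2 / s ^ 2)) : ℝ) : ℂ) := by
      funext ξ
      simp only [hF, exp_sub_eq_mul, smul_eq_mul, ← Complex.ofReal_mul]
      congr 1; ring
    have h4 := fourierInv_coord_gaussianE i hs x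
    rw [h3]
    rw [Real.fourierInv_eq'] at h4 ⊢
    simp_rw [smul_comm _ ((2 * (s ^ 2)⁻¹ * Real.exp (-Real.pi * (ε ^ 2 * s ^ 2)) : ℝ) : ℂ)]
    rw [integral_smul, h4, smul_eq_mul, mul_left_comm, ← Complex.ofReal_mul, hD2, add_mul, mul_add,
      Real.exp_add]
    congr 2
    rw [mul_comm (‖x‖ ^ 2), pow_add]
    field_simp
  have h5 : conjM i ε = fun ξ => -Complex.I • ((ξ i / ‖ξ‖ * Real.exp (-2 * Real.pi * ε * ‖ξ‖) : ℝ) : ℂ) := by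
    funext ξ; simp [conjM]
  rw [Real.fourierInv_eq'] at h ⊢
  rw [h5]
  simp_rw [smul_comm _ (-Complex.I)]
  rw [integral_smul, h, setIntegral_congr_fun measurableSet_Ioi h2, integral_const_mul,
    integral_complex_ofReal, integral_const_mul,
    integral_pow_mul_gaussian d hDpos, conjK, ← hD, smul_eq_mul, ← mul_assoc, neg_mul,
    Complex.I_mul_I, neg_neg, one_mul]
  congr 1
  field_simp

end Poisson

section FourierBasics

open scoped FourierTransform RealInnerProductSpace SchwartzMap

variable {d : ℕ}

local notation "𝔼" => EuclideanSpace ℝ (Fin d)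

lemma integral_fourier_mul {f g : 𝔼 → ℂ} (hf : Integrable f) (hg : Integrable g) :
    ∫ ξ, 𝓕 f ξ * g ξ = ∫ x, f x * 𝓕 g x := by
  have := VectorFourier.integral_fourierIntegral_smul_eq_flip (e := Real.fourierChar)
    (L := innerₗ 𝔼) (μ := volume) (ν := volume) Real.continuous_fourierChar continuous_inner hf hg
  rw [flip_innerₗ] at this
  exact this

lemma integral_fourierInv_mul {f g : 𝔼 → ℂ} (hf : Integrable f) (hg : Integrable g) :
    ∫ ξ, 𝓕⁻ f ξ * g ξ = ∫ x, f x * 𝓕⁻ g x := by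
  simp_rw [Real.fourierInv_eq_fourier_neg]
  rw [← integral_neg_eq_self, ← integral_neg_eq_self (fun x => f x * _)]
  simp_rw [neg_neg]
  have := integral_fourier_mul hf hg.comp_neg
  rw [this, ← integral_neg_eq_self]
  congr 1 with x
  congr 1
  have h := congrFun (Real.fourierInv_eq_fourier_comp_neg g) (-x)
  rw [Real.fourierInv_eq_fourier_neg, neg_neg] at h
  exact h.symm

lemma norm_fourier_le (f : 𝔼 → ℂ) (ξ : 𝔼) : ‖𝓕 f ξ‖ ≤ ∫ x, ‖f x‖ :=
  VectorFourier.norm_fourierIntegral_le_integral_norm _ _ _ _ _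

lemma norm_fourierInv_le (f : 𝔼 → ℂ) (ξ : 𝔼) : ‖𝓕⁻ f ξ‖ ≤ ∫ x, ‖f x‖ := by
  rw [Real.fourierInv_eq_fourier_neg]
  exact norm_fourier_le f _

lemma continuous_fourierE {f : 𝔼 → ℂ} (hf : Integrable f) : Continuous (𝓕 f) :=
  VectorFourier.fourierIntegral_continuous Real.continuous_fourierChar continuous_inner hf

lemma continuous_fourierInvE {f : 𝔼 → ℂ} (hf : Integrable f) : Continuous (𝓕⁻ f) := by
  have : 𝓕⁻ f = fun x => 𝓕 f (-x) := funext fun x => Real.fourierInv_eq_fourier_neg f x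
  rw [this]
  exact (continuous_fourierE hf).comp continuous_neg

/-- A complex Schwartz function made out of a smooth compactly supported real function. -/
def bumpSchwartz (g : 𝔼 → ℝ) (h1 : HasCompactSupport g) (h2 : ContDiff ℝ (⊤ : ℕ∞) g) : 𝓢(𝔼, ℂ) :=
  HasCompactSupport.toSchwartzMap (f := fun x => (g x : ℂ))
    (h1.comp_left (g := Complex.ofReal) Complex.ofReal_zero)
    (Complex.ofRealCLM.contDiff.comp h2)

lemma bumpSchwartz_apply (g : 𝔼 → ℝ) (h1 : HasCompactSupport g) (h2 : ContDiff ℝ (⊤ : ℕ∞) g) (x : 𝔼) :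
    bumpSchwartz g h1 h2 x = (g x : ℂ) := rfl

lemma ae_eq_of_integral_schwartz_mul_eq {f g : 𝔼 → ℂ} (hf : LocallyIntegrable f)
    (hg : LocallyIntegrable g) (h : ∀ θ : 𝓢(𝔼, ℂ), ∫ x, f x * θ x = ∫ x, g x * θ x) :
    f =ᵐ[volume] g := by
  refine ae_eq_of_integral_contDiff_smul_eq hf hg fun u h1 h2 => ?_
  have := h (bumpSchwartz u h2 h1)
  simp_rw [bumpSchwartz_apply, mul_comm _ ((u _ : ℝ) : ℂ)] at this
  simpa [Complex.real_smul] using this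

/-- Plancherel inequality for functions in `L¹ ∩ L²`. -/
lemma memLp_two_fourier {v : 𝔼 → ℂ} (h1 : Integrable v) (h2 : MemLp v 2) :
    MemLp (𝓕 v) 2 ∧ eLpNorm (𝓕 v) 2 = eLpNorm v 2 := by
  set V := h2.toLp v with hV
  set W : Lp ℂ 2 (volume : Measure 𝔼) := 𝓕 V with hW
  have key : (W : 𝔼 → ℂ) =ᵐ[volume] 𝓕 v := by
    refine ae_eq_of_integral_schwartz_mul_eq ((Lp.memLp W).locallyIntegrable (by norm_num))
      (continuous_fourierE h1).locallyIntegrable fun θ => ?_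
    have e1 : (𝓕 (V : 𝓢'(𝔼, ℂ))) θ = (W : 𝓢'(𝔼, ℂ)) θ := by
      rw [Lp.fourier_toTemperedDistribution_eq]
    rw [TemperedDistribution.fourier_apply, Lp.toTemperedDistribution_apply,
      Lp.toTemperedDistribution_apply] at e1
    simp_rw [smul_eq_mul] at e1
    simp_rw [mul_comm _ (θ _)]
    rw [← e1]
    simp_rw [mul_comm (θ _)]
    rw [integral_fourier_mul h1 θ.integrable, SchwartzMap.fourier_coe]
    refine integral_congr_ae ?_
    filter_upwards [h2.coeFn_toLp] with x hx
    rw [hx, mul_comm]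
  refine ⟨(memLp_congr_ae key).1 (Lp.memLp W), ?_⟩
  rw [← eLpNorm_congr_ae key, ← eLpNorm_congr_ae h2.coeFn_toLp]
  have : ‖W‖ = ‖V‖ := Lp.norm_fourier_eq V
  rw [Lp.norm_def, Lp.norm_def] at this
  exact (ENNReal.toReal_eq_toReal_iff' (Lp.eLpNorm_ne_top _) (Lp.eLpNorm_ne_top _)).1 this

lemma memLp_two_fourierInv {v : 𝔼 → ℂ} (h1 : Integrable v) (h2 : MemLp v 2) :
    MemLp (𝓕⁻ v) 2 ∧ eLpNorm (𝓕⁻ v) 2 = eLpNorm v 2 := by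
  have e : 𝓕⁻ v = 𝓕 v ∘ fun x => -x := funext fun x => Real.fourierInv_eq_fourier_neg v x
  have mp := Measure.measurePreserving_neg (volume : Measure 𝔼)
  obtain ⟨h3, h4⟩ := memLp_two_fourier h1 h2
  rw [e]
  exact ⟨h3.comp_measurePreserving mp, by
    rw [eLpNorm_comp_measurePreserving h3.aestronglyMeasurable mp, h4]⟩

/-- Uniqueness for Fourier transforms of integrable functions. -/
lemma ae_eq_of_fourier_eq {f g : 𝔼 → ℂ} (hf : Integrable f) (hg : Integrable g)
    (h : ∀ ξ, 𝓕 f ξ = 𝓕 g ξ) : f =ᵐ[volume] g := by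
  refine ae_eq_of_integral_schwartz_mul_eq hf.locallyIntegrable hg.locallyIntegrable fun θ => ?_
  have e : (θ : 𝔼 → ℂ) = 𝓕 ((𝓕⁻ θ : 𝓢(𝔼, ℂ)) : 𝔼 → ℂ) := by
    rw [← SchwartzMap.fourier_coe, FourierTransform.fourier_fourierInv_eq]
  rw [e, ← integral_fourier_mul hf (SchwartzMap.integrable _),
    ← integral_fourier_mul hg (SchwartzMap.integrable _)]
  simp_rw [h]

/-- Convolution of a function with a real kernel. -/
def kconv (k : 𝔼 → ℝ) (f : 𝔼 → ℂ) (x : 𝔼) : ℂ := ∫ y, f (x - y) * (k y : ℂ)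

lemma kconv_eq_fourierInv {f m : 𝔼 → ℂ} {k : 𝔼 → ℝ} (hf : Integrable f) (hm : Integrable m)
    (hk : ∀ x, 𝓕⁻ m x = (k x : ℂ)) (x : 𝔼) :
    kconv k f x = 𝓕⁻ (fun ξ => m ξ * 𝓕 f ξ) x := by
  unfold kconv
  simp_rw [← hk]
  have h1 : Integrable (fun y => f (x - y)) := hf.comp_sub_left x
  simp_rw [mul_comm (f _)]
  rw [integral_fourierInv_mul hm h1, Real.fourierInv_eq']
  congr 1 with ξ
  rw [smul_eq_mul, mul_left_comm]
  congr 1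
  rw [Real.fourierInv_eq', Real.fourier_eq', ← integral_const_mul,
    ← integral_sub_left_eq_self _ volume x]
  refine integral_congr_ae (ae_of_all _ fun y => ?_)
  simp only [smul_eq_mul]
  rw [← mul_assoc, ← Complex.exp_add, sub_sub_cancel]
  congr 2
  rw [inner_sub_left, real_inner_comm ξ x]
  push_cast
  ring

lemma kconv_poisson {f : 𝔼 → ℂ} (hf : Integrable f) {ε : ℝ} (hε : 0 < ε) (x : 𝔼) :
    kconv (poissonK d ε) f x = 𝓕⁻ (fun ξ => poissonM d ε ξ * 𝓕 f ξ) x :=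
  kconv_eq_fourierInv hf (integrable_poissonM hε) (fourierInv_poissonM hε) x

lemma kconv_conj (i : Fin d) {f : 𝔼 → ℂ} (hf : Integrable f) {ε : ℝ} (hε : 0 < ε) (x : 𝔼) :
    kconv (conjK i ε) f x = 𝓕⁻ (fun ξ => conjM i ε ξ * 𝓕 f ξ) x :=
  kconv_eq_fourierInv hf (integrable_conjM i hε) (fourierInv_conjM i hε) x

lemma integrable_mul_fourier {f m : 𝔼 → ℂ} (hf : Integrable f) (hm : Integrable m) :
    Integrable (fun ξ => m ξ * 𝓕 f ξ) :=
  (hm.bdd_mul (continuous_fourierE hf).aestronglyMeasurable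
    (ae_of_all _ fun ξ => norm_fourier_le f ξ)).congr (ae_of_all _ fun _ => mul_comm _ _)

/-- `L²` boundedness of the smoothed Riesz transforms, uniformly in the smoothing. -/
lemma eLpNorm_kconv_conj_le (i : Fin d) {G : 𝔼 → ℂ} (h1 : Integrable G) (h2 : MemLp G 2)
    {ε : ℝ} (hε : 0 < ε) :
    MemLp (kconv (conjK i ε) G) 2 ∧ eLpNorm (kconv (conjK i ε) G) 2 ≤ eLpNorm G 2 := by
  have e : kconv (conjK i ε) G = 𝓕⁻ (fun ξ => conjM i ε ξ * 𝓕 G ξ) :=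
    funext fun x => kconv_conj i h1 hε x
  obtain ⟨h3, h4⟩ := memLp_two_fourier h1 h2
  have hb : ∀ ξ, ‖conjM i ε ξ * 𝓕 G ξ‖ ≤ ‖𝓕 G ξ‖ := fun ξ => by
    rw [norm_mul]
    refine mul_le_of_le_one_left (norm_nonneg _) ((norm_conjM_le i ξ).trans ?_)
    rw [Real.exp_le_one_iff]
    have := norm_nonneg ξ
    have : 0 ≤ 2 * Real.pi * ε * ‖ξ‖ := by positivity
    linarith
  have h5 : MemLp (fun ξ => conjM i ε ξ * 𝓕 G ξ) 2 :=
    h3.mono ((measurable_conjM i ε).aestronglyMeasurable.mul h3.aestronglyMeasurable)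
      (ae_of_all _ hb)
  have h6 := memLp_two_fourierInv (integrable_mul_fourier h1 (integrable_conjM i hε)) h5
  rw [e]
  refine ⟨h6.1, ?_⟩
  rw [h6.2, ← h4]
  exact eLpNorm_mono hb

end FourierBasics

section Averaging

variable {d : ℕ}

local notation "𝔼" => EuclideanSpace ℝ (Fin d)

/-- A coordinate of the Riesz kernel on Euclidean space. -/
def rieszZ (i : Fin d) (x : 𝔼) : ℝ := rieszConst d * x i / ‖x‖ ^ (d + 1)

/-- Truncated Riesz integral in the coordinate `i`. -/
def truncE (i : Fin d) (f : 𝔼 → ℂ) (x : 𝔼) (ε : ℝ) : ℂ :=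
  ∫ y in {y : 𝔼 | ε < ‖y‖}, f (x - y) * (rieszZ i y : ℂ)

lemma abs_coord_le (i : Fin d) (x : 𝔼) : |x i| ≤ ‖x‖ := by
  simpa using PiLp.norm_apply_le x i

/-- The cumulative weight relating the smooth and the sharp truncations. -/
def cumW (d : ℕ) (r : ℝ) : ℝ := (r / Real.sqrt (1 + r ^ 2)) ^ (d + 1)

/-- The density of `cumW`. -/
def densW (d : ℕ) (r : ℝ) : ℝ :=
  (d + 1) * (r / Real.sqrt (1 + r ^ 2)) ^ d * (Real.sqrt (1 + r ^ 2) ^ 3)⁻¹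

lemma hasDerivAt_cumW (d : ℕ) (r : ℝ) : HasDerivAt (cumW d) (densW d r) r := by
  have hp : 0 < 1 + r ^ 2 := by positivity
  have h1 : HasDerivAt (fun r : ℝ => Real.sqrt (1 + r ^ 2)) (r / Real.sqrt (1 + r ^ 2)) r := by
    have := ((hasDerivAt_pow 2 r).const_add 1).sqrt hp.ne'
    refine this.congr_deriv ?_
    simp only [Nat.cast_ofNat, Nat.add_one_sub_one, pow_one]
    field_simp
  have hs : 0 < Real.sqrt (1 + r ^ 2) := Real.sqrt_pos.2 hp
  have h2 := ((hasDerivAt_id r).div h1 hs.ne').pow (d + 1)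
  refine h2.congr_deriv ?_
  simp only [id_eq, Pi.div_apply, Nat.add_sub_cancel, densW]
  push_cast
  have h3 : Real.sqrt (1 + r ^ 2) ^ 2 = 1 + r ^ 2 := Real.sq_sqrt hp.le
  have h4 : (1 * Real.sqrt (1 + r ^ 2) - r * (r / Real.sqrt (1 + r ^ 2))) / Real.sqrt (1 + r ^ 2) ^ 2
      = (Real.sqrt (1 + r ^ 2) ^ 3)⁻¹ := by
    field_simp
    rw [h3]; ring
  rw [h4]

lemma densW_nonneg {r : ℝ} (hr : 0 ≤ r) : 0 ≤ densW d r := by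
  unfold densW; positivity

lemma tendsto_cumW : Tendsto (cumW d) atTop (𝓝 1) := by
  have h1 : Tendsto (fun r : ℝ => (Real.sqrt (1 + (r⁻¹) ^ 2))⁻¹ ^ (d + 1)) atTop (𝓝 1) := by
    have : Tendsto (fun r : ℝ => (Real.sqrt (1 + (r⁻¹) ^ 2))⁻¹ ^ (d + 1)) atTop
        (𝓝 ((Real.sqrt (1 + (0 : ℝ) ^ 2))⁻¹ ^ (d + 1))) := by
      refine (Tendsto.inv₀ (Tendsto.sqrt ((tendsto_inv_atTop_zero.pow 2).const_add 1))
        (by simp)).pow _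
    simpa using this
  refine h1.congr' ?_
  filter_upwards [eventually_gt_atTop (0 : ℝ)] with r hr
  rw [cumW]
  congr 1
  have : 1 + r ^ 2 = r ^ 2 * (1 + (r⁻¹) ^ 2) := by field_simp; ring
  rw [this, Real.sqrt_mul (by positivity), Real.sqrt_sq hr.le]
  field_simp

lemma cumW_zero : cumW d 0 = 0 := by simp [cumW]

lemma integrableOn_densW : IntegrableOn (densW d) (Ioi 0) :=
  integrableOn_Ioi_deriv_of_nonneg' (fun r _ => hasDerivAt_cumW d r)
    (fun _ hr => densW_nonneg (le_of_lt hr)) tendsto_cumW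

lemma integral_densW : ∫ s in Ioi (0 : ℝ), densW d s = 1 := by
  rw [integral_Ioi_of_hasDerivAt_of_tendsto' (fun r _ => hasDerivAt_cumW d r)
    integrableOn_densW tendsto_cumW, cumW_zero, sub_zero]

lemma continuous_densW : Continuous (densW d) := by
  unfold densW
  have : ∀ r : ℝ, Real.sqrt (1 + r ^ 2) ≠ 0 := fun r => (Real.sqrt_pos.2 (by positivity)).ne'
  have h2 : ∀ r : ℝ, Real.sqrt (1 + r ^ 2) ^ 3 ≠ 0 := fun r => pow_ne_zero _ (this r)
  fun_prop (disch := assumption)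

lemma integral_indicator_densW {r : ℝ} (hr : 0 ≤ r) :
    ∫ s in Ioi (0 : ℝ), (Iio r).indicator (densW d) s = cumW d r := by
  rw [setIntegral_indicator measurableSet_Iio, Ioi_inter_Iio, ← integral_Ioc_eq_integral_Ioo,
    ← intervalIntegral.integral_of_le hr,
    intervalIntegral.integral_eq_sub_of_hasDerivAt (fun r _ => hasDerivAt_cumW d r)
      (continuous_densW.intervalIntegrable _ _), cumW_zero, sub_zero]

lemma conjK_eq_rieszZ_mul (i : Fin d) {ε : ℝ} (hε : 0 < ε) (y : 𝔼) :
    conjK i ε y = rieszZ i y * cumW d (‖y‖ / ε) := by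
  rcases eq_or_ne y 0 with rfl | hy
  · simp [conjK, rieszZ]
  have hn := norm_pos_iff.2 hy
  have h1 : Real.sqrt (1 + (‖y‖ / ε) ^ 2) = Real.sqrt (‖y‖ ^ 2 + ε ^ 2) / ε := by
    rw [show 1 + (‖y‖ / ε) ^ 2 = (‖y‖ ^ 2 + ε ^ 2) / ε ^ 2 by field_simp; ring,
      Real.sqrt_div (by positivity), Real.sqrt_sq hε.le]
  have h2 : 0 < Real.sqrt (‖y‖ ^ 2 + ε ^ 2) := Real.sqrt_pos.2 (by positivity)
  rw [conjK, rieszZ, cumW, h1, show ‖y‖ / ε / (Real.sqrt (‖y‖ ^ 2 + ε ^ 2) / ε) =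
    ‖y‖ / Real.sqrt (‖y‖ ^ 2 + ε ^ 2) by field_simp, div_pow]
  field_simp

lemma abs_conjK_le (i : Fin d) {ε : ℝ} (hε : 0 < ε) (y : 𝔼) :
    |conjK i ε y| ≤ rieszConst d / ε ^ d := by
  have hD : 0 < Real.sqrt (‖y‖ ^ 2 + ε ^ 2) := Real.sqrt_pos.2 (by positivity)
  have h1 : ‖y‖ ≤ Real.sqrt (‖y‖ ^ 2 + ε ^ 2) :=
    Real.le_sqrt_of_sq_le (by nlinarith)
  have h2 : ε ≤ Real.sqrt (‖y‖ ^ 2 + ε ^ 2) :=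
    Real.le_sqrt_of_sq_le (by nlinarith [norm_nonneg y])
  have hC := rieszConst_pos d
  rw [conjK, abs_div, abs_mul, abs_of_pos hC, abs_of_pos (pow_pos hD _), pow_succ,
    div_le_div_iff₀ (by positivity) (by positivity), mul_assoc]
  refine mul_le_mul_of_nonneg_left ?_ hC.le
  calc |y i| * ε ^ d ≤ Real.sqrt (‖y‖ ^ 2 + ε ^ 2) * Real.sqrt (‖y‖ ^ 2 + ε ^ 2) ^ d := by
        gcongr
        exact (abs_coord_le i y).trans h1
    _ = _ := by ring

lemma abs_rieszZ_le (i : Fin d) {s : ℝ} (hs : 0 < s) {y : 𝔼} (hy : s ≤ ‖y‖) :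
    |rieszZ i y| ≤ rieszConst d / s ^ d := by
  have hn : 0 < ‖y‖ := hs.trans_le hy
  have hC := rieszConst_pos d
  rw [rieszZ, abs_div, abs_mul, abs_of_pos hC, abs_of_pos (pow_pos hn _), pow_succ,
    div_le_div_iff₀ (by positivity) (by positivity), mul_assoc]
  refine mul_le_mul_of_nonneg_left ?_ hC.le
  calc |y i| * s ^ d ≤ ‖y‖ * ‖y‖ ^ d := by
        gcongr
        exact abs_coord_le i y
    _ = _ := by ring

lemma measurable_rieszZ (i : Fin d) : Measurable (rieszZ i) := by
  unfold rieszZ; fun_prop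

lemma continuous_conjK (i : Fin d) {ε : ℝ} (hε : 0 < ε) : Continuous (conjK i ε) := by
  unfold conjK
  have : ∀ y : 𝔼, Real.sqrt (‖y‖ ^ 2 + ε ^ 2) ^ (d + 1) ≠ 0 := fun y =>
    pow_ne_zero _ (Real.sqrt_pos.2 (by positivity)).ne'
  fun_prop (disch := assumption)

lemma integrable_mul_conjK (i : Fin d) {ε : ℝ} (hε : 0 < ε) {f : 𝔼 → ℂ} (hf : Integrable f) (x : 𝔼) :
    Integrable (fun y => f (x - y) * (conjK i ε y : ℂ)) := by
  refine (hf.comp_sub_left x).mul_bdd (c := rieszConst d / ε ^ d)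
    (Complex.continuous_ofReal.comp (continuous_conjK i hε)).aestronglyMeasurable
    (ae_of_all _ fun y => ?_)
  rw [Complex.norm_real, Real.norm_eq_abs]
  exact abs_conjK_le i hε y

lemma norm_truncE_le (i : Fin d) {f : 𝔼 → ℂ} (hf : Integrable f) (x : 𝔼) {s : ℝ} (hs : 0 < s) :
    ‖truncE i f x s‖ ≤ rieszConst d / s ^ d * ∫ y, ‖f y‖ := by
  have hi := (hf.comp_sub_left x).norm
  have hm : MeasurableSet {y : 𝔼 | s < ‖y‖} := measurableSet_lt measurable_const measurable_norm
  have hC := rieszConst_pos d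
  refine (norm_integral_le_of_norm_le ((hi.const_mul (rieszConst d / s ^ d)).integrableOn)
    ((ae_restrict_iff' hm).2 (ae_of_all _ fun y hy => ?_))).trans ?_
  · rw [norm_mul, mul_comm, Complex.norm_real, Real.norm_eq_abs]
    exact mul_le_mul_of_nonneg_right (abs_rieszZ_le i hs (le_of_lt hy)) (norm_nonneg _)
  · refine (setIntegral_le_integral (hi.const_mul _) (ae_of_all _ fun y => by positivity)).trans_eq ?_
    rw [integral_const_mul, integral_sub_left_eq_self (fun y => ‖f y‖)]

lemma kconv_conj_eq_average (i : Fin d) {ε : ℝ} (hε : 0 < ε) {f : 𝔼 → ℂ} (hf : Integrable f) (x : 𝔼) :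
    IntegrableOn (fun s => (densW d s : ℂ) * truncE i f x (ε * s)) (Ioi 0) ∧
    kconv (conjK i ε) f x = ∫ s in Ioi (0 : ℝ), (densW d s : ℂ) * truncE i f x (ε * s) := by
  set F : 𝔼 → ℝ → ℂ := fun y s =>
    f (x - y) * (rieszZ i y : ℂ) * ((Iio (‖y‖ / ε)).indicator (densW d) s : ℝ) with hF
  have hind : ∀ (y : 𝔼) (s : ℝ), (Iio (‖y‖ / ε)).indicator (densW d) s =
      {z : 𝔼 × ℝ | z.2 < ‖z.1‖ / ε}.indicator (fun z => densW d z.2) (y, s) := fun y s => rfl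
  have hAE : AEStronglyMeasurable (Function.uncurry F)
      ((volume : Measure 𝔼).prod (volume.restrict (Ioi (0 : ℝ)))) := by
    have h1 : AEStronglyMeasurable (fun y => f (x - y) * (rieszZ i y : ℂ)) (volume : Measure 𝔼) :=
      (hf.comp_sub_left x).aestronglyMeasurable.mul
        (Complex.measurable_ofReal.comp (measurable_rieszZ i)).aestronglyMeasurable
    refine (h1.comp_fst).mul ?_
    have : Measurable fun z : 𝔼 × ℝ => (((Iio (‖z.1‖ / ε)).indicator (densW d) z.2 : ℝ) : ℂ) := by
      simp_rw [hind]
      refine Complex.measurable_ofReal.comp (Measurable.indicator ?_ ?_)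
      · exact continuous_densW.measurable.comp measurable_snd
      · exact measurableSet_lt measurable_snd (by fun_prop)
    exact this.aestronglyMeasurable
  have hnorm : ∀ y s, 0 < s → ‖F y s‖ = ‖f (x - y) * (rieszZ i y : ℂ)‖ *
      (Iio (‖y‖ / ε)).indicator (densW d) s := by
    intro y s hs
    simp only [hF]
    rw [norm_mul _ (((Iio (‖y‖ / ε)).indicator (densW d) s : ℝ) : ℂ), Complex.norm_real,
      Real.norm_of_nonneg]
    simp only [indicator]
    split_ifs
    exacts [densW_nonneg hs.le, le_rfl]
  have hI : Integrable (Function.uncurry F) ((volume : Measure 𝔼).prod (volume.restrict (Ioi (0 : ℝ)))) := by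
    rw [integrable_prod_iff hAE]
    refine ⟨ae_of_all _ fun y => ?_, ?_⟩
    · have h2 : IntegrableOn (fun s => (((Iio (‖y‖ / ε)).indicator (densW d) s : ℝ) : ℂ)) (Ioi 0) :=
        (integrableOn_densW.indicator measurableSet_Iio).ofReal
      exact h2.const_mul (f (x - y) * (rieszZ i y : ℂ))
    · refine (integrable_mul_conjK i hε hf x).norm.congr (ae_of_all _ fun y => ?_)
      change _ = ∫ s in Ioi (0 : ℝ), ‖F y s‖
      simp only []
      rw [setIntegral_congr_fun measurableSet_Ioi (fun s hs => hnorm y s hs), integral_const_mul,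
        integral_indicator_densW (by positivity), norm_mul, norm_mul, conjK_eq_rieszZ_mul i hε,
        Complex.norm_real, Complex.norm_real, norm_mul, mul_assoc]
      congr 2
      rw [Real.norm_of_nonneg]
      unfold cumW; positivity
  have h1 : kconv (conjK i ε) f x = ∫ y, ∫ s in Ioi (0 : ℝ), F y s := by
    unfold kconv
    refine integral_congr_ae (ae_of_all _ fun y => ?_)
    simp only [hF]
    rw [integral_const_mul, integral_complex_ofReal, integral_indicator_densW (by positivity),
      conjK_eq_rieszZ_mul i hε]
    push_cast
    ring
  have h2 : ∀ s, ∫ y, F y s = (densW d s : ℂ) * truncE i f x (ε * s) := ?_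
  · rw [h1, integral_integral_swap hI]
    simp_rw [← h2]
    exact ⟨hI.integral_prod_right, trivial⟩
  intro s
  have hm : MeasurableSet {y : 𝔼 | ε * s < ‖y‖} := measurableSet_lt measurable_const measurable_norm
  simp only [truncE]
  rw [← integral_indicator hm, ← integral_const_mul]
  refine integral_congr_ae (ae_of_all _ fun y => ?_)
  by_cases h : ε * s < ‖y‖
  · have h' : s < ‖y‖ / ε := by rwa [lt_div_iff₀ hε, mul_comm]
    simp only [hF, indicator, mem_Iio, h', mem_ofPred_eq, h, if_true]
    ring
  · have h' : ¬ s < ‖y‖ / ε := by rwa [lt_div_iff₀ hε, mul_comm]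
    simp only [hF, indicator, mem_Iio, h', mem_ofPred_eq, h, if_false]
    simp

/-- Convergence of the truncated integrals implies convergence of the smooth means. -/
lemma tendsto_kconv_conj (i : Fin d) {f : 𝔼 → ℂ} (hf : Integrable f) (x : 𝔼) {L : ℂ}
    (h : Tendsto (fun ε => truncE i f x ε) (𝓝[>] 0) (𝓝 L)) :
    Tendsto (fun ε => kconv (conjK i ε) f x) (𝓝[>] 0) (𝓝 L) := by
  obtain ⟨s₀, hs₀, hb⟩ : ∃ s₀ > 0, ∀ s ∈ Ioo (0 : ℝ) s₀, ‖truncE i f x s‖ ≤ ‖L‖ + 1 := by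
    have h1 : ∀ᶠ s in 𝓝[>] (0 : ℝ), ‖truncE i f x s‖ ≤ ‖L‖ + 1 :=
      (h.norm).eventually_le_const (lt_add_one _)
    obtain ⟨s₀, h0, h2⟩ := mem_nhdsGT_iff_exists_Ioo_subset.1 h1
    exact ⟨s₀, h0, fun s hs => h2 hs⟩
  set M := max (‖L‖ + 1) (rieszConst d / s₀ ^ d * ∫ y, ‖f y‖) with hM
  have hC := rieszConst_pos d
  have hI0 : 0 ≤ ∫ y, ‖f y‖ := integral_nonneg fun _ => norm_nonneg _
  have hbd : ∀ s > 0, ‖truncE i f x s‖ ≤ M := by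
    intro s hs
    rcases lt_or_ge s s₀ with h1 | h1
    · exact (hb s ⟨hs, h1⟩).trans (le_max_left _ _)
    · refine (norm_truncE_le i hf x hs).trans (le_trans ?_ (le_max_right _ _))
      gcongr
  have hL : L = ∫ s in Ioi (0 : ℝ), (densW d s : ℂ) * L := by
    rw [integral_mul_const, integral_complex_ofReal, integral_densW]
    simp
  rw [hL]
  have hev : ∀ᶠ ε in 𝓝[>] (0 : ℝ), 0 < ε := self_mem_nhdsWithin
  refine Tendsto.congr' (f₁ := fun ε => ∫ s in Ioi (0 : ℝ), (densW d s : ℂ) * truncE i f x (ε * s)) ?_ ?_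
  · filter_upwards [hev] with ε hε
    exact (kconv_conj_eq_average i hε hf x).2.symm
  · refine tendsto_integral_filter_of_dominated_convergence (fun s => densW d s * M) ?_ ?_
      (integrableOn_densW.mul_const M) ?_
    · filter_upwards [hev] with ε hε
      exact (kconv_conj_eq_average i hε hf x).1.aestronglyMeasurable
    · filter_upwards [hev] with ε hε
      refine (ae_restrict_iff' measurableSet_Ioi).2 (ae_of_all _ fun s hs => ?_)
      have hs' : (0 : ℝ) < s := hs
      rw [norm_mul, Complex.norm_real, Real.norm_of_nonneg (densW_nonneg hs'.le)]
      exact mul_le_mul_of_nonneg_left (hbd _ (mul_pos hε hs')) (densW_nonneg hs'.le)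
    · refine (ae_restrict_iff' measurableSet_Ioi).2 (ae_of_all _ fun s hs => ?_)
      refine Tendsto.const_mul _ (h.comp ?_)
      refine tendsto_nhdsWithin_iff.2 ⟨?_, ?_⟩
      · have : Tendsto (fun ε : ℝ => ε * s) (𝓝 0) (𝓝 (0 * s)) := tendsto_id.mul_const s
        rw [zero_mul] at this
        exact this.mono_left nhdsWithin_le_nhds
      · filter_upwards [hev] with ε hε
        exact mul_pos hε hs

end Averaging

section PoissonFacts

open scoped FourierTransform

variable {d : ℕ}

local notation "𝔼" => EuclideanSpace ℝ (Fin d)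

lemma poissonK_nonneg {ε : ℝ} (hε : 0 ≤ ε) (x : 𝔼) : 0 ≤ poissonK d ε x := by
  have := rieszConst_pos d
  unfold poissonK
  positivity

lemma sqrt_sq_add_sq_pos {ε : ℝ} (hε : 0 < ε) (x : 𝔼) : 0 < Real.sqrt (‖x‖ ^ 2 + ε ^ 2) :=
  Real.sqrt_pos.2 (by positivity)

lemma continuous_poissonK {ε : ℝ} (hε : 0 < ε) : Continuous (poissonK d ε) := by
  unfold poissonK
  have : ∀ y : 𝔼, Real.sqrt (‖y‖ ^ 2 + ε ^ 2) ^ (d + 1) ≠ 0 := fun y =>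
    pow_ne_zero _ (sqrt_sq_add_sq_pos hε y).ne'
  fun_prop (disch := assumption)

lemma integrable_poissonK {ε : ℝ} (hε : 0 < ε) : Integrable (poissonK d ε) := by
  have hI := integrable_one_add_norm (E := 𝔼) (μ := volume)
    (r := ((d + 1 : ℕ) : ℝ)) (by rw [finrank_euclideanSpace, Fintype.card_fin]; push_cast; linarith)
  refine (hI.const_mul (rieszConst d * ε * (1 + ε⁻¹) ^ (d + 1))).mono'
    (continuous_poissonK hε).aestronglyMeasurable (ae_of_all _ fun x => ?_)
  have hD := sqrt_sq_add_sq_pos hε x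
  have h1 : ‖x‖ ≤ Real.sqrt (‖x‖ ^ 2 + ε ^ 2) := Real.le_sqrt_of_sq_le (by nlinarith)
  have h2 : ε ≤ Real.sqrt (‖x‖ ^ 2 + ε ^ 2) :=
    Real.le_sqrt_of_sq_le (by nlinarith [sq_nonneg ‖x‖])
  have hC := rieszConst_pos d
  have hx := norm_nonneg x
  rw [Real.norm_of_nonneg (poissonK_nonneg hε.le x), Real.rpow_neg (by positivity),
    Real.rpow_natCast, poissonK, mul_assoc _ (_ ^ _) (_⁻¹), div_eq_mul_inv]
  refine mul_le_mul_of_nonneg_left ?_ (by positivity)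
  rw [← div_eq_mul_inv, ← div_pow, ← inv_pow]
  refine pow_le_pow_left₀ (by positivity) ?_ _
  rw [inv_le_comm₀ hD (by positivity), inv_div, div_le_iff₀ (by positivity)]
  have : 1 ≤ ε⁻¹ * Real.sqrt (‖x‖ ^ 2 + ε ^ 2) := by
    rw [inv_mul_eq_div, one_le_div hε]; exact h2
  nlinarith

lemma integral_poissonK {ε : ℝ} (hε : 0 < ε) : ∫ x : 𝔼, poissonK d ε x = 1 := by
  have e : 𝓕⁻ (poissonM d ε) = fun x => (poissonK d ε x : ℂ) :=
    funext fun x => fourierInv_poissonM hε x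
  have hc : Continuous (poissonM d ε) := by unfold poissonM; fun_prop
  have hi : Integrable (𝓕 (poissonM d ε)) := by
    have : 𝓕 (poissonM d ε) = fun x => 𝓕⁻ (poissonM d ε) (-x) := funext fun x => by
      rw [Real.fourierInv_eq_fourier_neg, neg_neg]
    rw [this, e]
    exact ((integrable_poissonK hε).ofReal (𝕜 := ℂ)).comp_neg
  have := congrFun (Continuous.fourier_fourierInv_eq hc (integrable_poissonM hε) hi) 0
  rw [e, Real.fourier_eq'] at this
  simp only [inner_zero_right, mul_zero, Complex.ofReal_zero, zero_mul, Complex.exp_zero,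
    one_smul, integral_complex_ofReal, poissonM, norm_zero, Real.exp_zero] at this
  exact_mod_cast this

lemma lintegral_poissonK {ε : ℝ} (hε : 0 < ε) :
    ∫⁻ x : 𝔼, ENNReal.ofReal (poissonK d ε x) = 1 := by
  rw [← ofReal_integral_eq_lintegral_ofReal (integrable_poissonK hε)
    (ae_of_all _ fun x => poissonK_nonneg hε.le x), integral_poissonK hε, ENNReal.ofReal_one]

/-- The tail profile `δ / |x|^{d+1}` off the ball of radius `δ` is dominated by a Poisson kernel. -/
lemma div_pow_le_poissonK {δ : ℝ} (hδ : 0 < δ) {x : 𝔼} (hx : δ ≤ ‖x‖) :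
    δ / ‖x‖ ^ (d + 1) ≤ (2 ^ (d + 1) / rieszConst d) * poissonK d δ x := by
  have hn : 0 < ‖x‖ := hδ.trans_le hx
  have hD := sqrt_sq_add_sq_pos hδ x
  have h1 : Real.sqrt (‖x‖ ^ 2 + δ ^ 2) ≤ 2 * ‖x‖ := by
    rw [Real.sqrt_le_left (by positivity)]
    nlinarith
  have hC := rieszConst_pos d
  have h2 : (2 ^ (d + 1) / rieszConst d) * poissonK d δ x =
      δ * 2 ^ (d + 1) / Real.sqrt (‖x‖ ^ 2 + δ ^ 2) ^ (d + 1) := by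
    rw [poissonK]; field_simp
  rw [h2, div_le_div_iff₀ (by positivity) (by positivity), mul_assoc, ← mul_pow]
  gcongr

/-- Regularity of the conjugate Poisson kernel, uniformly in the scale. -/
lemma abs_conjK_sub_le (i : Fin d) {ε : ℝ} (hε : 0 < ε) {x y : 𝔼} (hx : x ≠ 0)
    (hxy : ‖x - y‖ ≤ ‖x‖ / 2) :
    |conjK i ε x - conjK i ε y| ≤
      rieszConst d * (1 + (d + 1) * 4 ^ d) * ‖x - y‖ / ‖x‖ ^ (d + 1) := by
  set A := Real.sqrt (‖x‖ ^ 2 + ε ^ 2) with hA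
  set B := Real.sqrt (‖y‖ ^ 2 + ε ^ 2) with hB
  have hAp : 0 < A := sqrt_sq_add_sq_pos hε x
  have hBp : 0 < B := sqrt_sq_add_sq_pos hε y
  have hxA : ‖x‖ ≤ A := Real.le_sqrt_of_sq_le (by nlinarith)
  have hyB : ‖y‖ ≤ B := Real.le_sqrt_of_sq_le (by nlinarith)
  have hxp : 0 < ‖x‖ := norm_pos_iff.2 hx
  have hA2 : A ^ 2 = ‖x‖ ^ 2 + ε ^ 2 := Real.sq_sqrt (by positivity)
  have hB2 : B ^ 2 = ‖y‖ ^ 2 + ε ^ 2 := Real.sq_sqrt (by positivity)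
  have hxy' := abs_norm_sub_norm_le x y
  have hAB : |A - B| ≤ ‖x - y‖ := by
    refine le_trans ?_ hxy'
    have h1 : (A - B) * (A + B) = (‖x‖ - ‖y‖) * (‖x‖ + ‖y‖) := by nlinarith
    have h2 : |A - B| * (A + B) = |‖x‖ - ‖y‖| * (‖x‖ + ‖y‖) := by
      rw [← abs_of_pos (add_pos hAp hBp), ← abs_mul, h1, abs_mul,
        abs_of_nonneg (add_nonneg (norm_nonneg x) (norm_nonneg y))]
    have h3 : |A - B| * (A + B) ≤ |‖x‖ - ‖y‖| * (A + B) := by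
      rw [h2]; gcongr
    exact le_of_mul_le_mul_right h3 (by positivity)
  obtain ⟨hl, hr⟩ := abs_le.1 hAB
  have hBA : A / 2 ≤ B := by linarith
  have hBA' : B ≤ 2 * A := by linarith
  have hC := rieszConst_pos d
  have hpow : |B ^ (d + 1) - A ^ (d + 1)| ≤ ‖x - y‖ * (d + 1) * (2 * A) ^ d := by
    refine (abs_pow_sub_pow_le _ _ _).trans ?_
    rw [Nat.add_sub_cancel, abs_of_pos hAp, abs_of_pos hBp, abs_sub_comm]
    push_cast
    gcongr
    exact max_le hBA' (by linarith)
  have key : conjK i ε x - conjK i ε y = rieszConst d * ((x i - y i) / A ^ (d + 1) +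
      y i * ((B ^ (d + 1) - A ^ (d + 1)) / (A ^ (d + 1) * B ^ (d + 1)))) := by
    rw [conjK, conjK, ← hA, ← hB]
    field_simp
    ring
  have h4 : |x i - y i| ≤ ‖x - y‖ := abs_coord_le i (x - y)
  have h5 : |y i| ≤ B := (abs_coord_le i y).trans hyB
  have h6 : |y i * ((B ^ (d + 1) - A ^ (d + 1)) / (A ^ (d + 1) * B ^ (d + 1)))| ≤
      (d + 1) * 4 ^ d * ‖x - y‖ / A ^ (d + 1) := by
    rw [abs_mul, abs_div, abs_of_pos (by positivity : 0 < A ^ (d + 1) * B ^ (d + 1))]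
    calc _ ≤ B * ((‖x - y‖ * (d + 1) * (2 * A) ^ d) / (A ^ (d + 1) * B ^ (d + 1))) := by gcongr
      _ = (‖x - y‖ * (d + 1) * (2 * A) ^ d) / (A ^ (d + 1) * B ^ d) := by
        rw [pow_succ B]; field_simp
      _ ≤ (‖x - y‖ * (d + 1) * (2 * A) ^ d) / (A ^ (d + 1) * (A / 2) ^ d) := by gcongr
      _ = _ := by
        rw [div_pow, mul_pow, show (4 : ℝ) = 2 * 2 by norm_num, mul_pow]
        field_simp
  rw [key, abs_mul, abs_of_pos hC, mul_assoc (rieszConst d), mul_div_assoc]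
  refine mul_le_mul_of_nonneg_left ?_ hC.le
  calc _ ≤ ‖x - y‖ / A ^ (d + 1) + (d + 1) * 4 ^ d * ‖x - y‖ / A ^ (d + 1) := by
        refine (abs_add_le _ _).trans (add_le_add ?_ h6)
        rw [abs_div, abs_of_pos (by positivity : 0 < A ^ (d + 1))]
        gcongr
    _ = (1 + (d + 1) * 4 ^ d) * ‖x - y‖ / A ^ (d + 1) := by ring
    _ ≤ _ := by gcongr

end PoissonFacts

section MaximalSet

variable {d : ℕ}

local notation "𝔼" => EuclideanSpace ℝ (Fin d)

/-- The set where the (centered, normalized) maximal function of `h` exceeds `c`. -/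
def maxSet (h : 𝔼 → ℂ) (c : ℝ) : Set 𝔼 :=
  {x | ∃ r : ℝ, 0 < r ∧ c * r ^ d < ∫ y in Metric.closedBall x r, ‖h y‖}

/-- The volume of the unit ball. -/
def ballC (d : ℕ) : ℝ := (volume (Metric.ball (0 : EuclideanSpace ℝ (Fin d)) 1)).toReal

lemma ballC_pos : 0 < ballC d :=
  ENNReal.toReal_pos (Metric.measure_ball_pos _ _ one_pos).ne' measure_ball_lt_top.ne

lemma volume_closedBallE (x : 𝔼) {r : ℝ} (hr : 0 ≤ r) :
    volume (Metric.closedBall x r) = ENNReal.ofReal (r ^ d * ballC d) := by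
  rw [Measure.addHaar_closedBall _ _ hr, finrank_euclideanSpace, Fintype.card_fin,
    ENNReal.ofReal_mul (by positivity), ballC, ENNReal.ofReal_toReal measure_ball_lt_top.ne]

lemma volume_ballE (x : 𝔼) {r : ℝ} (hr : 0 < r) :
    volume (Metric.ball x r) = ENNReal.ofReal (r ^ d * ballC d) := by
  rw [Measure.addHaar_ball_of_pos _ _ hr, finrank_euclideanSpace, Fintype.card_fin,
    ENNReal.ofReal_mul (by positivity), ballC, ENNReal.ofReal_toReal measure_ball_lt_top.ne]

lemma isOpen_maxSet {h : 𝔼 → ℂ} (hh : Integrable h) (c : ℝ) : IsOpen (maxSet h c) := by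
  rw [Metric.isOpen_iff]
  rintro x ⟨r, hr, hx⟩
  have hc : ContinuousAt (fun s : ℝ => c * (r + s) ^ d) 0 := by fun_prop
  have : ∀ᶠ s in 𝓝 (0 : ℝ), c * (r + s) ^ d < ∫ y in Metric.closedBall x r, ‖h y‖ :=
    hc.eventually_lt_const (by simpa using hx)
  obtain ⟨s, hs, hs2⟩ := Metric.eventually_nhds_iff_ball.1 this
  refine ⟨s / 2, half_pos hs, fun x' hx' => ⟨r + s / 2, by positivity, ?_⟩⟩
  refine (hs2 (s / 2) (by simp [abs_of_pos hs]; linarith)).trans_le ?_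
  refine setIntegral_mono_set hh.norm.integrableOn (ae_of_all _ fun _ => norm_nonneg _)
    (LE.le.eventuallyLE ?_)
  refine Metric.closedBall_subset_closedBall' ?_
  rw [Metric.mem_ball, dist_comm] at hx'
  linarith

lemma volume_maxSet_le (hd : 0 < d) {h : 𝔼 → ℂ} (hh : Integrable h) {c : ℝ} (hc : 0 < c) :
    volume (maxSet h c) ≤ ENNReal.ofReal (4 ^ d * ballC d / c * ∫ y, ‖h y‖) := by
  choose! r hr hrc using (fun x (hx : x ∈ maxSet h c) => hx)
  set I := ∫ y, ‖h y‖ with hI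
  have hR : ∀ x ∈ maxSet h c, r x ≤ max 1 (I / c) := by
    intro x hx
    by_contra! hlt
    have h1 : 1 < r x := (le_max_left _ _).trans_lt hlt
    have h2 : I / c < r x := (le_max_right _ _).trans_lt hlt
    have h3 : c * r x ^ d < I := (hrc x hx).trans_le
      (setIntegral_le_integral hh.norm (ae_of_all _ fun _ => norm_nonneg _))
    have h4 : r x ≤ r x ^ d := le_self_pow₀ h1.le hd.ne'
    rw [div_lt_iff₀ hc] at h2
    nlinarith
  obtain ⟨u, hu, hdisj, hcov⟩ := Vitali.exists_disjoint_subfamily_covering_enlargement_closedBall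
    (maxSet h c) id r _ hR 4 (by norm_num)
  have hcount : u.Countable := by
    refine hdisj.countable_of_nonempty_interior fun x hx => ?_
    refine ⟨x, Metric.ball_subset_interior_closedBall ?_⟩
    exact Metric.mem_ball_self (hr x (hu hx))
  have : Countable u := hcount.to_subtype
  have hsub : maxSet h c ⊆ ⋃ x : u, Metric.closedBall (x : 𝔼) (4 * r x) := by
    intro x hx
    obtain ⟨z, hz, hz2⟩ := hcov x hx
    exact mem_iUnion.2 ⟨⟨z, hz⟩, hz2 (Metric.mem_closedBall_self (hr x hx).le)⟩
  calc volume (maxSet h c) ≤ ∑' x : u, volume (Metric.closedBall (x : 𝔼) (4 * r x)) :=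
        (measure_mono hsub).trans (measure_iUnion_le _)
    _ ≤ ∑' x : u, ENNReal.ofReal (4 ^ d * ballC d / c) *
          ∫⁻ y in Metric.closedBall (x : 𝔼) (r x), ‖h y‖ₑ := by
        refine ENNReal.tsum_le_tsum fun x => ?_
        have hx := hu x.2
        rw [volume_closedBallE _ (by linarith [hr x hx]),
          ← ofReal_integral_norm_eq_lintegral_enorm hh.integrableOn,
          ← ENNReal.ofReal_mul (by have := ballC_pos (d := d); positivity)]
        refine ENNReal.ofReal_le_ofReal ?_
        have := hrc x hx
        have hb := ballC_pos (d := d)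
        calc (4 * r x) ^ d * ballC d = 4 ^ d * ballC d / c * (c * r x ^ d) := by
              rw [mul_pow]; field_simp
          _ ≤ _ := by gcongr
    _ = ENNReal.ofReal (4 ^ d * ballC d / c) *
          ∫⁻ y in ⋃ x : u, Metric.closedBall (x : 𝔼) (r x), ‖h y‖ₑ := by
        rw [ENNReal.tsum_mul_left, lintegral_iUnion (fun x => Metric.isClosed_closedBall.measurableSet)]
        intro x y hxy
        exact hdisj x.2 y.2 (fun h => hxy (Subtype.ext h))
    _ ≤ ENNReal.ofReal (4 ^ d * ballC d / c) * ∫⁻ y, ‖h y‖ₑ := by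
        exact mul_le_mul_right (setLIntegral_le_lintegral _ _) _
    _ = _ := by
        rw [← ofReal_integral_norm_eq_lintegral_enorm hh,
          ← ENNReal.ofReal_mul (by have := ballC_pos (d := d); positivity)]

lemma ae_norm_le_of_notMem_maxSet {h : 𝔼 → ℂ} (hh : Integrable h) (c : ℝ) :
    ∀ᵐ x, x ∉ maxSet h c → ‖h x‖ ≤ c / ballC d := by
  filter_upwards [IsUnifLocDoublingMeasure.ae_tendsto_average (μ := (volume : Measure 𝔼))
    hh.norm.locallyIntegrable 1] with x hx hxm
  have h1 := hx (l := 𝓝[>] (0 : ℝ)) (fun _ => x) id tendsto_id (by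
    filter_upwards [self_mem_nhdsWithin] with r hr
    exact Metric.mem_closedBall_self (by simpa using (mem_Ioi.1 hr).le))
  refine le_of_tendsto h1 ?_
  filter_upwards [self_mem_nhdsWithin] with r hr
  rw [mem_Ioi] at hr
  have hb := ballC_pos (d := d)
  have h2 : ∫ y in Metric.closedBall x r, ‖h y‖ ≤ c * r ^ d := by
    by_contra! hlt
    exact hxm ⟨r, hr, hlt⟩
  rw [setAverage_eq, measureReal_def, id, volume_closedBallE x hr.le,
    ENNReal.toReal_ofReal (by positivity), smul_eq_mul, inv_mul_le_iff₀ (by positivity)]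
  calc _ ≤ _ := h2
    _ = _ := by field_simp

end MaximalSet

section Decomposition

variable {d : ℕ}

local notation "𝔼" => EuclideanSpace ℝ (Fin d)

/-- Averaging kernel over the ball of radius half the distance to the complement of `Ω`. -/
def whitK (Ω : Set 𝔼) (y u : 𝔼) : ℝ :=
  if dist y u < Metric.infDist y Ωᶜ / 2 then ((Metric.infDist y Ωᶜ / 2) ^ d * ballC d)⁻¹ else 0

variable {Ω : Set (EuclideanSpace ℝ (Fin d))}

lemma measurable_whitK (Ω : Set 𝔼) : Measurable (fun p : 𝔼 × 𝔼 => whitK Ω p.1 p.2) := by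
  have h : Measurable fun p : 𝔼 × 𝔼 => Metric.infDist p.1 Ωᶜ :=
    (Metric.continuous_infDist_pt _).measurable.comp measurable_fst
  refine Measurable.ite (measurableSet_lt (measurable_fst.dist measurable_snd) (h.div_const 2)) ?_
    measurable_const
  exact ((h.div_const 2).pow_const d |>.mul_const _).inv

lemma whitK_nonneg (y u : 𝔼) : 0 ≤ whitK Ω y u := by
  unfold whitK
  have := ballC_pos (d := d)
  have := Metric.infDist_nonneg (x := y) (s := Ωᶜ)
  split_ifs <;> positivity

lemma infDist_compl_pos (hΩ : IsOpen Ω) (hne : Ωᶜ.Nonempty) {y : 𝔼} (hy : y ∈ Ω) :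
    0 < Metric.infDist y Ωᶜ :=
  (hΩ.isClosed_compl.notMem_iff_infDist_pos hne).1 (by simpa using hy)

lemma whitK_eq_indicator (y : 𝔼) : whitK Ω y =
    (Metric.ball y (Metric.infDist y Ωᶜ / 2)).indicator
      (fun _ => ((Metric.infDist y Ωᶜ / 2) ^ d * ballC d)⁻¹) := by
  ext u
  simp only [whitK, indicator, Metric.mem_ball, dist_comm u y]

lemma whitK_eq_zero_left {y : 𝔼} (hy : y ∉ Ω) (u : 𝔼) : whitK Ω y u = 0 := by
  rw [whitK, Metric.infDist_zero_of_mem (mem_compl hy), if_neg]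
  simp [dist_nonneg]

lemma whitK_eq_zero_right {u : 𝔼} (hu : u ∉ Ω) (y : 𝔼) : whitK Ω y u = 0 := by
  rw [whitK, if_neg]
  have := Metric.infDist_le_dist_of_mem (x := y) (mem_compl hu)
  have := dist_nonneg (x := y) (y := u)
  linarith

lemma integrable_whitK (y : 𝔼) : Integrable (whitK Ω y) := by
  rw [whitK_eq_indicator, integrable_indicator_iff Metric.isOpen_ball.measurableSet]
  exact integrableOn_const measure_ball_lt_top.ne

lemma integral_whitK (hΩ : IsOpen Ω) (hne : Ωᶜ.Nonempty) {y : 𝔼} (hy : y ∈ Ω) :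
    ∫ u, whitK Ω y u = 1 := by
  have h := infDist_compl_pos hΩ hne hy
  have hb := ballC_pos (d := d)
  rw [whitK_eq_indicator, integral_indicator Metric.isOpen_ball.measurableSet, setIntegral_const,
    measureReal_def, volume_ballE _ (by positivity), ENNReal.toReal_ofReal (by positivity), smul_eq_mul,
    mul_inv_cancel₀ (by positivity)]

variable {h : EuclideanSpace ℝ (Fin d) → ℂ}

lemma integral_norm_whitK_mul (hΩ : IsOpen Ω) (hne : Ωᶜ.Nonempty) (y : 𝔼) :
    ∫ u, ‖h y * (whitK Ω y u : ℂ)‖ = Ω.indicator (fun y => ‖h y‖) y := by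
  simp_rw [norm_mul, Complex.norm_real, Real.norm_of_nonneg (whitK_nonneg _ _)]
  rw [integral_const_mul]
  by_cases hy : y ∈ Ω
  · rw [integral_whitK hΩ hne hy, indicator_of_mem hy, mul_one]
  · simp [whitK_eq_zero_left hy, hy]

lemma integrable_prod_whitK (hh : Integrable h) (hΩ : IsOpen Ω) (hne : Ωᶜ.Nonempty) :
    Integrable (fun p : 𝔼 × 𝔼 => h p.1 * (whitK Ω p.1 p.2 : ℂ)) (volume.prod volume) := by
  have hm : AEStronglyMeasurable (fun p : 𝔼 × 𝔼 => h p.1 * (whitK Ω p.1 p.2 : ℂ))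
      (volume.prod volume) := hh.1.comp_fst.mul
    (Complex.measurable_ofReal.comp (measurable_whitK Ω)).aestronglyMeasurable
  refine (integrable_prod_iff hm).2 ⟨?_, ?_⟩
  · exact ae_of_all _ fun y => ((integrable_whitK (Ω := Ω) y).ofReal (𝕜 := ℂ)).const_mul (h y)
  · simp only [integral_norm_whitK_mul hΩ hne]
    exact hh.norm.indicator hΩ.measurableSet

/-- The smoothed bad part. -/
def whitAvg (Ω : Set 𝔼) (h : 𝔼 → ℂ) (u : 𝔼) : ℂ := ∫ y, h y * (whitK Ω y u : ℂ)

lemma integrable_whitAvg (hh : Integrable h) (hΩ : IsOpen Ω) (hne : Ωᶜ.Nonempty) :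
    Integrable (whitAvg Ω h) :=
  (integrable_prod_whitK hh hΩ hne).integral_prod_right

lemma integral_norm_whitAvg_le (hh : Integrable h) (hΩ : IsOpen Ω) (hne : Ωᶜ.Nonempty) :
    ∫ u, ‖whitAvg Ω h u‖ ≤ ∫ y, ‖h y‖ := by
  have hw := integrable_prod_whitK hh hΩ hne
  calc ∫ u, ‖whitAvg Ω h u‖ ≤ ∫ u, ∫ y, ‖h y * (whitK Ω y u : ℂ)‖ :=
        integral_mono (integrable_whitAvg hh hΩ hne).norm hw.norm.integral_prod_right
          fun u => norm_integral_le_integral_norm _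
    _ = ∫ y, ∫ u, ‖h y * (whitK Ω y u : ℂ)‖ := integral_integral_swap hw.norm.swap
    _ = ∫ y, Ω.indicator (fun y => ‖h y‖) y := by simp only [integral_norm_whitK_mul hΩ hne]
    _ ≤ _ := integral_mono (hh.norm.indicator hΩ.measurableSet) hh.norm
        (indicator_le_self' fun _ _ => norm_nonneg _)

lemma norm_whitAvg_le (hh : Integrable h) {c : ℝ} (hc : 0 < c)
    (hne : (maxSet h c)ᶜ.Nonempty) (u : 𝔼) :
    ‖whitAvg (maxSet h c) h u‖ ≤ 9 ^ d / ballC d * c := by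
  set Ω := maxSet h c with hΩdef
  have hΩ : IsOpen Ω := isOpen_maxSet hh c
  have hb := ballC_pos (d := d)
  by_cases hu : u ∈ Ω
  swap
  · simp only [whitAvg, whitK_eq_zero_right hu]
    simp only [Complex.ofReal_zero, mul_zero, integral_zero, norm_zero]
    positivity
  set D := Metric.infDist u Ωᶜ with hD
  have hDp : 0 < D := infDist_compl_pos hΩ hne hu
  obtain ⟨z, hz, hz2⟩ := (Metric.infDist_lt_iff hne).1 (show D < 2 * D by linarith)
  set K := ((D / 3) ^ d * ballC d)⁻¹ with hK
  have hKp : 0 < K := by positivity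
  have hbound : ∀ y, ‖h y * (whitK Ω y u : ℂ)‖ ≤
      K * (Metric.closedBall z (3 * D)).indicator (fun y => ‖h y‖) y := by
    intro y
    rw [norm_mul, Complex.norm_real, Real.norm_of_nonneg (whitK_nonneg _ _), mul_comm]
    by_cases hy : dist y u < Metric.infDist y Ωᶜ / 2
    · have h1 : Metric.infDist y Ωᶜ ≤ D + dist y u := Metric.infDist_le_infDist_add_dist
      have h2 : D ≤ Metric.infDist y Ωᶜ + dist u y := Metric.infDist_le_infDist_add_dist
      rw [dist_comm u y] at h2
      have hmem : y ∈ Metric.closedBall z (3 * D) := by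
        rw [Metric.mem_closedBall]
        have := dist_triangle y u z
        linarith
      rw [indicator_of_mem hmem, whitK, if_pos hy, hK]
      have : D / 3 ≤ Metric.infDist y Ωᶜ / 2 := by linarith
      gcongr
    · rw [whitK, if_neg hy, zero_mul]
      exact mul_nonneg hKp.le (indicator_nonneg (fun _ _ => norm_nonneg _) _)
  have hms : MeasurableSet (Metric.closedBall z (3 * D)) := Metric.isClosed_closedBall.measurableSet
  have h3 : ∫ y in Metric.closedBall z (3 * D), ‖h y‖ ≤ c * (3 * D) ^ d := by
    by_contra! hlt
    exact hz ⟨3 * D, by positivity, hlt⟩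
  refine (norm_integral_le_of_norm_le ((hh.norm.indicator hms).const_mul K)
    (ae_of_all _ hbound)).trans ?_
  rw [integral_const_mul, integral_indicator hms]
  calc _ ≤ K * (c * (3 * D) ^ d) := by gcongr
    _ = _ := by
      rw [hK, show (9 : ℝ) = 3 * 3 by norm_num, mul_pow, mul_pow, div_pow]
      field_simp

lemma kconv_eq_integral (k : 𝔼 → ℝ) (f : 𝔼 → ℂ) (x : 𝔼) :
    kconv k f x = ∫ u, f u * (k (x - u) : ℂ) := by
  rw [kconv, ← integral_sub_left_eq_self _ volume x]
  simp only [sub_sub_cancel]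

lemma kconv_bad_eq (i : Fin d) (hh : Integrable h) (hΩ : IsOpen Ω) (hne : Ωᶜ.Nonempty)
    {ε : ℝ} (hε : 0 < ε) (x : 𝔼) :
    kconv (conjK i ε) (fun u => Ω.indicator h u - whitAvg Ω h u) x =
      ∫ y, ∫ u, h y * (whitK Ω y u : ℂ) * ((conjK i ε (x - y) - conjK i ε (x - u) : ℝ) : ℂ) := by
  have hw := integrable_prod_whitK hh hΩ hne
  have hbd : ∀ z : 𝔼, ‖(conjK i ε z : ℂ)‖ ≤ rieszConst d / ε ^ d := fun z => by
    rw [Complex.norm_real, Real.norm_eq_abs]; exact abs_conjK_le i hε z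
  have hcq : Continuous fun z : 𝔼 => (conjK i ε z : ℂ) :=
    Complex.continuous_ofReal.comp (continuous_conjK i hε)
  have hw1 : Integrable (fun p : 𝔼 × 𝔼 => h p.1 * (whitK Ω p.1 p.2 : ℂ) *
      (conjK i ε (x - p.1) : ℂ)) (volume.prod volume) :=
    hw.mul_bdd (hcq.comp (by fun_prop)).aestronglyMeasurable (ae_of_all _ fun p => hbd _)
  have hw2 : Integrable (fun p : 𝔼 × 𝔼 => h p.1 * (whitK Ω p.1 p.2 : ℂ) *
      (conjK i ε (x - p.2) : ℂ)) (volume.prod volume) :=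
    hw.mul_bdd (hcq.comp (by fun_prop)).aestronglyMeasurable (ae_of_all _ fun p => hbd _)
  have hI1 : Integrable (fun u => Ω.indicator h u * (conjK i ε (x - u) : ℂ)) :=
    (hh.indicator hΩ.measurableSet).mul_bdd (hcq.comp (by fun_prop)).aestronglyMeasurable
      (ae_of_all _ fun p => hbd _)
  have hI2 : Integrable (fun u => whitAvg Ω h u * (conjK i ε (x - u) : ℂ)) :=
    (integrable_whitAvg hh hΩ hne).mul_bdd (hcq.comp (by fun_prop)).aestronglyMeasurable
      (ae_of_all _ fun p => hbd _)
  rw [kconv_eq_integral]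
  simp_rw [sub_mul]
  rw [integral_sub hI1 hI2]
  have e1 : ∫ u, Ω.indicator h u * (conjK i ε (x - u) : ℂ) =
      ∫ y, ∫ u, h y * (whitK Ω y u : ℂ) * (conjK i ε (x - y) : ℂ) := by
    refine integral_congr_ae (ae_of_all _ fun y => ?_)
    simp only []
    rw [integral_mul_const, integral_const_mul, integral_complex_ofReal]
    by_cases hy : y ∈ Ω
    · rw [integral_whitK hΩ hne hy, indicator_of_mem hy, Complex.ofReal_one, mul_one]
    · simp [whitK_eq_zero_left hy, hy]
  have e2 : ∫ u, whitAvg Ω h u * (conjK i ε (x - u) : ℂ) =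
      ∫ y, ∫ u, h y * (whitK Ω y u : ℂ) * (conjK i ε (x - u) : ℂ) := by
    rw [integral_integral_swap hw2]
    refine integral_congr_ae (ae_of_all _ fun u => ?_)
    simp only [whitAvg]
    rw [integral_mul_const]
  rw [e1, e2, ← integral_sub hw1.integral_prod_left hw2.integral_prod_left]
  refine integral_congr_ae ?_
  filter_upwards [hw1.prod_right_ae, hw2.prod_right_ae] with y h1 h2
  rw [← integral_sub h1 h2]
  refine integral_congr_ae (ae_of_all _ fun u => ?_)
  push_cast
  ring

/-- Constant in the estimate of the bad part. -/
def badC (d : ℕ) : ℝ :=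
  rieszConst d * (1 + (d + 1) * 4 ^ d) * (2 ^ (d + 1) / rieszConst d)

lemma badC_pos : 0 < badC d := by
  have := rieszConst_pos d
  unfold badC
  positivity

lemma norm_bad_inner_le (i : Fin d) (hΩ : IsOpen Ω) (hne : Ωᶜ.Nonempty)
    {ε : ℝ} (hε : 0 < ε) {x : 𝔼} (hx : x ∉ Ω) (y : 𝔼) :
    ‖∫ u, h y * (whitK Ω y u : ℂ) * ((conjK i ε (x - y) - conjK i ε (x - u) : ℝ) : ℂ)‖ ≤
      Ω.indicator (fun y => ‖h y‖ * (badC d * poissonK d (Metric.infDist y Ωᶜ) (x - y))) y := by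
  by_cases hy : y ∈ Ω
  swap
  · simp [whitK_eq_zero_left hy, hy]
  rw [indicator_of_mem hy]
  set δ := Metric.infDist y Ωᶜ with hδ
  have hδp : 0 < δ := infDist_compl_pos hΩ hne hy
  have hxy : δ ≤ ‖x - y‖ := by
    rw [← dist_eq_norm, dist_comm]
    exact Metric.infDist_le_dist_of_mem (mem_compl hx)
  have hxy0 : 0 < ‖x - y‖ := hδp.trans_le hxy
  have hC := rieszConst_pos d
  set L := rieszConst d * (1 + (d + 1) * 4 ^ d) with hL
  have hLp : 0 < L := by positivity
  have hb : ∀ u, ‖h y * (whitK Ω y u : ℂ) * ((conjK i ε (x - y) - conjK i ε (x - u) : ℝ) : ℂ)‖ ≤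
      ‖h y‖ * (L * (δ / ‖x - y‖ ^ (d + 1))) * whitK Ω y u := by
    intro u
    rw [norm_mul, norm_mul, Complex.norm_real, Complex.norm_real,
      Real.norm_of_nonneg (whitK_nonneg _ _), Real.norm_eq_abs]
    by_cases hu : dist y u < δ / 2
    · have h1 : ‖(x - y) - (x - u)‖ < δ / 2 := by
        rw [sub_sub_sub_cancel_left, ← dist_eq_norm, dist_comm]; exact hu
      have h2 := abs_conjK_sub_le i hε (norm_pos_iff.1 hxy0) (y := x - u) (by linarith)
      have h3 : |conjK i ε (x - y) - conjK i ε (x - u)| ≤ L * (δ / ‖x - y‖ ^ (d + 1)) := by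
        refine h2.trans ?_
        rw [mul_div_assoc]
        gcongr
        linarith
      calc _ ≤ ‖h y‖ * whitK Ω y u * (L * (δ / ‖x - y‖ ^ (d + 1))) := by
            have := whitK_nonneg (Ω := Ω) y u
            gcongr
        _ = _ := by ring
    · rw [whitK, if_neg hu]; simp
  refine (norm_integral_le_of_norm_le ((integrable_whitK y).const_mul _) (ae_of_all _ hb)).trans ?_
  rw [integral_const_mul, integral_whitK hΩ hne hy, mul_one]
  refine mul_le_mul_of_nonneg_left ?_ (norm_nonneg _)
  rw [badC, ← hL, mul_assoc L]
  exact mul_le_mul_of_nonneg_left (div_pow_le_poissonK hδp hxy) hLp.le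

lemma lintegral_kconv_bad_le (i : Fin d) (hh : Integrable h) (hΩ : IsOpen Ω) (hne : Ωᶜ.Nonempty)
    {ε : ℝ} (hε : 0 < ε) :
    ∫⁻ x in Ωᶜ, ‖kconv (conjK i ε) (fun u => Ω.indicator h u - whitAvg Ω h u) x‖ₑ ≤
      ENNReal.ofReal (badC d * ∫ y, ‖h y‖) := by
  set P : 𝔼 → 𝔼 → ℝ≥0∞ := fun x y => Ω.indicator (fun y => ‖h y‖ₑ *
    (ENNReal.ofReal (badC d) * ENNReal.ofReal (poissonK d (Metric.infDist y Ωᶜ) (x - y)))) y with hP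
  have hbC := badC_pos (d := d)
  have h1 : ∀ x ∈ Ωᶜ, ‖kconv (conjK i ε) (fun u => Ω.indicator h u - whitAvg Ω h u) x‖ₑ ≤
      ∫⁻ y, P x y := by
    intro x hx
    rw [kconv_bad_eq i hh hΩ hne hε]
    refine (enorm_integral_le_lintegral_enorm _).trans (lintegral_mono fun y => ?_)
    rw [← ofReal_norm]
    refine (ENNReal.ofReal_le_ofReal (norm_bad_inner_le i hΩ hne hε hx y)).trans (le_of_eq ?_)
    by_cases hy : y ∈ Ω
    · simp only [hP, indicator_of_mem hy]
      rw [ENNReal.ofReal_mul (norm_nonneg _), ofReal_norm, ENNReal.ofReal_mul hbC.le]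
    · simp [hP, hy]
  have hPm : AEMeasurable (Function.uncurry P) ((volume : Measure 𝔼).prod volume) := by
    have e : Function.uncurry P = (Prod.snd ⁻¹' Ω).indicator (fun p : 𝔼 × 𝔼 => ‖h p.2‖ₑ *
      (ENNReal.ofReal (badC d) *
        ENNReal.ofReal (poissonK d (Metric.infDist p.2 Ωᶜ) (p.1 - p.2)))) := by
      ext p
      rfl
    rw [e]
    refine AEMeasurable.indicator ?_ (measurable_snd hΩ.measurableSet)
    refine hh.1.comp_snd.enorm.mul ?_
    have : Measurable fun p : 𝔼 × 𝔼 => Metric.infDist p.2 Ωᶜ :=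
      (Metric.continuous_infDist_pt _).measurable.comp measurable_snd
    unfold poissonK
    fun_prop
  calc _ ≤ ∫⁻ x in Ωᶜ, ∫⁻ y, P x y := setLIntegral_mono' hΩ.isClosed_compl.measurableSet h1
    _ ≤ ∫⁻ x, ∫⁻ y, P x y := setLIntegral_le_lintegral _ _
    _ = ∫⁻ y, ∫⁻ x, P x y := lintegral_lintegral_swap hPm
    _ ≤ ∫⁻ y, ENNReal.ofReal (badC d) * ‖h y‖ₑ := by
        refine lintegral_mono fun y => ?_
        by_cases hy : y ∈ Ω
        · simp only [hP, indicator_of_mem hy]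
          have hδp := infDist_compl_pos hΩ hne hy
          rw [lintegral_const_mul' _ _ enorm_ne_top,
            lintegral_const_mul' _ _ ENNReal.ofReal_ne_top,
            lintegral_sub_right_eq_self (fun z => ENNReal.ofReal (poissonK d _ z)),
            lintegral_poissonK hδp, mul_one, mul_comm]
        · simp [hP, hy]
    _ = _ := by
        rw [lintegral_const_mul' _ _ ENNReal.ofReal_ne_top,
          ← ofReal_integral_norm_eq_lintegral_enorm hh, ← ENNReal.ofReal_mul hbC.le]

lemma exists_norm_truncation_small {f : 𝔼 → ℂ} (hf : Integrable f) {κ : ℝ} (hκ : 0 < κ) :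
    ∃ (c : ℝ) (g : 𝔼 → ℂ), 1 ≤ c ∧ Integrable g ∧ ∫ x, ‖g x‖ ≤ κ ∧ (∀ x, ‖g x‖ ≤ ‖f x‖) ∧
      ∀ x, ‖f x - g x‖ ≤ c := by
  set T : ℕ → ℂ → ℂ := fun n z => if (n + 1 : ℝ) < ‖z‖ then z else 0 with hT
  have hTm : ∀ n, Measurable (T n) := fun n =>
    Measurable.ite (measurableSet_lt measurable_const measurable_norm) measurable_id measurable_const
  have hTle : ∀ n z, ‖T n z‖ ≤ ‖z‖ := fun n z => by
    simp only [hT]; split_ifs <;> simp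
  have hsm : ∀ n, AEStronglyMeasurable (fun x => T n (f x)) := fun n =>
    ((hTm n).comp_aemeasurable hf.1.aemeasurable).aestronglyMeasurable
  have hlim : Tendsto (fun n => ∫ x, ‖T n (f x)‖) atTop (𝓝 (∫ _ : 𝔼, (0 : ℝ))) := by
    refine tendsto_integral_of_dominated_convergence (fun x => ‖f x‖) (fun n => (hsm n).norm) hf.norm
      (fun n => ae_of_all _ fun x => by rw [norm_norm]; exact hTle n _) (ae_of_all _ fun x => ?_)
    obtain ⟨N, hN⟩ := exists_nat_gt ‖f x‖
    refine tendsto_const_nhds.congr' ?_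
    filter_upwards [eventually_ge_atTop N] with n hn
    have : ¬ (n + 1 : ℝ) < ‖f x‖ := by
      have : (N : ℝ) ≤ n := by exact_mod_cast hn
      linarith
    simp [hT, this]
  rw [integral_zero] at hlim
  obtain ⟨n, hn⟩ := (hlim.eventually_le_const hκ).exists
  refine ⟨n + 1, fun x => T n (f x), by simp, hf.mono (hsm n) (ae_of_all _ fun x => hTle n _), hn,
    fun x => hTle n _, fun x => ?_⟩
  simp only [hT]
  split_ifs with h
  · simp; positivity
  · simpa using not_lt.1 h

/-- Calderón–Zygmund decomposition adapted to the conjugate Poisson kernels. -/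
lemma exists_cz_decomposition (hd : 0 < d) (i : Fin d) {f : 𝔼 → ℂ} (hf : Integrable f) {κ : ℝ}
    (hκ : 0 < κ) :
    ∃ (G B : 𝔼 → ℂ) (Ω : Set 𝔼), (∀ x, f x = G x + B x) ∧ Integrable G ∧ MemLp G 2 ∧ Integrable B ∧
      MeasurableSet Ω ∧ volume Ω ≤ ENNReal.ofReal κ ∧ eLpNorm G 2 ^ 2 * volume Ω ≤ ENNReal.ofReal κ ∧
      ∫ x, ‖B x‖ ≤ κ ∧
      ∀ ε : ℝ, 0 < ε → ∫⁻ x in Ωᶜ, ‖kconv (conjK i ε) B x‖ₑ ≤ ENNReal.ofReal κ := by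
  have hb := ballC_pos (d := d)
  have hbad := badC_pos (d := d)
  set A := ∫ x, ‖f x‖ with hA
  have hA0 : 0 ≤ A := integral_nonneg fun _ => norm_nonneg _
  set M := 1 + (1 + 9 ^ d) / ballC d with hM
  set K := 4 ^ d * ballC d with hK
  set C := 2 + badC d + M * (3 * A) * K + K with hC
  have hC0 : 0 < C := by positivity
  obtain ⟨c, h, hc1, hh, hhκ, hhf, hfh⟩ := exists_norm_truncation_small hf (div_pos hκ hC0)
  have hc : 0 < c := one_pos.trans_le hc1
  have hK0 : 0 < K := by positivity
  have hhκ' : C * ∫ x, ‖h x‖ ≤ κ := by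
    rw [mul_comm]; exact (le_div_iff₀ hC0).1 hhκ
  set H := ∫ x, ‖h x‖ with hH
  have hH0 : 0 ≤ H := integral_nonneg fun _ => norm_nonneg _
  have hHA : H ≤ A := integral_mono hh.norm hf.norm hhf
  set Ω := maxSet h c with hΩdef
  have hΩ : IsOpen Ω := isOpen_maxSet hh c
  have hvol := volume_maxSet_le hd hh hc
  have hvol' : volume Ω < ∞ := hvol.trans_lt ENNReal.ofReal_lt_top
  have hne : Ωᶜ.Nonempty := by
    by_contra hcon
    rw [not_nonempty_iff_eq_empty, compl_empty_iff] at hcon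
    have : Nontrivial 𝔼 := by
      have : Nonempty (Fin d) := ⟨i⟩
      infer_instance
    rw [hcon, measure_univ_of_isAddLeftInvariant] at hvol'
    exact lt_irrefl _ hvol'
  set B : 𝔼 → ℂ := fun u => Ω.indicator h u - whitAvg Ω h u with hB
  have hBi : Integrable B := (hh.indicator hΩ.measurableSet).sub (integrable_whitAvg hh hΩ hne)
  have hBn : ∫ x, ‖B x‖ ≤ 2 * H := by
    calc ∫ x, ‖B x‖ ≤ ∫ x, (‖h x‖ + ‖whitAvg Ω h x‖) := by
          refine integral_mono hBi.norm (hh.norm.add (integrable_whitAvg hh hΩ hne).norm) fun x => ?_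
          exact (norm_sub_le _ _).trans (add_le_add_left (norm_indicator_le_norm_self _ _) _)
      _ ≤ 2 * H := by
          rw [integral_add hh.norm (integrable_whitAvg hh hΩ hne).norm]
          linarith [integral_norm_whitAvg_le hh hΩ hne]
  set G : 𝔼 → ℂ := fun x => f x - B x with hG
  have hGi : Integrable G := hf.sub hBi
  have hGb : ∀ᵐ x, ‖G x‖ ≤ M * c := by
    filter_upwards [ae_norm_le_of_notMem_maxSet hh c] with x hx
    have h1 : G x = (f x - h x) + (Ωᶜ.indicator h x + whitAvg Ω h x) := by
      have := congrFun (indicator_self_add_compl Ω h) x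
      simp only [Pi.add_apply] at this
      simp only [hG, hB]
      linear_combination -this
    have h2 : ‖Ωᶜ.indicator h x‖ ≤ c / ballC d := by
      by_cases hxΩ : x ∈ Ω
      · simp [hxΩ]; positivity
      · rw [indicator_of_mem (mem_compl hxΩ)]; exact hx hxΩ
    have h3 := norm_whitAvg_le hh hc hne x
    rw [h1]
    calc _ ≤ ‖f x - h x‖ + (‖Ωᶜ.indicator h x‖ + ‖whitAvg Ω h x‖) :=
          (norm_add_le _ _).trans (add_le_add_right (norm_add_le _ _) _)
      _ ≤ c + (c / ballC d + 9 ^ d / ballC d * c) := by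
          gcongr
          exact hfh x
      _ = M * c := by rw [hM]; ring
  have hGn : ∫ x, ‖G x‖ ≤ 3 * A := by
    calc ∫ x, ‖G x‖ ≤ ∫ x, (‖f x‖ + ‖B x‖) :=
          integral_mono hGi.norm (hf.norm.add hBi.norm) fun x => norm_sub_le _ _
      _ ≤ 3 * A := by
          rw [integral_add hf.norm hBi.norm]
          linarith
  have hG2 : eLpNorm G 2 ^ 2 ≤ ENNReal.ofReal (M * c * (3 * A)) := by
    have e : eLpNorm G 2 ^ 2 = ∫⁻ x, ‖G x‖ₑ ^ 2 := by
      rw [eLpNorm_eq_lintegral_rpow_enorm_toReal (by norm_num) (by norm_num), ← ENNReal.rpow_natCast,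
        ← ENNReal.rpow_mul]
      simp
    rw [e]
    calc ∫⁻ x, ‖G x‖ₑ ^ 2 ≤ ∫⁻ x, ENNReal.ofReal (M * c) * ‖G x‖ₑ := by
          refine lintegral_mono_ae ?_
          filter_upwards [hGb] with x hx
          rw [sq]
          gcongr
          rw [← ofReal_norm]
          exact ENNReal.ofReal_le_ofReal hx
      _ = ENNReal.ofReal (M * c * ∫ x, ‖G x‖) := by
          rw [lintegral_const_mul' _ _ ENNReal.ofReal_ne_top,
            ← ofReal_integral_norm_eq_lintegral_enorm hGi, ← ENNReal.ofReal_mul (by positivity)]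
      _ ≤ _ := ENNReal.ofReal_le_ofReal (by gcongr)
  have hGL : MemLp G 2 := by
    refine ⟨hGi.1, ?_⟩
    have := hG2.trans_lt ENNReal.ofReal_lt_top
    by_contra hcon
    rw [not_lt, top_le_iff] at hcon
    simp [hcon] at this
  refine ⟨G, B, Ω, fun x => by simp [hG], hGi, hGL, hBi, hΩ.measurableSet, ?_, ?_, ?_, ?_⟩
  · refine hvol.trans (ENNReal.ofReal_le_ofReal (le_trans ?_ hhκ'))
    rw [← hK, ← hH]
    gcongr
    have : K / c ≤ K := div_le_self hK0.le hc1
    have : 0 ≤ M * (3 * A) * K := by positivity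
    linarith
  · calc _ ≤ ENNReal.ofReal (M * c * (3 * A)) * ENNReal.ofReal (4 ^ d * ballC d / c * H) := by
          gcongr
      _ = ENNReal.ofReal (M * (3 * A) * K * H) := by
          rw [← ENNReal.ofReal_mul (by positivity), ← hK]
          congr 1
          field_simp
      _ ≤ _ := ENNReal.ofReal_le_ofReal (le_trans (by gcongr; rw [hC]; linarith) hhκ')
  · refine hBn.trans (le_trans ?_ hhκ')
    gcongr
    rw [hC]
    have : 0 ≤ M * (3 * A) * K := by positivity
    linarith
  · intro ε hε
    refine (lintegral_kconv_bad_le i hh hΩ hne hε).trans (ENNReal.ofReal_le_ofReal ?_)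
    refine le_trans ?_ hhκ'
    rw [← hH]
    gcongr
    rw [hC]
    have : 0 ≤ M * (3 * A) * K := by positivity
    linarith

end Decomposition

section WeakLimit

open scoped FourierTransform RealInnerProductSpace SchwartzMap

variable {d : ℕ}

local notation "𝔼" => EuclideanSpace ℝ (Fin d)

lemma continuous_kconv_conj (i : Fin d) {f : 𝔼 → ℂ} (hf : Integrable f) {ε : ℝ} (hε : 0 < ε) :
    Continuous (kconv (conjK i ε) f) := by
  rw [show kconv (conjK i ε) f = _ from funext fun x => kconv_conj i hf hε x]
  exact continuous_fourierInvE (integrable_mul_fourier hf (integrable_conjM i hε))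

lemma norm_kconv_conj_le (i : Fin d) {f : 𝔼 → ℂ} (hf : Integrable f) {ε : ℝ} (hε : 0 < ε) (x : 𝔼) :
    ‖kconv (conjK i ε) f x‖ ≤ ∫ ξ, ‖conjM i ε ξ * 𝓕 f ξ‖ := by
  rw [kconv_conj i hf hε x]
  exact norm_fourierInv_le _ _

lemma integrable_kconv_conj_mul (i : Fin d) {f : 𝔼 → ℂ} (hf : Integrable f) {ε : ℝ} (hε : 0 < ε)
    (θ : 𝓢(𝔼, ℂ)) : Integrable (fun x => kconv (conjK i ε) f x * θ x) :=
  θ.integrable.bdd_mul (continuous_kconv_conj i hf hε).aestronglyMeasurable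
    (ae_of_all _ fun x => norm_kconv_conj_le i hf hε x)

lemma integral_kconv_conj_mul (i : Fin d) {f : 𝔼 → ℂ} (hf : Integrable f) {ε : ℝ} (hε : 0 < ε)
    (θ : 𝓢(𝔼, ℂ)) : ∫ x, kconv (conjK i ε) f x * θ x
      = ∫ ξ, conjM i ε ξ * 𝓕 f ξ * 𝓕⁻ (θ : 𝔼 → ℂ) ξ := by
  rw [← integral_fourierInv_mul (integrable_mul_fourier hf (integrable_conjM i hε)) θ.integrable]
  exact integral_congr_ae (ae_of_all _ fun x => by simp only [kconv_conj i hf hε x])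

lemma integrable_fourierInv_schwartz (θ : 𝓢(𝔼, ℂ)) : Integrable (𝓕⁻ (θ : 𝔼 → ℂ)) := by
  rw [← SchwartzMap.fourierInv_coe]
  exact (𝓕⁻ θ).integrable

lemma norm_conjM_le_one (i : Fin d) {ε : ℝ} (hε : 0 ≤ ε) (ξ : 𝔼) : ‖conjM i ε ξ‖ ≤ 1 := by
  refine (norm_conjM_le i ξ).trans (Real.exp_le_one_iff.2 ?_)
  have : 0 ≤ Real.pi * ε * ‖ξ‖ := by positivity
  linarith

lemma norm_integral_kconv_conj_mul_le (i : Fin d) {f : 𝔼 → ℂ} (hf : Integrable f) {ε : ℝ}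
    (hε : 0 < ε) (θ : 𝓢(𝔼, ℂ)) : ‖∫ x, kconv (conjK i ε) f x * θ x‖
      ≤ (∫ x, ‖f x‖) * ∫ ξ, ‖𝓕⁻ (θ : 𝔼 → ℂ) ξ‖ := by
  rw [integral_kconv_conj_mul i hf hε, ← integral_const_mul]
  refine norm_integral_le_of_norm_le ((integrable_fourierInv_schwartz θ).norm.const_mul _)
    (ae_of_all _ fun ξ => ?_)
  rw [norm_mul, norm_mul]
  refine mul_le_mul_of_nonneg_right ?_ (norm_nonneg _)
  calc _ ≤ 1 * ‖𝓕 f ξ‖ := by gcongr; exact norm_conjM_le_one i hε.le ξ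
    _ ≤ _ := by rw [one_mul]; exact norm_fourier_le f ξ

lemma tendsto_integral_kconv_conj_mul (i : Fin d) {f : 𝔼 → ℂ} (hf : Integrable f) (θ : 𝓢(𝔼, ℂ)) :
    Tendsto (fun n : ℕ => ∫ x, kconv (conjK i (1 / ((n : ℝ) + 1))) f x * θ x) atTop
      (𝓝 (∫ ξ, conjM i 0 ξ * 𝓕 f ξ * 𝓕⁻ (θ : 𝔼 → ℂ) ξ)) := by
  have h0 : ∀ n : ℕ, 0 < 1 / ((n : ℝ) + 1) := fun n => by positivity
  simp_rw [fun n => integral_kconv_conj_mul i hf (h0 n) θ]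
  refine tendsto_integral_of_dominated_convergence
    (fun ξ => (∫ x, ‖f x‖) * ‖𝓕⁻ (θ : 𝔼 → ℂ) ξ‖) (fun n => ?_)
    ((integrable_fourierInv_schwartz θ).norm.const_mul _) (fun n => ae_of_all _ fun ξ => ?_)
    (ae_of_all _ fun ξ => ?_)
  · exact ((measurable_conjM i _).aestronglyMeasurable.mul
      (continuous_fourierE hf).aestronglyMeasurable).mul
      (integrable_fourierInv_schwartz θ).aestronglyMeasurable
  · rw [norm_mul, norm_mul]
    refine mul_le_mul_of_nonneg_right ?_ (norm_nonneg _)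
    calc _ ≤ 1 * ‖𝓕 f ξ‖ := by gcongr; exact norm_conjM_le_one i (h0 n).le ξ
      _ ≤ _ := by rw [one_mul]; exact norm_fourier_le f ξ
  · refine Tendsto.mul_const _ (Tendsto.mul_const _ ?_)
    have hc : Continuous fun ε : ℝ => conjM i ε ξ := by
      unfold conjM; fun_prop
    exact (hc.tendsto 0).comp tendsto_one_div_add_atTop_nhds_zero_nat

lemma kconv_add_of_eq (i : Fin d) {ε : ℝ} (hε : 0 < ε) {f G B : 𝔼 → ℂ} (h : ∀ x, f x = G x + B x)
    (hG : Integrable G) (hB : Integrable B) (x : 𝔼) :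
    kconv (conjK i ε) f x = kconv (conjK i ε) G x + kconv (conjK i ε) B x := by
  unfold kconv
  rw [← integral_add (integrable_mul_conjK i hε hG x) (integrable_mul_conjK i hε hB x)]
  exact integral_congr_ae (ae_of_all _ fun y => by simp only [h, add_mul])

lemma eventually_mul_lt (c : ℝ) {t : ℝ} (ht : 0 < t) : ∀ᶠ κ in 𝓝[>] (0 : ℝ), κ * c < t := by
  have : Tendsto (fun κ : ℝ => κ * c) (𝓝[>] 0) (𝓝 0) := by
    have : Tendsto (fun κ : ℝ => κ * c) (𝓝 0) (𝓝 (0 * c)) := tendsto_id.mul_const c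
    rw [zero_mul] at this
    exact this.mono_left nhdsWithin_le_nhds
  exact this.eventually_lt_const ht

/-- Cauchy–Schwarz on a set, for a measure dominated by a multiple of another. -/
lemma sq_setLIntegral_le {X : Type*} [MeasurableSpace X] {μ ν : Measure X} {M : ℝ≥0∞}
    (hν : ν ≤ M • μ) {F : X → ℂ} (hF : AEStronglyMeasurable F μ) (hF' : AEStronglyMeasurable F ν)
    (S : Set X) :
    (∫⁻ x in S, ‖F x‖ₑ ∂ν) ^ 2 ≤ M * eLpNorm F 2 μ ^ 2 * ν S := by
  have h1 := eLpNorm_le_eLpNorm_mul_rpow_measure_univ (μ := ν.restrict S) (p := 1) (q := 2)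
    (f := F) (by norm_num) hF'.restrict
  rw [eLpNorm_one_eq_lintegral_enorm, Measure.restrict_apply_univ] at h1
  have h2 : ∀ ρ : Measure X, eLpNorm F 2 ρ ^ 2 = ∫⁻ x, ‖F x‖ₑ ^ 2 ∂ρ := by
    intro ρ
    rw [eLpNorm_eq_lintegral_rpow_enorm_toReal (by norm_num) (by norm_num), ← ENNReal.rpow_natCast,
      ← ENNReal.rpow_mul]
    norm_num
  calc _ ≤ (eLpNorm F 2 (ν.restrict S) * ν S ^ (1 / (1 : ℝ≥0∞).toReal - 1 / (2 : ℝ≥0∞).toReal)) ^ 2 :=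
        pow_le_pow_left' h1 2
    _ = (∫⁻ x in S, ‖F x‖ₑ ^ 2 ∂ν) * ν S := by
        rw [mul_pow, h2, ← ENNReal.rpow_natCast (ν S ^ _), ← ENNReal.rpow_mul]
        norm_num
    _ ≤ (∫⁻ x, ‖F x‖ₑ ^ 2 ∂ν) * ν S := by gcongr; exact Measure.restrict_le_self
    _ ≤ (∫⁻ x, ‖F x‖ₑ ^ 2 ∂(M • μ)) * ν S := by gcongr
    _ = _ := by rw [lintegral_smul_measure, h2]; simp

lemma tendsto_integral_kconv_conj_mul_of_ae (hd : 0 < d) (i : Fin d) {f g : 𝔼 → ℂ}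
    (hf : Integrable f) (hg : Integrable g) (hgm : StronglyMeasurable g)
    (hae : ∀ᵐ x, Tendsto (fun n : ℕ => kconv (conjK i (1 / ((n : ℝ) + 1))) f x) atTop (𝓝 (g x)))
    (θ : 𝓢(𝔼, ℂ)) :
    Tendsto (fun n : ℕ => ∫ x, kconv (conjK i (1 / ((n : ℝ) + 1))) f x * θ x) atTop
      (𝓝 (∫ x, g x * θ x)) := by
  have h0 : ∀ n : ℕ, 0 < 1 / ((n : ℝ) + 1) := fun n => by positivity
  set ν : Measure 𝔼 := volume.withDensity fun x => ‖θ x‖ₑ with hν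
  have hθm : Measurable fun x => ‖θ x‖ₑ := θ.continuous.measurable.enorm
  obtain ⟨M, hM0, hM⟩ : ∃ M : ℝ, 0 ≤ M ∧ ∀ x, ‖θ x‖ ≤ M := by
    obtain ⟨C, hC⟩ := θ.toBoundedContinuousFunction.bddAbove_range_norm_comp
    exact ⟨‖θ.toBoundedContinuousFunction‖, norm_nonneg _,
      fun x => θ.toBoundedContinuousFunction.norm_coe_le_norm x⟩
  have hM' : ∀ x, ‖θ x‖ₑ ≤ ENNReal.ofReal M := fun x => by
    rw [← ofReal_norm]; exact ENNReal.ofReal_le_ofReal (hM x)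
  set N : ℝ := ∫ x, ‖θ x‖ with hN
  have hN0 : 0 ≤ N := integral_nonneg fun _ => norm_nonneg _
  set L : ℝ := ∫ ξ, ‖𝓕⁻ (θ : 𝔼 → ℂ) ξ‖ with hL
  have hL0 : 0 ≤ L := integral_nonneg fun _ => norm_nonneg _
  have hνu : ν univ = ENNReal.ofReal N := by
    rw [hν, withDensity_apply _ MeasurableSet.univ, Measure.restrict_univ, hN,
      ofReal_integral_norm_eq_lintegral_enorm θ.integrable]
  have : IsFiniteMeasure ν := ⟨by rw [hνu]; exact ENNReal.ofReal_lt_top⟩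
  have hνle : ν ≤ ENNReal.ofReal M • (volume : Measure 𝔼) := by
    rw [hν, ← withDensity_const]
    exact withDensity_mono (ae_of_all _ hM')
  have hνac : ν ≪ (volume : Measure 𝔼) := withDensity_absolutelyContinuous _ _
  have hset : ∀ (S : Set 𝔼) (F : 𝔼 → ℂ), MeasurableSet S → Measurable F →
      ∫⁻ x in S, ‖F x * θ x‖ₑ = ∫⁻ x in S, ‖F x‖ₑ ∂ν := by
    intro S F hS hF
    rw [hν, setLIntegral_withDensity_eq_setLIntegral_mul _ hθm hF.enorm hS]
    exact lintegral_congr fun x => by simp [enorm_mul, mul_comm]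
  have hgθ : Integrable fun x => g x * θ x :=
    (hg.mul_bdd (c := M) θ.continuous.aestronglyMeasurable (ae_of_all _ hM))
  have hgν : ∫⁻ x, ‖g x‖ₑ ∂ν ≠ ∞ := by
    have := hset univ g MeasurableSet.univ hgm.measurable
    rw [Measure.restrict_univ, Measure.restrict_univ] at this
    rw [← this]
    exact hgθ.2.ne
  rw [tendsto_iff_edist_tendsto_0, ENNReal.tendsto_nhds_zero]
  intro e he
  obtain ⟨τ, hτ, hτe⟩ : ∃ τ : ℝ, 0 < τ ∧ ENNReal.ofReal (5 * τ) ≤ e := by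
    rcases eq_or_ne e ∞ with h | h
    · exact ⟨1, one_pos, h ▸ le_top⟩
    · refine ⟨e.toReal / 5, div_pos (ENNReal.toReal_pos he.ne' h) (by norm_num), ?_⟩
      rw [mul_div_cancel₀ _ (by norm_num), ENNReal.ofReal_toReal h]
  obtain ⟨δ, hδ, hδg⟩ := exists_pos_setLIntegral_lt_of_measure_lt hgν
    (ENNReal.ofReal_pos.2 hτ).ne'
  obtain ⟨δ', hδ', hδ'δ⟩ : ∃ δ' : ℝ, 0 < δ' ∧ ENNReal.ofReal δ' ≤ δ := by
    rcases eq_or_ne δ ∞ with h | h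
    · exact ⟨1, one_pos, h ▸ le_top⟩
    · exact ⟨δ.toReal, ENNReal.toReal_pos hδ.ne' h, (ENNReal.ofReal_toReal h).le⟩
  have hpos : ∀ᶠ κ in 𝓝[>] (0 : ℝ), κ ∈ Ioi (0 : ℝ) := self_mem_nhdsWithin
  obtain ⟨κ, ⟨⟨⟨⟨⟨hκ, k1⟩, k2⟩, k3⟩, k4⟩, k5⟩⟩ := (((((hpos.and (eventually_mul_lt L hτ)).and
      (eventually_mul_lt N hτ)).and (eventually_mul_lt M hτ)).and
      (eventually_mul_lt (M * (M + 1)) (pow_pos hτ 2))).and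
      (eventually_mul_lt (M + 1) hδ')).exists
  rw [Set.mem_Ioi] at hκ
  obtain ⟨G, B, Ω, hGB, hG, hG2, hB, hΩ, hΩ1, hΩ2, hB1, hBΩ⟩ :=
    exists_cz_decomposition hd i hf hκ
  set γ : ℝ := (eLpNorm G 2).toReal ^ 2 with hγ
  have hγ0 : 0 ≤ γ := by positivity
  have hγ' : eLpNorm G 2 ^ 2 = ENNReal.ofReal γ := by
    rw [hγ, ENNReal.ofReal_pow ENNReal.toReal_nonneg, ENNReal.ofReal_toReal hG2.2.ne]
  obtain ⟨E, hE, hEν, hEu⟩ := tendstoUniformlyOn_of_ae_tendsto' (μ := ν)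
    (fun n => (continuous_kconv_conj i hf (h0 n)).stronglyMeasurable) hgm (hνac.ae_le hae)
    (ε := κ / (1 + γ)) (by positivity)
  have hEκ : ν E ≤ ENNReal.ofReal κ :=
    hEν.trans (ENNReal.ofReal_le_ofReal (div_le_self hκ.le (by linarith)))
  have hEγ : eLpNorm G 2 ^ 2 * ν E ≤ ENNReal.ofReal κ := by
    rw [hγ']
    refine (mul_le_mul_right hEν _).trans ?_
    rw [← ENNReal.ofReal_mul hγ0]
    refine ENNReal.ofReal_le_ofReal ?_
    rw [← mul_div_assoc, div_le_iff₀ (by positivity)]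
    nlinarith
  have hνΩ : ν Ω ≤ ENNReal.ofReal M * volume Ω := by
    simpa using hνle Ω
  set S := Ω ∪ E with hS
  have hSm : MeasurableSet S := hΩ.union hE
  have hνS : ν S < δ := by
    refine lt_of_lt_of_le ?_ hδ'δ
    calc ν S ≤ ν Ω + ν E := measure_union_le _ _
      _ ≤ ENNReal.ofReal M * ENNReal.ofReal κ + ENNReal.ofReal κ := by gcongr; exact hνΩ.trans (by gcongr)
      _ = ENNReal.ofReal (κ * (M + 1)) := by
        rw [← ENNReal.ofReal_mul hM0, ← ENNReal.ofReal_add (by positivity) hκ.le]; congr 1; ring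
      _ < _ := (ENNReal.ofReal_lt_ofReal_iff hδ').2 k5
  have hGS : ENNReal.ofReal M * eLpNorm G 2 ^ 2 * ν S ≤ ENNReal.ofReal τ ^ 2 := by
    calc _ ≤ ENNReal.ofReal M * eLpNorm G 2 ^ 2 * (ENNReal.ofReal M * volume Ω + ν E) := by
          gcongr; exact (measure_union_le _ _).trans (by gcongr)
      _ = ENNReal.ofReal M * (ENNReal.ofReal M * (eLpNorm G 2 ^ 2 * volume Ω)
            + eLpNorm G 2 ^ 2 * ν E) := by ring
      _ ≤ ENNReal.ofReal M * (ENNReal.ofReal M * ENNReal.ofReal κ + ENNReal.ofReal κ) := by gcongr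
      _ = ENNReal.ofReal (κ * (M * (M + 1))) := by
        rw [← ENNReal.ofReal_mul hM0, ← ENNReal.ofReal_add (by positivity) hκ.le,
          ← ENNReal.ofReal_mul hM0]
        congr 1; ring
      _ ≤ _ := by rw [← ENNReal.ofReal_pow hτ.le]; exact ENNReal.ofReal_le_ofReal k4.le
  rw [Metric.tendstoUniformlyOn_iff] at hEu
  filter_upwards [hEu κ hκ] with n hn
  refine le_trans ?_ hτe
  set ε := 1 / ((n : ℝ) + 1) with hεdef
  have hε : 0 < ε := h0 n
  have cf := continuous_kconv_conj i hf hε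
  have cG := continuous_kconv_conj i hG hε
  have cB := continuous_kconv_conj i hB hε
  have iF := integrable_kconv_conj_mul i hf hε θ
  have iB := integrable_kconv_conj_mul i hB hε θ
  have hsplit := kconv_add_of_eq i hε hGB hG hB
  rw [edist_eq_enorm_sub, ← integral_sub iF hgθ]
  have e1 : ∫ x, (kconv (conjK i ε) f x * θ x - g x * θ x)
      = (∫ x, kconv (conjK i ε) B x * θ x) + ∫ x, (kconv (conjK i ε) G x - g x) * θ x := by
    rw [← integral_add iB]
    · refine integral_congr_ae (ae_of_all _ fun x => ?_)
      simp only [hsplit]; ring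
    · refine ((iF.sub iB).sub hgθ).congr (ae_of_all _ fun x => ?_)
      simp only [Pi.sub_apply, hsplit]; ring
  have hGg : Measurable fun x => kconv (conjK i ε) G x - g x := cG.measurable.sub hgm.measurable
  have tB : ‖∫ x, kconv (conjK i ε) B x * θ x‖ₑ ≤ ENNReal.ofReal τ := by
    rw [← ofReal_norm]
    refine ENNReal.ofReal_le_ofReal ((norm_integral_kconv_conj_mul_le i hB hε θ).trans ?_)
    exact (mul_le_mul_of_nonneg_right hB1 hL0).trans k1.le
  have tS : ∫⁻ x in S, ‖kconv (conjK i ε) G x - g x‖ₑ ∂ν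
      ≤ ENNReal.ofReal τ + ENNReal.ofReal τ := by
    calc _ ≤ ∫⁻ x in S, (‖kconv (conjK i ε) G x‖ₑ + ‖g x‖ₑ) ∂ν :=
          lintegral_mono fun x => enorm_sub_le
      _ = ∫⁻ x in S, ‖kconv (conjK i ε) G x‖ₑ ∂ν + ∫⁻ x in S, ‖g x‖ₑ ∂ν :=
          lintegral_add_left cG.measurable.enorm _
      _ ≤ _ := by
        refine add_le_add ?_ (hδg S hνS).le
        rw [← ENNReal.pow_le_pow_left_iff (n := 2) (by norm_num)]
        refine (sq_setLIntegral_le hνle cG.aestronglyMeasurable cG.aestronglyMeasurable S).trans ?_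
        refine le_trans ?_ hGS
        gcongr
        exact (eLpNorm_kconv_conj_le i hG hG2 hε).2
  have tSc : ∫⁻ x in Sᶜ, ‖kconv (conjK i ε) G x - g x‖ₑ ∂ν
      ≤ ENNReal.ofReal τ + ENNReal.ofReal τ := by
    calc _ ≤ ∫⁻ x in Sᶜ, (‖kconv (conjK i ε) f x - g x‖ₑ + ‖kconv (conjK i ε) B x‖ₑ) ∂ν := by
          refine lintegral_mono fun x => ?_
          rw [show kconv (conjK i ε) G x - g x
            = (kconv (conjK i ε) f x - g x) - kconv (conjK i ε) B x by rw [hsplit]; ring]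
          exact enorm_sub_le
      _ = ∫⁻ x in Sᶜ, ‖kconv (conjK i ε) f x - g x‖ₑ ∂ν
          + ∫⁻ x in Sᶜ, ‖kconv (conjK i ε) B x‖ₑ ∂ν :=
          lintegral_add_left (cf.measurable.sub hgm.measurable).enorm _
      _ ≤ _ := by
        refine add_le_add ?_ ?_
        · calc _ ≤ ∫⁻ x in Sᶜ, ENNReal.ofReal κ ∂ν := by
                refine setLIntegral_mono measurable_const fun x hx => ?_
                have hxE : x ∈ Eᶜ := fun h => hx (Or.inr h)
                have := hn x hxE
                rw [← ofReal_norm, ← dist_eq_norm, dist_comm]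
                exact ENNReal.ofReal_le_ofReal this.le
            _ = ENNReal.ofReal κ * ν Sᶜ := by rw [setLIntegral_const]
            _ ≤ ENNReal.ofReal κ * ENNReal.ofReal N := by
                rw [← hνu]; gcongr; exact subset_univ _
            _ = ENNReal.ofReal (κ * N) := (ENNReal.ofReal_mul hκ.le).symm
            _ ≤ _ := ENNReal.ofReal_le_ofReal k2.le
        · calc _ ≤ ∫⁻ x in Ωᶜ, ‖kconv (conjK i ε) B x‖ₑ ∂ν :=
                lintegral_mono_set (compl_subset_compl.2 subset_union_left)
            _ ≤ ∫⁻ x in Ωᶜ, ‖kconv (conjK i ε) B x‖ₑ ∂(ENNReal.ofReal M • volume) :=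
                lintegral_mono' (Measure.restrict_mono le_rfl hνle) le_rfl
            _ = ENNReal.ofReal M * ∫⁻ x in Ωᶜ, ‖kconv (conjK i ε) B x‖ₑ := by
                rw [Measure.restrict_smul, lintegral_smul_measure, smul_eq_mul]
            _ ≤ ENNReal.ofReal M * ENNReal.ofReal κ := by gcongr; exact hBΩ ε hε
            _ = ENNReal.ofReal (κ * M) := by rw [← ENNReal.ofReal_mul hM0, mul_comm]
            _ ≤ _ := ENNReal.ofReal_le_ofReal k3.le
  rw [e1]
  calc _ ≤ ‖∫ x, kconv (conjK i ε) B x * θ x‖ₑ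
        + ‖∫ x, (kconv (conjK i ε) G x - g x) * θ x‖ₑ := enorm_add_le _ _
    _ ≤ ENNReal.ofReal τ + ((ENNReal.ofReal τ + ENNReal.ofReal τ)
          + (ENNReal.ofReal τ + ENNReal.ofReal τ)) := by
        refine add_le_add tB ((enorm_integral_le_lintegral_enorm _).trans ?_)
        rw [← lintegral_add_compl _ hSm, hset S _ hSm hGg, hset Sᶜ _ hSm.compl hGg]
        exact add_le_add tS tSc
    _ = _ := by
        simp only [← ENNReal.ofReal_add hτ.le hτ.le, ← ENNReal.ofReal_add (add_pos hτ hτ).le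
          (add_pos hτ hτ).le, ← ENNReal.ofReal_add hτ.le (add_pos (add_pos hτ hτ) (add_pos hτ hτ)).le]
        congr 1; ring

/-- If the smoothed conjugate functions of `f` converge a.e. to an integrable function, the limit
is given by the Riesz multiplier. -/
theorem norm_mul_fourier_eq_of_ae_tendsto (hd : 0 < d) (i : Fin d) {f g : 𝔼 → ℂ}
    (hf : Integrable f) (hg : Integrable g)
    (hae : ∀ᵐ x, Tendsto (fun ε : ℝ => kconv (conjK i ε) f x) (𝓝[>] 0) (𝓝 (g x))) (ξ : 𝔼) :
    (‖ξ‖ : ℂ) * 𝓕 g ξ = -Complex.I * (ξ i : ℂ) * 𝓕 f ξ := by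
  wlog hgm : StronglyMeasurable g generalizing g with H
  · have e := hg.aestronglyMeasurable.ae_eq_mk
    have hF : 𝓕 g = 𝓕 (hg.aestronglyMeasurable.mk g) := by
      funext ξ
      rw [Real.fourier_eq', Real.fourier_eq']
      exact integral_congr_ae (e.mono fun x hx => by simp only [hx])
    rw [hF]
    refine H (hg.congr e) ?_ hg.aestronglyMeasurable.stronglyMeasurable_mk
    filter_upwards [hae, e] with x h1 h2
    rwa [← h2]
  have hseq : Tendsto (fun n : ℕ => 1 / ((n : ℝ) + 1)) atTop (𝓝[>] 0) :=
    tendsto_nhdsWithin_iff.2 ⟨tendsto_one_div_add_atTop_nhds_zero_nat,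
      Eventually.of_forall fun n => by rw [Set.mem_Ioi]; positivity⟩
  have h1 : ∀ θ : 𝓢(𝔼, ℂ), ∫ ξ, (conjM i 0 ξ * 𝓕 f ξ) * θ ξ = ∫ ξ, 𝓕 g ξ * θ ξ := by
    intro θ
    have a := tendsto_integral_kconv_conj_mul i hf (𝓕 θ)
    have b := tendsto_integral_kconv_conj_mul_of_ae hd i hf hg hgm
      (hae.mono fun x hx => hx.comp hseq) (𝓕 θ)
    have c := tendsto_nhds_unique a b
    have e : 𝓕⁻ ((𝓕 θ : 𝓢(𝔼, ℂ)) : 𝔼 → ℂ) = θ := by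
      rw [← SchwartzMap.fourierInv_coe, FourierTransform.fourierInv_fourier_eq]
    rw [e] at c
    rw [c, integral_fourier_mul hg θ.integrable, SchwartzMap.fourier_coe]
  have hbd : ∀ ξ, ‖conjM i 0 ξ * 𝓕 f ξ‖ ≤ ‖∫ x, ‖f x‖‖ := fun ξ => by
    rw [norm_mul]
    calc _ ≤ 1 * ‖𝓕 f ξ‖ := by gcongr; exact norm_conjM_le_one i le_rfl ξ
      _ ≤ _ := by rw [one_mul]; exact (norm_fourier_le f ξ).trans (le_abs_self _)
  have h2 : (fun ξ => conjM i 0 ξ * 𝓕 f ξ) =ᵐ[volume] 𝓕 g := by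
    refine ae_eq_of_integral_schwartz_mul_eq ?_ (continuous_fourierE hg).locallyIntegrable h1
    exact (locallyIntegrable_const (∫ x, ‖f x‖)).mono
      ((measurable_conjM i _).aestronglyMeasurable.mul (continuous_fourierE hf).aestronglyMeasurable)
      (ae_of_all _ hbd)
  have h3 : (fun ξ : 𝔼 => (‖ξ‖ : ℂ) * 𝓕 g ξ) = fun ξ => -Complex.I * (ξ i : ℂ) * 𝓕 f ξ := by
    refine Continuous.ae_eq_iff_eq (volume : Measure 𝔼) ?_ ?_ |>.1 ?_
    · have := continuous_fourierE hg
      fun_prop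
    · have := continuous_fourierE hf
      fun_prop
    · filter_upwards [h2] with ξ hξ
      rw [← hξ]
      unfold conjM
      rcases eq_or_ne ξ 0 with h | h
      · simp [h]
      · have : (‖ξ‖ : ℂ) ≠ 0 := by exact_mod_cast norm_ne_zero_iff.2 h
        simp only [mul_zero, zero_mul, Real.exp_zero, mul_one, Complex.ofReal_div]
        field_simp
  exact congrFun h3 ξ

end WeakLimit

section PoissonPointwise

open scoped FourierTransform

variable {d : ℕ}

local notation "𝔼" => EuclideanSpace ℝ (Fin d)

/-- Normalized integral over a centered ball. -/
def ballMean (h : 𝔼 → ℝ≥0∞) (r : ℝ) : ℝ≥0∞ :=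
  ENNReal.ofReal ((r ^ d)⁻¹) * ∫⁻ y in Metric.closedBall 0 r, h y

lemma poissonK_le_div {ε R : ℝ} (hε : 0 < ε) (hR : 0 < R) {y : 𝔼} (h : R ≤ 2 * ε ∨ R ≤ 2 * ‖y‖) :
    poissonK d ε y ≤ rieszConst d * 2 ^ (d + 1) * (ε / R ^ (d + 1)) := by
  have hC := rieszConst_pos d
  have hs : R / 2 ≤ Real.sqrt (‖y‖ ^ 2 + ε ^ 2) := by
    rcases h with h | h
    · exact Real.le_sqrt_of_sq_le (by nlinarith [sq_nonneg ‖y‖])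
    · exact Real.le_sqrt_of_sq_le (by nlinarith [sq_nonneg ε])
  have e : rieszConst d * 2 ^ (d + 1) * (ε / R ^ (d + 1)) = rieszConst d * ε / (R / 2) ^ (d + 1) := by
    rw [div_pow]; field_simp
  rw [e, poissonK]
  gcongr

lemma exists_dyadic {ε : ℝ} (hε : 0 < ε) (y : 𝔼) :
    ∃ n : ℕ, ‖y‖ ≤ 2 ^ n * ε ∧ ((2 : ℝ) ^ n * ε ≤ 2 * ε ∨ (2 : ℝ) ^ n * ε ≤ 2 * ‖y‖) := by
  by_cases h : ‖y‖ ≤ ε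
  · exact ⟨0, by simpa using h, Or.inl (by linarith)⟩
  · push Not at h
    obtain ⟨n, h1, h2⟩ := exists_nat_pow_near (x := ‖y‖ / ε) (y := 2)
      ((one_le_div hε).2 h.le) one_lt_two
    rw [le_div_iff₀ hε] at h1
    rw [div_lt_iff₀ hε] at h2
    exact ⟨n + 1, h2.le, Or.inr (by rw [pow_succ]; linarith)⟩

lemma lintegral_poissonK_mul_le {ε : ℝ} (hε : 0 < ε) {h : 𝔼 → ℝ≥0∞} (hh : AEMeasurable h) :
    ∫⁻ y, ENNReal.ofReal (poissonK d ε y) * h y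
      ≤ ∑' n : ℕ, ENNReal.ofReal (rieszConst d * 2 ^ (d + 1) * (1 / 2) ^ n)
          * ballMean h (2 ^ n * ε) := by
  have hC := rieszConst_pos d
  set c : ℕ → ℝ≥0∞ := fun n =>
    ENNReal.ofReal (rieszConst d * 2 ^ (d + 1) * (ε / (2 ^ n * ε) ^ (d + 1))) with hc
  have e : ∀ n : ℕ, ENNReal.ofReal (rieszConst d * 2 ^ (d + 1) * (1 / 2) ^ n)
      * ballMean h (2 ^ n * ε) = ∫⁻ y, (Metric.closedBall 0 (2 ^ n * ε)).indicator
        (fun y => c n * h y) y := by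
    intro n
    rw [lintegral_indicator Metric.isClosed_closedBall.measurableSet,
      lintegral_const_mul'' _ hh.restrict, ballMean, ← mul_assoc,
      ← ENNReal.ofReal_mul (by positivity)]
    congr 2
    rw [mul_assoc, pow_succ _ d]
    congr 1
    field_simp
    rw [pow_succ, mul_comm ((2 ^ n * ε) ^ d), ← mul_assoc, ← mul_assoc, ← mul_pow, one_div,
      inv_mul_cancel₀ two_ne_zero, one_pow, one_mul]
  simp_rw [e]
  rw [← lintegral_tsum]
  · refine lintegral_mono fun y => ?_
    obtain ⟨n, h1, h2⟩ := exists_dyadic hε y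
    refine le_trans ?_ (ENNReal.le_tsum n)
    rw [indicator_of_mem (by simpa using h1)]
    exact mul_le_mul_left (ENNReal.ofReal_le_ofReal (poissonK_le_div hε (by positivity) h2)) _
  · intro n
    exact (hh.const_mul _).indicator Metric.isClosed_closedBall.measurableSet

lemma tendsto_lintegral_poissonK_mul {h : 𝔼 → ℝ≥0∞} (hh : AEMeasurable h)
    (h0 : Tendsto (ballMean h) (𝓝[>] 0) (𝓝 0)) {K : ℝ≥0∞} (hK : K ≠ ∞)
    (hb : ∀ r, 0 < r → ballMean h r ≤ K) :
    Tendsto (fun ε : ℝ => ∫⁻ y, ENNReal.ofReal (poissonK d ε y) * h y) (𝓝[>] 0) (𝓝 0) := by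
  have hC := rieszConst_pos d
  have key : Tendsto (fun ε : ℝ => ∑' n : ℕ,
      ENNReal.ofReal (rieszConst d * 2 ^ (d + 1) * (1 / 2) ^ n) * ballMean h (2 ^ n * ε))
      (𝓝[>] 0) (𝓝 0) := by
    simp_rw [← lintegral_count]
    have e0 : (0 : ℝ≥0∞) = ∫⁻ _ : ℕ, 0 ∂Measure.count := by simp
    rw [e0]
    refine tendsto_lintegral_filter_of_dominated_convergence
      (fun n => ENNReal.ofReal (rieszConst d * 2 ^ (d + 1) * (1 / 2) ^ n) * K)
      (Eventually.of_forall fun ε => measurable_of_countable _) ?_ ?_ ?_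
    · filter_upwards [self_mem_nhdsWithin] with ε hε
      rw [mem_Ioi] at hε
      exact ae_of_all _ fun n => by
        gcongr
        exact hb _ (by positivity)
    · rw [lintegral_count, ENNReal.tsum_mul_right]
      refine ENNReal.mul_ne_top ?_ hK
      have hs : Summable fun n : ℕ => rieszConst d * 2 ^ (d + 1) * (1 / 2 : ℝ) ^ n :=
        (summable_geometric_of_lt_one (by norm_num) (by norm_num)).mul_left _
      exact hs.tsum_ofReal_ne_top
    · refine ae_of_all _ fun n => ?_
      have : Tendsto (fun ε : ℝ => (2 : ℝ) ^ n * ε) (𝓝[>] 0) (𝓝[>] 0) := by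
        refine tendsto_nhdsWithin_iff.2 ⟨?_, ?_⟩
        · have : Tendsto (fun ε : ℝ => (2 : ℝ) ^ n * ε) (𝓝 0) (𝓝 (2 ^ n * 0)) :=
            tendsto_id.const_mul _
          rw [mul_zero] at this
          exact this.mono_left nhdsWithin_le_nhds
        · filter_upwards [self_mem_nhdsWithin] with ε hε
          rw [mem_Ioi] at hε ⊢
          positivity
      have := ENNReal.Tendsto.const_mul (a := ENNReal.ofReal (rieszConst d * 2 ^ (d + 1) * (1 / 2) ^ n))
        (h0.comp this) (Or.inr ENNReal.ofReal_ne_top)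
      simpa using this
  refine tendsto_of_tendsto_of_tendsto_of_le_of_le' tendsto_const_nhds key
    (Eventually.of_forall fun _ => zero_le) ?_
  filter_upwards [self_mem_nhdsWithin] with ε hε
  exact lintegral_poissonK_mul_le hε hh

/-- Poisson means of the oscillation vanish at Lebesgue points. -/
lemma ae_tendsto_lintegral_poissonK_osc {f : 𝔼 → ℂ} (hf : Integrable f) :
    ∀ᵐ x, Tendsto (fun ε : ℝ => ∫⁻ y, ENNReal.ofReal (poissonK d ε y) * ‖f (x - y) - f x‖ₑ)
      (𝓝[>] 0) (𝓝 0) := by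
  filter_upwards [IsUnifLocDoublingMeasure.ae_tendsto_average_norm_sub (μ := (volume : Measure 𝔼))
    hf.locallyIntegrable 1] with x hx
  have h1 := hx (l := 𝓝[>] (0 : ℝ)) (fun _ => x) id tendsto_id (by
    filter_upwards [self_mem_nhdsWithin] with r hr
    exact Metric.mem_closedBall_self (by simpa using (mem_Ioi.1 hr).le))
  have hbC := ballC_pos (d := d)
  have hm : AEMeasurable fun y => ‖f (x - y) - f x‖ₑ :=
    ((hf.comp_sub_left x).aestronglyMeasurable.sub aestronglyMeasurable_const).enorm
  have hsub : ∀ r, ∫⁻ y in Metric.closedBall 0 r, ‖f (x - y) - f x‖ₑ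
      = ∫⁻ y in Metric.closedBall x r, ‖f y - f x‖ₑ := by
    intro r
    have := (Measure.measurePreserving_sub_left (volume : Measure 𝔼) x).setLIntegral_comp_preimage_emb
      (Homeomorph.subLeft x).measurableEmbedding (fun y => ‖f y - f x‖ₑ) (Metric.closedBall x r)
    rw [← this]
    congr 2
    ext y
    simp [dist_eq_norm]
  have hmean : ∀ r, 0 < r → ballMean (fun y => ‖f (x - y) - f x‖ₑ) r
      = ENNReal.ofReal (ballC d) * ENNReal.ofReal (⨍ y in Metric.closedBall x r, ‖f y - f x‖) := by
    intro r hr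
    have hi : IntegrableOn (fun y => f y - f x) (Metric.closedBall x r) :=
      hf.integrableOn.sub (integrableOn_const (measure_closedBall_lt_top.ne))
    rw [ballMean, hsub, setAverage_eq, measureReal_def, volume_closedBallE x hr.le,
      ENNReal.toReal_ofReal (by positivity), smul_eq_mul, ENNReal.ofReal_mul (by positivity),
      ofReal_integral_norm_eq_lintegral_enorm hi, ← mul_assoc, ← ENNReal.ofReal_mul hbC.le]
    congr 2
    field_simp
  have h0 : Tendsto (ballMean (fun y => ‖f (x - y) - f x‖ₑ)) (𝓝[>] 0) (𝓝 0) := by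
    have := ENNReal.Tendsto.const_mul (a := ENNReal.ofReal (ballC d))
      (ENNReal.tendsto_ofReal h1) (Or.inr ENNReal.ofReal_ne_top)
    rw [ENNReal.ofReal_zero, mul_zero] at this
    refine this.congr' ?_
    filter_upwards [self_mem_nhdsWithin] with r hr
    exact (hmean r hr).symm
  have h2 : ∀ᶠ r in 𝓝[>] (0 : ℝ), ballMean (fun y => ‖f (x - y) - f x‖ₑ) r ≤ 1 :=
    h0.eventually_le_const one_pos
  rw [eventually_nhdsWithin_iff, Metric.eventually_nhds_iff] at h2
  obtain ⟨r₀, hr₀, h2⟩ := h2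
  refine tendsto_lintegral_poissonK_mul hm h0
    (K := 1 + (ENNReal.ofReal ((r₀ ^ d)⁻¹) * (∫⁻ y, ‖f y‖ₑ) + ‖f x‖ₑ * ENNReal.ofReal (ballC d))) ?_ ?_
  · have := hf.2.ne
    refine ENNReal.add_ne_top.2 ⟨ENNReal.one_ne_top, ENNReal.add_ne_top.2
      ⟨ENNReal.mul_ne_top ENNReal.ofReal_ne_top hf.2.ne,
      ENNReal.mul_ne_top enorm_ne_top ENNReal.ofReal_ne_top⟩⟩
  · intro r hr
    by_cases hrr : r < r₀
    · refine (h2 (by rw [Real.dist_eq, sub_zero, abs_of_pos hr]; exact hrr) hr).trans le_self_add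
    · push Not at hrr
      refine le_trans ?_ le_add_self
      rw [ballMean, hsub]
      calc _ ≤ ENNReal.ofReal ((r ^ d)⁻¹)
            * ∫⁻ y in Metric.closedBall x r, (‖f y‖ₑ + ‖f x‖ₑ) := by
            gcongr; exact enorm_sub_le
        _ = ENNReal.ofReal ((r ^ d)⁻¹) * (∫⁻ y in Metric.closedBall x r, ‖f y‖ₑ)
            + ENNReal.ofReal ((r ^ d)⁻¹) * (‖f x‖ₑ * ENNReal.ofReal (r ^ d * ballC d)) := by
            rw [lintegral_add_right _ measurable_const, setLIntegral_const,
              volume_closedBallE x hr.le, mul_add]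
        _ ≤ _ := by
            refine add_le_add ?_ (le_of_eq ?_)
            · gcongr
              exact Measure.restrict_le_self
            · rw [mul_left_comm, ← ENNReal.ofReal_mul (by positivity)]
              congr 2
              field_simp

lemma integrable_mul_poissonK {f : 𝔼 → ℂ} (hf : Integrable f) {ε : ℝ} (hε : 0 < ε) (x : 𝔼) :
    Integrable fun y => f (x - y) * (poissonK d ε y : ℂ) := by
  obtain ⟨C, hC⟩ : ∃ C, ∀ y : 𝔼, ‖(poissonK d ε y : ℂ)‖ ≤ C := by
    refine ⟨rieszConst d * 2 ^ (d + 1) * (ε / ε ^ (d + 1)), fun y => ?_⟩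
    rw [Complex.norm_real, Real.norm_of_nonneg (poissonK_nonneg hε.le y)]
    exact poissonK_le_div hε hε (Or.inl (by linarith))
  refine Integrable.mul_bdd (hf.comp_sub_left x)
    (Complex.continuous_ofReal.comp (continuous_poissonK hε)).aestronglyMeasurable
    (ae_of_all _ hC)

lemma enorm_kconv_poissonK_sub_le {f : 𝔼 → ℂ} (hf : Integrable f) {ε : ℝ} (hε : 0 < ε) (x : 𝔼) :
    ‖kconv (poissonK d ε) f x - f x‖ₑ
      ≤ ∫⁻ y, ENNReal.ofReal (poissonK d ε y) * ‖f (x - y) - f x‖ₑ := by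
  have h1 : ∫ y, f x * (poissonK d ε y : ℂ) = f x := by
    rw [integral_const_mul, integral_complex_ofReal, integral_poissonK hε]; simp
  have h2 : kconv (poissonK d ε) f x - f x = ∫ y, (f (x - y) - f x) * (poissonK d ε y : ℂ) := by
    have h3 := integral_sub (integrable_mul_poissonK hf hε x)
      ((integrable_poissonK hε).ofReal.const_mul (f x))
    simp only [Complex.coe_algebraMap] at h3
    rw [h1] at h3
    rw [kconv, ← h3]
    exact integral_congr_ae (ae_of_all _ fun y => by simp only []; ring)
  rw [h2]
  refine (enorm_integral_le_lintegral_enorm _).trans (le_of_eq (lintegral_congr fun y => ?_))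
  rw [enorm_mul, mul_comm, ← ofReal_norm (poissonK d ε y : ℂ), Complex.norm_real,
    Real.norm_of_nonneg (poissonK_nonneg hε.le y)]

/-- The difference between the sharp and the smooth truncation of the Riesz kernel. -/
def truncDiff (i : Fin d) (ε : ℝ) (y : 𝔼) : ℝ :=
  ({y : 𝔼 | ε < ‖y‖}.indicator (rieszZ i) y) - conjK i ε y

lemma truncDiff_neg (i : Fin d) (ε : ℝ) (y : 𝔼) : truncDiff i ε (-y) = -truncDiff i ε y := by
  have h1 : rieszZ i (-y) = -rieszZ i y := by simp [rieszZ, neg_div]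
  have h2 : conjK i ε (-y) = -conjK i ε y := by simp [conjK, neg_div]
  simp only [truncDiff, indicator_apply, Set.mem_ofPred_eq, norm_neg, h1, h2]
  split_ifs <;> ring

lemma pow_sub_pow_le_mul {s t : ℝ} (ht : 0 ≤ t) (h : t ≤ s) (n : ℕ) :
    s ^ (n + 1) - t ^ (n + 1) ≤ (n + 1) * s ^ n * (s - t) := by
  induction n with
  | zero => simp
  | succ n ih =>
    have h1 : t ^ (n + 1) ≤ s ^ (n + 1) := by gcongr
    have h2 : s ^ (n + 1 + 1) - t ^ (n + 1 + 1)
        = s * (s ^ (n + 1) - t ^ (n + 1)) + t ^ (n + 1) * (s - t) := by ring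
    rw [h2]
    calc _ ≤ s * ((n + 1) * s ^ n * (s - t)) + s ^ (n + 1) * (s - t) := by
          gcongr
          linarith
      _ = _ := by push_cast; ring

lemma abs_truncDiff_le (i : Fin d) {ε : ℝ} (hε : 0 < ε) (y : 𝔼) :
    |truncDiff i ε y| ≤ (d + 1) * 2 ^ (d + 1) * poissonK d ε y := by
  have hC := rieszConst_pos d
  set s := Real.sqrt (‖y‖ ^ 2 + ε ^ 2) with hs
  have hs0 : 0 < s := sqrt_sq_add_sq_pos hε y
  have hs2 : s ^ 2 = ‖y‖ ^ 2 + ε ^ 2 := Real.sq_sqrt (by positivity)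
  have hys : ‖y‖ ≤ s := Real.le_sqrt_of_sq_le (by nlinarith)
  have hεs : ε ≤ s := Real.le_sqrt_of_sq_le (by nlinarith [norm_nonneg y])
  have hy := abs_coord_le i y
  have hn := norm_nonneg y
  unfold truncDiff
  by_cases h : ε < ‖y‖
  · rw [indicator_of_mem (s := {y : 𝔼 | ε < ‖y‖}) h, rieszZ, conjK, poissonK, ← hs]
    have hy0 : 0 < ‖y‖ := hε.trans h
    have hs2y : s ≤ 2 * ‖y‖ := by nlinarith
    have e : rieszConst d * y i / ‖y‖ ^ (d + 1) - rieszConst d * y i / s ^ (d + 1)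
        = rieszConst d * y i * ((s ^ (d + 1) - ‖y‖ ^ (d + 1)) / (‖y‖ ^ (d + 1) * s ^ (d + 1))) := by
      field_simp
    have h0 : 0 ≤ s ^ (d + 1) - ‖y‖ ^ (d + 1) := sub_nonneg.2 (by gcongr)
    have h1 := pow_sub_pow_le_mul hn hys d
    have h3 : ‖y‖ * (s - ‖y‖) ≤ ε ^ 2 := by nlinarith
    rw [e, abs_mul, abs_mul, abs_of_pos hC, abs_of_nonneg (by positivity : 0 ≤ (s ^ (d + 1) - ‖y‖ ^ (d + 1)) / (‖y‖ ^ (d + 1) * s ^ (d + 1)))]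
    calc _ ≤ rieszConst d * ‖y‖ * (((d + 1) * s ^ d * (s - ‖y‖)) / (‖y‖ ^ (d + 1) * s ^ (d + 1))) := by
          gcongr
      _ = rieszConst d * (d + 1) * s ^ d * (‖y‖ * (s - ‖y‖)) / (‖y‖ ^ (d + 1) * s ^ (d + 1)) := by
          ring
      _ ≤ rieszConst d * (d + 1) * s ^ d * ε ^ 2 / ((s / 2) ^ (d + 1) * s ^ (d + 1)) := by
          gcongr; linarith
      _ = rieszConst d * (d + 1) * 2 ^ (d + 1) * (ε * ε) / (s * s ^ (d + 1)) := by
          rw [div_pow]; field_simp; ring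
      _ ≤ rieszConst d * (d + 1) * 2 ^ (d + 1) * (ε * s) / (s * s ^ (d + 1)) := by gcongr
      _ = _ := by field_simp
  · rw [indicator_of_notMem (s := {y : 𝔼 | ε < ‖y‖}) h, zero_sub, abs_neg, conjK, poissonK, ← hs]
    push Not at h
    rw [abs_div, abs_mul, abs_of_pos hC, abs_of_pos (pow_pos hs0 _)]
    calc _ ≤ rieszConst d * ε / s ^ (d + 1) := by gcongr; exact hy.trans h
      _ = 1 * 1 * (rieszConst d * ε / s ^ (d + 1)) := by ring
      _ ≤ _ := by
        have : (1 : ℝ) ≤ d + 1 := by linarith [(Nat.cast_nonneg d : (0 : ℝ) ≤ d)]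
        gcongr
        exact one_le_pow₀ one_le_two

lemma measurable_truncDiff (i : Fin d) {ε : ℝ} (hε : 0 < ε) : Measurable (truncDiff i ε) :=
  ((measurable_rieszZ i).indicator (measurableSet_lt measurable_const measurable_norm)).sub
    (continuous_conjK i hε).measurable

lemma integrable_truncDiff (i : Fin d) {ε : ℝ} (hε : 0 < ε) : Integrable (truncDiff i ε) := by
  refine ((integrable_poissonK hε).const_mul ((d + 1) * 2 ^ (d + 1))).mono'
    (measurable_truncDiff i hε).aestronglyMeasurable (ae_of_all _ fun y => ?_)
  exact abs_truncDiff_le i hε y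

lemma integral_truncDiff (i : Fin d) (ε : ℝ) : ∫ y : 𝔼, truncDiff i ε y = 0 := by
  have h := integral_neg_eq_self (fun y : 𝔼 => truncDiff i ε y) volume
  simp only [truncDiff_neg, integral_neg] at h
  linarith

lemma enorm_truncE_sub_le (i : Fin d) {f : 𝔼 → ℂ} (hf : Integrable f) {ε : ℝ} (hε : 0 < ε) (x : 𝔼) :
    ‖truncE i f x ε - kconv (conjK i ε) f x‖ₑ ≤ ENNReal.ofReal ((d + 1) * 2 ^ (d + 1))
      * ∫⁻ y, ENNReal.ofReal (poissonK d ε y) * ‖f (x - y) - f x‖ₑ := by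
  have hS : MeasurableSet {y : 𝔼 | ε < ‖y‖} := measurableSet_lt measurable_const measurable_norm
  have hD : Integrable fun y => f (x - y) * (truncDiff i ε y : ℂ) := by
    refine ((integrable_mul_poissonK hf hε x).norm.const_mul ((d + 1) * 2 ^ (d + 1))).mono'
      ((hf.comp_sub_left x).aestronglyMeasurable.mul
      (Complex.measurable_ofReal.comp (measurable_truncDiff i hε)).aestronglyMeasurable)
      (ae_of_all _ fun y => ?_)
    rw [norm_mul, norm_mul, Complex.norm_real, Complex.norm_real,
      Real.norm_of_nonneg (poissonK_nonneg hε.le y), mul_left_comm]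
    exact mul_le_mul_of_nonneg_left (abs_truncDiff_le i hε y) (norm_nonneg _)
  have h1 : ∫ y, f x * (truncDiff i ε y : ℂ) = 0 := by
    rw [integral_const_mul, integral_complex_ofReal, integral_truncDiff]; simp
  have e : ∀ y, f (x - y) * (truncDiff i ε y : ℂ) = {y : 𝔼 | ε < ‖y‖}.indicator
      (fun y => f (x - y) * (rieszZ i y : ℂ)) y - f (x - y) * (conjK i ε y : ℂ) := by
    intro y
    simp only [truncDiff, indicator_apply]
    split_ifs <;> push_cast <;> ring
  have h2 : truncE i f x ε - kconv (conjK i ε) f x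
      = ∫ y, (f (x - y) - f x) * (truncDiff i ε y : ℂ) := by
    have a : ∫ y, (f (x - y) - f x) * (truncDiff i ε y : ℂ)
        = ∫ y, f (x - y) * (truncDiff i ε y : ℂ) := by
      have h3 := integral_sub hD ((integrable_truncDiff i hε).ofReal.const_mul (f x))
      simp only [Complex.coe_algebraMap] at h3
      rw [h1, sub_zero] at h3
      rw [← h3]
      exact integral_congr_ae (ae_of_all _ fun y => by simp only []; ring)
    have hZ : Integrable ({y : 𝔼 | ε < ‖y‖}.indicator (fun y => f (x - y) * (rieszZ i y : ℂ))) :=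
      (hD.add (integrable_mul_conjK i hε hf x)).congr (ae_of_all _ fun y => by
        simp only [Pi.add_apply, e]; ring)
    rw [a, truncE, kconv, ← integral_indicator hS,
      ← integral_sub hZ (integrable_mul_conjK i hε hf x)]
    exact integral_congr_ae (ae_of_all _ fun y => (e y).symm)
  rw [h2, ← lintegral_const_mul' _ _ ENNReal.ofReal_ne_top]
  refine (enorm_integral_le_lintegral_enorm _).trans (lintegral_mono fun y => ?_)
  simp only []
  rw [enorm_mul, ← mul_assoc, ← ENNReal.ofReal_mul (by positivity), mul_comm]
  gcongr
  rw [← ofReal_norm, Complex.norm_real]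
  exact ENNReal.ofReal_le_ofReal (abs_truncDiff_le i hε y)

lemma kconv_conj_eq_kconv_poisson (i : Fin d) {f g : 𝔼 → ℂ} (hf : Integrable f) (hg : Integrable g)
    (h : ∀ ξ : 𝔼, (‖ξ‖ : ℂ) * 𝓕 g ξ = -Complex.I * (ξ i : ℂ) * 𝓕 f ξ) {ε : ℝ} (hε : 0 < ε) (x : 𝔼) :
    kconv (conjK i ε) f x = kconv (poissonK d ε) g x := by
  have : Nontrivial 𝔼 := ⟨0, EuclideanSpace.single i 1, fun hh => by
    have := congrArg (fun v : 𝔼 => v i) hh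
    simp at this⟩
  rw [kconv_conj i hf hε, kconv_poisson hg hε, Real.fourierInv_eq', Real.fourierInv_eq']
  have h0 : ∀ᵐ ξ : 𝔼, ξ ≠ 0 := by
    have : (volume : Measure 𝔼) {0} = 0 := measure_singleton 0
    exact compl_mem_ae_iff.2 this
  refine integral_congr_ae (h0.mono fun ξ hξ => ?_)
  have hn : (‖ξ‖ : ℂ) ≠ 0 := by exact_mod_cast norm_ne_zero_iff.2 hξ
  have := h ξ
  simp only [conjM, poissonM, Complex.ofReal_mul, Complex.ofReal_div]
  congr 1
  field_simp
  linear_combination -this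

/-- If two integrable functions are related by a Riesz multiplier, then the truncated Riesz
integrals of the first converge a.e. to the second. -/
theorem ae_tendsto_truncE_of_fourier (i : Fin d) {f g : 𝔼 → ℂ} (hf : Integrable f)
    (hg : Integrable g)
    (h : ∀ ξ : 𝔼, (‖ξ‖ : ℂ) * 𝓕 g ξ = -Complex.I * (ξ i : ℂ) * 𝓕 f ξ) :
    ∀ᵐ x, Tendsto (fun ε : ℝ => truncE i f x ε) (𝓝[>] 0) (𝓝 (g x)) := by
  filter_upwards [ae_tendsto_lintegral_poissonK_osc hf, ae_tendsto_lintegral_poissonK_osc hg]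
    with x hxf hxg
  have h1 := (ENNReal.Tendsto.const_mul (a := ENNReal.ofReal (((d : ℝ) + 1) * 2 ^ (d + 1))) hxf
    (Or.inr ENNReal.ofReal_ne_top)).add hxg
  rw [mul_zero, add_zero] at h1
  rw [tendsto_iff_edist_tendsto_0]
  refine tendsto_of_tendsto_of_tendsto_of_le_of_le' tendsto_const_nhds h1
    (Eventually.of_forall fun _ => zero_le) ?_
  filter_upwards [self_mem_nhdsWithin] with ε hε
  rw [mem_Ioi] at hε
  refine (edist_triangle _ (kconv (conjK i ε) f x) _).trans (add_le_add ?_ ?_)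
  · rw [edist_eq_enorm_sub]
    exact enorm_truncE_sub_le i hf hε x
  · rw [edist_eq_enorm_sub, kconv_conj_eq_kconv_poisson i hf hg h hε]
    exact enorm_kconv_poissonK_sub_le hg hε x

end PoissonPointwise

section Transfer

open scoped FourierTransform

variable {d : ℕ}

local notation "𝔼" => EuclideanSpace ℝ (Fin d)
local notation "𝕏" => Fin d → ℝ

lemma norm_toLp_eq_eucNorm (x : 𝕏) : ‖(WithLp.toLp 2 x : 𝔼)‖ = eucNorm x := by
  simp [EuclideanSpace.norm_eq, eucNorm]

lemma eucNorm_ofLp (x : 𝔼) : eucNorm (WithLp.ofLp x) = ‖x‖ := by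
  simp [EuclideanSpace.norm_eq, eucNorm]

lemma integral_comp_ofLp {F : Type*} [NormedAddCommGroup F] [NormedSpace ℝ F] (f : 𝕏 → F) :
    ∫ x : 𝔼, f (WithLp.ofLp x) = ∫ x, f x :=
  (PiLp.volume_preserving_ofLp (Fin d)).integral_comp (MeasurableEquiv.toLp 2 (Fin d → ℝ)).symm.measurableEmbedding f

lemma integrable_comp_ofLp {f : 𝕏 → ℂ} (hf : Integrable f) :
    Integrable fun x : 𝔼 => f (WithLp.ofLp x) :=
  (PiLp.volume_preserving_ofLp (Fin d)).integrable_comp_of_integrable hf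

lemma ft_eq_fourier (f : 𝕏 → ℂ) (ξ : 𝕏) :
    ft f ξ = 𝓕 (fun x : 𝔼 => f (WithLp.ofLp x)) (WithLp.toLp 2 ξ) := by
  rw [Real.fourier_eq', ft, ← integral_comp_ofLp]
  refine integral_congr_ae (ae_of_all _ fun x => ?_)
  simp only [smul_eq_mul, dotP, PiLp.inner_apply, RCLike.inner_apply, conj_trivial]
  congr 4
  ring

lemma rieszKernel_ofLp (i : Fin d) (y : 𝔼) (hy : y ≠ 0) :
    rieszKernel d (WithLp.ofLp y) i = rieszZ i y := by
  have : WithLp.ofLp y ≠ 0 := fun h => hy (by ext j; exact congrFun h j)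
  rw [rieszKernel, if_neg this, rieszZ, eucNorm_ofLp]

lemma integrableOn_mul_rieszZ (i : Fin d) {f : 𝔼 → ℂ} (hf : Integrable f) (x : 𝔼) {ε : ℝ}
    (hε : 0 < ε) : IntegrableOn (fun y => f (x - y) * (rieszZ i y : ℂ)) {y : 𝔼 | ε < ‖y‖} := by
  refine Integrable.mul_bdd (c := rieszConst d / ε ^ d) (hf.comp_sub_left x).integrableOn
    (Complex.measurable_ofReal.comp (measurable_rieszZ i)).aestronglyMeasurable ?_
  refine (ae_restrict_iff' (measurableSet_lt measurable_const measurable_norm)).2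
    (ae_of_all _ fun y hy => ?_)
  rw [Complex.norm_real]
  exact abs_rieszZ_le i hε (le_of_lt hy)

lemma truncRiesz_apply {f : 𝕏 → ℂ} (hf : Integrable f) (x : 𝕏) {ε : ℝ} (hε : 0 < ε) (i : Fin d) :
    truncRiesz f x ε i = truncE i (fun y : 𝔼 => f (WithLp.ofLp y)) (WithLp.toLp 2 x) ε := by
  have hS : MeasurableSet {y : 𝔼 | ε < ‖y‖} := measurableSet_lt measurable_const measurable_norm
  have key : ∀ i, ∀ y : 𝔼, {y : 𝔼 | ε < ‖y‖}.indicator (fun y : 𝔼 => f (x - WithLp.ofLp y) *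
      ((rieszKernel d (WithLp.ofLp y) i : ℝ) : ℂ)) y = {y : 𝔼 | ε < ‖y‖}.indicator
      (fun y : 𝔼 => f (WithLp.ofLp (WithLp.toLp 2 x - y)) * (rieszZ i y : ℂ)) y := by
    intro i y
    by_cases hy : ε < ‖y‖
    · rw [indicator_of_mem (s := {y : 𝔼 | ε < ‖y‖}) hy, indicator_of_mem (s := {y : 𝔼 | ε < ‖y‖}) hy,
        rieszKernel_ofLp i y (norm_pos_iff.1 (hε.trans hy))]
      rfl
    · rw [indicator_of_notMem (s := {y : 𝔼 | ε < ‖y‖}) hy,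
        indicator_of_notMem (s := {y : 𝔼 | ε < ‖y‖}) hy]
  have hT : MeasurableSet {y : 𝕏 | ε < eucNorm y} := by
    refine measurableSet_lt measurable_const ?_
    unfold eucNorm
    fun_prop
  have e : ∀ i, ∀ y : 𝔼, {y : 𝕏 | ε < eucNorm y}.indicator (fun y : 𝕏 => f (x - y) *
      ((rieszKernel d y i : ℝ) : ℂ)) (WithLp.ofLp y) = {y : 𝔼 | ε < ‖y‖}.indicator
      (fun y : 𝔼 => f (WithLp.ofLp (WithLp.toLp 2 x - y)) * (rieszZ i y : ℂ)) y := by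
    intro i y
    rw [← key i y]
    simp only [indicator_apply, Set.mem_ofPred_eq, eucNorm_ofLp]
  have hint : ∀ i, IntegrableOn (fun y : 𝕏 => f (x - y) * ((rieszKernel d y i : ℝ) : ℂ))
      {y : 𝕏 | ε < eucNorm y} := by
    intro i
    rw [← integrable_indicator_iff hT, ← (PiLp.volume_preserving_ofLp (Fin d)).integrable_comp_emb
      (MeasurableEquiv.toLp 2 (Fin d → ℝ)).symm.measurableEmbedding]
    refine ((integrable_indicator_iff hS).2 (integrableOn_mul_rieszZ i (integrable_comp_ofLp hf)
      (WithLp.toLp 2 x) hε)).congr (ae_of_all _ fun y => (e i y).symm)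
  rw [truncRiesz, eval_integral hint, truncE, ← integral_indicator hT, ← integral_indicator hS,
    ← integral_comp_ofLp]
  exact integral_congr_ae (ae_of_all _ fun y => e i y)

/-- Two functions related by the Riesz multiplier in the coordinate `i`. -/
def RieszPair (i : Fin d) (f g : 𝕏 → ℂ) : Prop :=
  ∀ ξ : 𝕏, (eucNorm ξ : ℂ) * ft g ξ = -Complex.I * (ξ i : ℂ) * ft f ξ

/-- Principal value characterization of the Riesz transform by its multiplier. -/
theorem hasRiesz_iff {f : 𝕏 → ℂ} {g : 𝕏 → Fin d → ℂ} (hf : Integrable f) (hg : Integrable g) :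
    HasRiesz f g ↔ ∀ i, RieszPair i f (fun x => g x i) := by
  have hgi : ∀ i, Integrable fun x => g x i := fun i => hg.eval i
  have hae : ∀ P : 𝕏 → Prop, (∀ᵐ x : 𝔼, P (WithLp.ofLp x)) ↔ ∀ᵐ x, P x := fun P =>
    ⟨fun h => (PiLp.volume_preserving_toLp (Fin d)).quasiMeasurePreserving.ae h,
      fun h => (PiLp.volume_preserving_ofLp (Fin d)).quasiMeasurePreserving.ae h⟩
  have h1 : HasRiesz f g ↔ ∀ i, ∀ᵐ x : 𝔼, Tendsto (fun ε : ℝ =>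
      truncE i (fun y : 𝔼 => f (WithLp.ofLp y)) x ε) (𝓝[>] 0) (𝓝 (g (WithLp.ofLp x) i)) := by
    unfold HasRiesz
    rw [← hae, ← ae_all_iff]
    refine eventually_congr (ae_of_all _ fun x => ?_)
    rw [tendsto_pi_nhds]
    refine forall_congr' fun i => tendsto_congr' ?_
    filter_upwards [self_mem_nhdsWithin] with ε hε
    exact truncRiesz_apply hf _ hε i
  rw [h1]
  refine forall_congr' fun i => ⟨fun h ξ => ?_, fun h => ?_⟩
  · have hd : 0 < d := i.pos
    have := norm_mul_fourier_eq_of_ae_tendsto hd i (integrable_comp_ofLp hf)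
      (integrable_comp_ofLp (hgi i))
      (h.mono fun x hx => tendsto_kconv_conj i (integrable_comp_ofLp hf) x hx) (WithLp.toLp 2 ξ)
    rw [norm_toLp_eq_eucNorm, ← ft_eq_fourier f, ← ft_eq_fourier fun x => g x i] at this
    exact this
  · refine ae_tendsto_truncE_of_fourier i (integrable_comp_ofLp hf) (integrable_comp_ofLp (hgi i))
      fun ξ => ?_
    have := h (WithLp.ofLp ξ)
    rw [eucNorm_ofLp, ft_eq_fourier f, ft_eq_fourier fun x => g x i] at this
    exact this

lemma continuous_ft {f : 𝕏 → ℂ} (hf : Integrable f) : Continuous (ft f) := by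
  have : ft f = fun ξ => 𝓕 (fun x : 𝔼 => f (WithLp.ofLp x)) (WithLp.toLp 2 ξ) :=
    funext fun ξ => ft_eq_fourier f ξ
  rw [this]
  exact (continuous_fourierE (integrable_comp_ofLp hf)).comp (PiLp.continuous_toLp 2 _)

lemma norm_ft_le (f : 𝕏 → ℂ) (ξ : 𝕏) : ‖ft f ξ‖ ≤ ∫ x, ‖f x‖ := by
  rw [ft_eq_fourier, ← integral_comp_ofLp]
  exact norm_fourier_le _ _

lemma ae_eq_of_ft_eq {f g : 𝕏 → ℂ} (hf : Integrable f) (hg : Integrable g) (h : ft f = ft g) :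
    f =ᵐ[volume] g := by
  have h2 := ae_eq_of_fourier_eq (integrable_comp_ofLp hf) (integrable_comp_ofLp hg) (by
    intro ξ
    have := congrFun h (WithLp.ofLp ξ)
    rwa [ft_eq_fourier f, ft_eq_fourier g] at this)
  exact (PiLp.volume_preserving_toLp (Fin d)).quasiMeasurePreserving.ae h2

lemma integrable_exp_mul {f : 𝕏 → ℂ} (hf : Integrable f) (ξ : 𝕏) :
    Integrable fun x => Complex.exp ((-(2 * Real.pi * dotP ξ x) : ℝ) * Complex.I) * f x := by
  have hc : Continuous fun x : 𝕏 => Complex.exp ((-(2 * Real.pi * dotP ξ x) : ℝ) * Complex.I) := by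
    unfold dotP
    fun_prop
  exact hf.bdd_mul (c := 1) hc.aestronglyMeasurable (ae_of_all _ fun x => by
    rw [Complex.norm_exp_ofReal_mul_I])

lemma ft_congr_ae {f g : 𝕏 → ℂ} (h : f =ᵐ[volume] g) : ft f = ft g :=
  funext fun ξ => integral_congr_ae (h.mono fun x hx => by simp only [hx])

lemma ft_add {f g : 𝕏 → ℂ} (hf : Integrable f) (hg : Integrable g) (ξ : 𝕏) :
    ft (fun x => f x + g x) ξ = ft f ξ + ft g ξ := by
  rw [ft, ft, ft, ← integral_add (integrable_exp_mul hf ξ) (integrable_exp_mul hg ξ)]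
  exact integral_congr_ae (ae_of_all _ fun x => by simp only [mul_add])

lemma ft_sub {f g : 𝕏 → ℂ} (hf : Integrable f) (hg : Integrable g) (ξ : 𝕏) :
    ft (fun x => f x - g x) ξ = ft f ξ - ft g ξ := by
  rw [ft, ft, ft, ← integral_sub (integrable_exp_mul hf ξ) (integrable_exp_mul hg ξ)]
  exact integral_congr_ae (ae_of_all _ fun x => by simp only [mul_sub])

lemma ft_const_mul (c : ℂ) (f : 𝕏 → ℂ) (ξ : 𝕏) : ft (fun x => c * f x) ξ = c * ft f ξ := by
  rw [ft, ft, ← integral_const_mul]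
  exact integral_congr_ae (ae_of_all _ fun x => by simp only []; ring)

lemma ft_zero_eq (f : 𝕏 → ℂ) : ft f 0 = ∫ x, f x := by
  simp [ft, dotP]

lemma RieszPair.add {i : Fin d} {f g f' g' : 𝕏 → ℂ} (h : RieszPair i f g) (h' : RieszPair i f' g')
    (hf : Integrable f) (hg : Integrable g) (hf' : Integrable f') (hg' : Integrable g') :
    RieszPair i (fun x => f x + f' x) (fun x => g x + g' x) := by
  intro ξ
  rw [ft_add hf hf', ft_add hg hg', mul_add, mul_add, h ξ, h' ξ]

lemma RieszPair.sub {i : Fin d} {f g f' g' : 𝕏 → ℂ} (h : RieszPair i f g) (h' : RieszPair i f' g')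
    (hf : Integrable f) (hg : Integrable g) (hf' : Integrable f') (hg' : Integrable g') :
    RieszPair i (fun x => f x - f' x) (fun x => g x - g' x) := by
  intro ξ
  rw [ft_sub hf hf', ft_sub hg hg', mul_sub, mul_sub, h ξ, h' ξ]

lemma RieszPair.const_mul {i : Fin d} {f g : 𝕏 → ℂ} (h : RieszPair i f g) (c : ℂ) :
    RieszPair i (fun x => c * f x) (fun x => c * g x) := by
  intro ξ
  rw [ft_const_mul, ft_const_mul, mul_left_comm, h ξ]
  ring

lemma eucNorm_pos {ξ : 𝕏} (h : ξ ≠ 0) : 0 < eucNorm ξ := by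
  rw [← norm_toLp_eq_eucNorm, norm_pos_iff]
  intro hh
  exact h (by funext j; exact congrArg (fun v : 𝔼 => v j) hh)

lemma abs_le_eucNorm (ξ : 𝕏) (i : Fin d) : |ξ i| ≤ eucNorm ξ := by
  rw [← norm_toLp_eq_eucNorm]
  exact abs_coord_le i (WithLp.toLp 2 ξ : 𝔼)

/-- Uniqueness of the second member of a Riesz pair. -/
lemma RieszPair.unique {i : Fin d} {f g g' : 𝕏 → ℂ} (h : RieszPair i f g) (h' : RieszPair i f g')
    (hg : Integrable g) (hg' : Integrable g') : g =ᵐ[volume] g' := by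
  refine ae_eq_of_ft_eq hg hg' ?_
  have hnt : Nontrivial 𝕏 := ⟨0, Pi.single i 1, fun hh => by
    have := congrFun hh i
    simp at this⟩
  refine (continuous_ft hg).ext_on (s := {0}ᶜ) (dense_compl_singleton 0) (continuous_ft hg') fun ξ hξ => ?_
  have hn : (eucNorm ξ : ℂ) ≠ 0 := by exact_mod_cast (eucNorm_pos hξ).ne'
  exact mul_left_cancel₀ hn ((h ξ).trans (h' ξ).symm)

/-- The transform of the second member of a Riesz pair vanishes wherever that of the first does,
at nonzero frequencies. -/
lemma RieszPair.ft_eq_zero {i : Fin d} {f g : 𝕏 → ℂ} (h : RieszPair i f g) {ξ : 𝕏} (hξ : ξ ≠ 0)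
    (h0 : ft f ξ = 0) : ft g ξ = 0 := by
  have hn : (eucNorm ξ : ℂ) ≠ 0 := by exact_mod_cast (eucNorm_pos hξ).ne'
  have := h ξ
  rw [h0, mul_zero] at this
  exact (mul_eq_zero.1 this).resolve_left hn

lemma RieszPair.norm_ft_le {i : Fin d} {f g : 𝕏 → ℂ} (h : RieszPair i f g) {ξ : 𝕏} (hξ : ξ ≠ 0) :
    ‖ft g ξ‖ ≤ ‖ft f ξ‖ := by
  have hp := eucNorm_pos hξ
  have := congrArg norm (h ξ)
  rw [norm_mul, norm_mul, norm_mul, norm_neg, Complex.norm_I, one_mul, Complex.norm_real,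
    Complex.norm_real, Real.norm_of_nonneg hp.le] at this
  have h2 : eucNorm ξ * ‖ft g ξ‖ ≤ eucNorm ξ * ‖ft f ξ‖ := by
    rw [this]
    exact mul_le_mul_of_nonneg_right (abs_le_eucNorm ξ i) (norm_nonneg _)
  exact le_of_mul_le_mul_left h2 hp

/-- Cancellation at the zero frequency. -/
lemma RieszPair.ft_zero {i : Fin d} {f g : 𝕏 → ℂ} (h : RieszPair i f g) (hf : Integrable f)
    (hg : Integrable g) (h0 : ft f 0 = 0) : ft g 0 = 0 := by
  have hnt : Nontrivial 𝕏 := ⟨0, Pi.single i 1, fun hh => by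
    have := congrFun hh i
    simp at this⟩
  have h1 : Tendsto (fun ξ => ft g ξ) (𝓝[≠] 0) (𝓝 (ft g 0)) :=
    ((continuous_ft hg).tendsto 0).mono_left nhdsWithin_le_nhds
  have h2 : Tendsto (fun ξ => ft g ξ) (𝓝[≠] 0) (𝓝 0) := by
    have h3 : Tendsto (fun ξ => ‖ft f ξ‖) (𝓝[≠] 0) (𝓝 0) := by
      have := ((continuous_ft hf).tendsto 0).norm.mono_left (nhdsWithin_le_nhds (s := {0}ᶜ))
      rwa [h0, norm_zero] at this
    refine squeeze_zero_norm' ?_ h3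
    filter_upwards [self_mem_nhdsWithin] with ξ hξ
    exact h.norm_ft_le hξ
  exact tendsto_nhds_unique h1 h2

lemma eucNorm_smul (c : ℝ) (ξ : 𝕏) : eucNorm (c • ξ) = |c| * eucNorm ξ := by
  rw [← norm_toLp_eq_eucNorm, ← norm_toLp_eq_eucNorm, WithLp.toLp_smul, norm_smul, Real.norm_eq_abs]

end Transfer

section Lattice

variable {d : ℕ}

local notation "𝕏" => Fin d → ℝ
local notation "ℤℤ" => Fin d → ℤ

/-- The half-open unit cube `(0, 1]^d`. -/
def unitCell (d : ℕ) : Set (Fin d → ℝ) := Set.univ.pi fun _ => Set.Ioc (0 : ℝ) 1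

/-- The lattice point `k` with `x ∈ k + (0, 1]^d`. -/
def cellIndex (x : 𝕏) : ℤℤ := fun i => ⌈x i⌉ - 1

lemma measurableSet_unitCell : MeasurableSet (unitCell d) :=
  MeasurableSet.univ_pi fun _ => measurableSet_Ioc

lemma volume_unitCell : volume (unitCell d) = 1 := by
  rw [unitCell, Real.volume_pi_Ioc]
  simp

lemma intVec_sub (k l : ℤℤ) : intVec (k - l) = intVec k - intVec l := by
  ext i; simp [intVec]

lemma intVec_neg (k : ℤℤ) : intVec (-k) = -intVec k := by
  ext i; simp [intVec]

lemma intVec_zero : intVec (0 : ℤℤ) = 0 := by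
  ext i; simp [intVec]

lemma sub_intVec_mem_unitCell {x : 𝕏} {k : ℤℤ} : x - intVec k ∈ unitCell d ↔ k = cellIndex x := by
  simp only [unitCell, Set.mem_univ_pi, Set.mem_Ioc, Pi.sub_apply, intVec, funext_iff, cellIndex]
  refine forall_congr' fun i => ?_
  have := Int.ceil_eq_iff (a := x i) (z := k i + 1)
  push_cast at this
  constructor
  · rintro ⟨h1, h2⟩
    have := this.2 ⟨by linarith, by linarith⟩
    omega
  · intro h
    have := this.1 (by omega)
    constructor <;> linarith

lemma cellIndex_add {x : 𝕏} (hx : x ∈ unitCell d) (k : ℤℤ) : cellIndex (x + intVec k) = k := by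
  symm
  rw [← sub_intVec_mem_unitCell]
  simpa using hx

lemma measurable_cellIndex : Measurable (cellIndex : 𝕏 → ℤℤ) := by
  refine measurable_pi_lambda _ fun i => ?_
  exact (Int.measurable_ceil.comp (measurable_pi_apply i)).sub_const 1

lemma tsum_indicator_unitCell (x : 𝕏) (a : ℝ≥0∞) :
    ∑' k : ℤℤ, (unitCell d).indicator (fun _ => a) (x - intVec k) = a := by
  rw [tsum_eq_single (cellIndex x)]
  · rw [Set.indicator_of_mem (sub_intVec_mem_unitCell.2 rfl)]
  · intro k hk
    rw [Set.indicator_of_notMem]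
    rwa [sub_intVec_mem_unitCell]

/-- Tiling of an integral by lattice cells. -/
lemma lintegral_eq_tsum_unitCell {F : 𝕏 → ℝ≥0∞} (hF : AEMeasurable F) :
    ∫⁻ x, F x = ∑' k : ℤℤ, ∫⁻ x in unitCell d, F (x + intVec k) := by
  have h1 : ∀ k : ℤℤ, ∫⁻ x in unitCell d, F (x + intVec k) =
      ∫⁻ x, (unitCell d).indicator (fun _ => F x) (x - intVec k) := by
    intro k
    rw [← lintegral_indicator measurableSet_unitCell, ← lintegral_add_right_eq_self (fun x => (unitCell d).indicator (fun _ => F x) (x - intVec k)) (intVec k)]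
    refine lintegral_congr fun x => ?_
    simp only [add_sub_cancel_right]
    rfl
  simp_rw [h1]
  rw [← lintegral_tsum]
  · simp_rw [tsum_indicator_unitCell]
  · intro k
    have : (fun x : 𝕏 => (unitCell d).indicator (fun _ => F x) (x - intVec k)) =
        ((fun x => x - intVec k) ⁻¹' unitCell d).indicator F := by
      ext x; simp only [Set.indicator]; rfl
    rw [this]
    exact hF.indicator (measurableSet_unitCell.preimage (measurable_id.sub_const _))

lemma aemeasurable_comp_sub {F : 𝕏 → ℝ≥0∞} (hF : AEMeasurable F) (y : 𝕏) :
    AEMeasurable fun x => F (x - y) :=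
  hF.comp_quasiMeasurePreserving (measurePreserving_sub_right volume y).quasiMeasurePreserving

lemma aemeasurable_comp_add {F : 𝕏 → ℝ≥0∞} (hF : AEMeasurable F) (y : 𝕏) :
    AEMeasurable fun x => F (x + y) :=
  hF.comp_quasiMeasurePreserving (measurePreserving_add_right volume y).quasiMeasurePreserving

/-- The lattice sum `∑ₖ cₖ v(x - k)`. -/
def latSum (c : ℤℤ → ℂ) (v : 𝕏 → ℂ) (x : 𝕏) : ℂ := ∑' k, c k * v (x - intVec k)

/-- The lattice periodization `∑ₖ v(x - k)`. -/
def latPer (v : 𝕏 → ℂ) (x : 𝕏) : ℂ := ∑' k : ℤℤ, v (x - intVec k)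

lemma lintegral_tsum_mul (c : ℤℤ → ℝ≥0∞) {v : 𝕏 → ℝ≥0∞} (hv : AEMeasurable v) :
    ∫⁻ x, ∑' k, c k * v (x - intVec k) = (∑' k, c k) * ∫⁻ x, v x := by
  rw [lintegral_tsum fun k => (aemeasurable_comp_sub hv _).const_mul _, ← ENNReal.tsum_mul_right]
  refine tsum_congr fun k => ?_
  rw [lintegral_const_mul'' _ (aemeasurable_comp_sub hv _),
    lintegral_sub_right_eq_self (fun x => v x)]

lemma tsum_enorm_eq (c : ℤℤ → ℂ) (v : 𝕏 → ℂ) (x : 𝕏) :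
    ∑' k, ‖c k‖ₑ * ‖v (x - intVec k)‖ₑ = ∑' k, ‖c k * v (x - intVec k)‖ₑ := by
  simp_rw [enorm_mul]

lemma summable_of_tsum_enorm_ne_top {ι : Type*} {f : ι → ℂ} (h : ∑' k, ‖f k‖ₑ ≠ ⊤) : Summable f :=
  (summable_norm_iff.1 (tsum_enorm_ne_top_iff_summable_norm.1 h))

lemma ae_summable_latSum {c : ℤℤ → ℂ} (hc : ∑' k, ‖c k‖ₑ ≠ ⊤) {v : 𝕏 → ℂ} (hv : Integrable v) :
    ∀ᵐ x, Summable fun k => c k * v (x - intVec k) := by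
  have h := lintegral_tsum_mul (fun k => ‖c k‖ₑ) hv.1.enorm
  have h2 : ∫⁻ x : 𝕏, ∑' k, ‖c k‖ₑ * ‖v (x - intVec k)‖ₑ ≠ ⊤ := by
    rw [h]
    exact ENNReal.mul_ne_top hc hv.2.ne
  have h3 := ae_lt_top' (AEMeasurable.tsum fun k =>
    (aemeasurable_comp_sub hv.1.enorm (intVec k)).const_mul ‖c k‖ₑ) h2
  filter_upwards [h3] with x hx
  rw [tsum_enorm_eq] at hx
  exact summable_of_tsum_enorm_ne_top hx.ne

lemma lintegral_latSum_le (c : ℤℤ → ℂ) {v : 𝕏 → ℂ} (hv : Integrable v) :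
    ∫⁻ x, ‖latSum c v x‖ₑ ≤ (∑' k, ‖c k‖ₑ) * ∫⁻ x, ‖v x‖ₑ := by
  rw [← lintegral_tsum_mul _ hv.1.enorm]
  refine lintegral_mono fun x => ?_
  simp only []
  rw [tsum_enorm_eq]
  exact enorm_tsum_le_tsum_enorm

lemma aestronglyMeasurable_tsum {ι : Type*} [Countable ι] {μ : Measure 𝕏} {F : ι → 𝕏 → ℂ}
    (hF : ∀ k, AEStronglyMeasurable (F k) μ) : AEStronglyMeasurable (fun x => ∑' k, F k x) μ := by
  have h1 : (fun x => ∑' k, F k x) =ᵐ[μ] fun x => ∑' k, (hF k).mk (F k) x := by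
    filter_upwards [ae_all_iff.2 fun k => (hF k).ae_eq_mk] with x hx
    exact tsum_congr hx
  refine (Measurable.aestronglyMeasurable ?_).congr h1.symm
  exact Measurable.tsum fun k => (hF k).stronglyMeasurable_mk.measurable

lemma integrable_latSum {c : ℤℤ → ℂ} (hc : ∑' k, ‖c k‖ₑ ≠ ⊤) {v : 𝕏 → ℂ} (hv : Integrable v) :
    Integrable (latSum c v) := by
  refine ⟨aestronglyMeasurable_tsum fun k =>
    ((hv.comp_sub_right (intVec k)).const_mul (c k)).1, ?_⟩
  exact (lintegral_latSum_le c hv).trans_lt (ENNReal.mul_lt_top hc.lt_top hv.2)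

end Lattice

section LatticeStar

variable {d : ℕ}

local notation "𝕏" => Fin d → ℝ
local notation "ℤℤ" => Fin d → ℤ

lemma ae_of_ae_unitCell {p : 𝕏 → Prop} (hp : ∀ (k : ℤℤ) x, p (x + intVec k) ↔ p x)
    (h : ∀ᵐ x ∂(volume.restrict (unitCell d)), p x) : ∀ᵐ x, p x := by
  rw [ae_restrict_iff' measurableSet_unitCell] at h
  have h2 : ∀ k : ℤℤ, ∀ᵐ x : 𝕏, x - intVec k ∈ unitCell d → p x := by
    intro k
    have := (measurePreserving_sub_right (volume : Measure 𝕏) (intVec k)).quasiMeasurePreserving.ae h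
    filter_upwards [this] with x hx hx2
    have := hx hx2
    rwa [← hp k, sub_add_cancel] at this
  filter_upwards [ae_all_iff.2 h2] with x hx
  exact hx (cellIndex x) (sub_intVec_mem_unitCell.2 rfl)

lemma lintegral_unitCell_tsum {F : 𝕏 → ℝ≥0∞} (hF : AEMeasurable F) :
    ∫⁻ x in unitCell d, ∑' k : ℤℤ, F (x - intVec k) = ∫⁻ x, F x := by
  rw [lintegral_eq_tsum_unitCell hF, lintegral_tsum fun k =>
    (aemeasurable_comp_sub hF (intVec k)).restrict, ← (Equiv.neg ℤℤ).tsum_eq]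
  simp [intVec_neg, sub_eq_add_neg]

lemma ae_summable_latPer {v : 𝕏 → ℂ} (hv : Integrable v) :
    ∀ᵐ x, Summable fun k : ℤℤ => v (x - intVec k) := by
  refine ae_of_ae_unitCell (fun k x => ?_) ?_
  · rw [← (Equiv.subRight k).summable_iff (f := fun k : ℤℤ => v (x - intVec k))]
    refine iff_of_eq (congrArg (fun g => Summable g) (funext fun l => ?_))
    simp [intVec_sub, sub_sub_eq_add_sub]
  · have h := lintegral_unitCell_tsum hv.1.enorm
    have h3 := ae_lt_top' (μ := volume.restrict (unitCell d)) (AEMeasurable.tsum fun k =>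
      (aemeasurable_comp_sub hv.1.enorm (intVec k)).restrict) (by rw [h]; exact hv.2.ne)
    filter_upwards [h3] with x hx
    exact summable_of_tsum_enorm_ne_top hx.ne

lemma latPer_add (v : 𝕏 → ℂ) (x : 𝕏) (k : ℤℤ) : latPer v (x + intVec k) = latPer v x := by
  rw [latPer, latPer, ← (Equiv.subRight k).tsum_eq (fun k : ℤℤ => v (x - intVec k))]
  refine tsum_congr fun l => ?_
  simp [intVec_sub, sub_sub_eq_add_sub]

lemma lintegral_latPer_le {v : 𝕏 → ℂ} (hv : Integrable v) :
    ∫⁻ x in unitCell d, ‖latPer v x‖ₑ ≤ ∫⁻ x, ‖v x‖ₑ := by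
  rw [← lintegral_unitCell_tsum hv.1.enorm]
  exact lintegral_mono fun x => enorm_tsum_le_tsum_enorm

lemma aestronglyMeasurable_latPer {v : 𝕏 → ℂ} (hv : Integrable v) :
    AEStronglyMeasurable (latPer v) volume :=
  aestronglyMeasurable_tsum fun k => (hv.comp_sub_right (intVec k)).1

/-- The mass of `v` on the cell with index `n`. -/
def cellMass (v : 𝕏 → ℂ) (n : ℤℤ) : ℝ≥0∞ := ∫⁻ x in unitCell d, ‖v (x + intVec n)‖ₑ

lemma tsum_cellMass {v : 𝕏 → ℂ} (hv : Integrable v) :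
    ∑' n, cellMass v n = ∫⁻ x, ‖v x‖ₑ :=
  (lintegral_eq_tsum_unitCell hv.1.enorm).symm

/-- Replacing the coefficients in a lattice sum by a locally constant function. -/
lemma lintegral_latSum_sub_le {c : ℤℤ → ℂ} (hc : ∑' k, ‖c k‖ₑ ≠ ⊤) {v : 𝕏 → ℂ}
    (hv : Integrable v) :
    ∫⁻ x, ‖latSum c v x - c (cellIndex x) * latPer v x‖ₑ ≤
      ∑' n, (∑' m, ‖c (m - n) - c m‖ₑ) * cellMass v n := by
  have h1 : ∀ᵐ x : 𝕏, ‖latSum c v x - c (cellIndex x) * latPer v x‖ₑ ≤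
      ∑' k, ‖c k - c (cellIndex x)‖ₑ * ‖v (x - intVec k)‖ₑ := by
    filter_upwards [ae_summable_latSum hc hv, ae_summable_latPer hv] with x h1 h2
    rw [latSum, latPer, ← tsum_mul_left, ← h1.tsum_sub (h2.mul_left _)]
    refine enorm_tsum_le_tsum_enorm.trans (ENNReal.tsum_le_tsum fun k => ?_)
    rw [← sub_mul, enorm_mul]
  refine (lintegral_mono_ae h1).trans ?_
  have hm : ∀ k, AEMeasurable fun x => ‖c k - c (cellIndex x)‖ₑ * ‖v (x - intVec k)‖ₑ := by
    intro k
    refine AEMeasurable.mul (Measurable.aemeasurable ?_) (aemeasurable_comp_sub hv.1.enorm _)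
    exact (measurable_const.sub ((measurable_of_countable c).comp measurable_cellIndex)).enorm
  rw [lintegral_eq_tsum_unitCell (AEMeasurable.tsum hm)]
  have h2 : ∀ m : ℤℤ, ∫⁻ x in unitCell d,
      ∑' k, ‖c k - c (cellIndex (x + intVec m))‖ₑ * ‖v (x + intVec m - intVec k)‖ₑ =
      ∑' n, ‖c (m - n) - c m‖ₑ * cellMass v n := by
    intro m
    have : ∫⁻ x in unitCell d,
      ∑' k, ‖c k - c (cellIndex (x + intVec m))‖ₑ * ‖v (x + intVec m - intVec k)‖ₑ =
      ∫⁻ x in unitCell d, ∑' n, ‖c (m - n) - c m‖ₑ * ‖v (x + intVec n)‖ₑ := by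
      refine setLIntegral_congr_fun measurableSet_unitCell fun x hx => ?_
      rw [cellIndex_add hx, ← (Equiv.subLeft m).tsum_eq]
      refine tsum_congr fun n => ?_
      simp [intVec_sub, add_sub_assoc]
    rw [this, lintegral_tsum fun n =>
      ((aemeasurable_comp_add hv.1.enorm (intVec n)).restrict).const_mul _]
    refine tsum_congr fun n => ?_
    rw [lintegral_const_mul'' _ (aemeasurable_comp_add hv.1.enorm _).restrict, cellMass]
  simp_rw [h2]
  rw [ENNReal.tsum_comm]
  simp_rw [ENNReal.tsum_mul_right]
  exact le_rfl

/-- The `L¹` modulus of continuity. -/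
def om (F : 𝕏 → ℂ) (y : 𝕏) : ℝ≥0∞ := ∫⁻ x, ‖F x - F (x - y)‖ₑ

/-- The sampling coefficients of `F` against the translates of `φ`. -/
def latCoef (φ F : 𝕏 → ℂ) (k : ℤℤ) : ℂ := ∫ x, F x * (starRingEnd ℂ) (φ (x - intVec k))

/-- Uniformly bounded absolute periodization. -/
def LatBdd (φ : 𝕏 → ℂ) (M : ℝ≥0∞) : Prop := ∀ x, ∑' k : ℤℤ, ‖φ (x - intVec k)‖ₑ ≤ M

lemma LatBdd.enorm_le {φ : 𝕏 → ℂ} {M : ℝ≥0∞} (h : LatBdd φ M) (x : 𝕏) : ‖φ x‖ₑ ≤ M := by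
  have := (ENNReal.le_tsum (f := fun k : ℤℤ => ‖φ (x - intVec k)‖ₑ) 0).trans (h x)
  simpa [intVec_zero] using this

lemma tsum_enorm_latCoef_le {φ : 𝕏 → ℂ} (hφ : Measurable φ) {M : ℝ≥0∞} (h : LatBdd φ M)
    {F : 𝕏 → ℂ} (hF : Integrable F) : ∑' k, ‖latCoef φ F k‖ₑ ≤ M * ∫⁻ x, ‖F x‖ₑ := by
  have hm : ∀ k : ℤℤ, Measurable fun x => ‖φ (x - intVec k)‖ₑ := fun k =>
    (hφ.comp (measurable_id.sub_const _)).enorm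
  calc ∑' k, ‖latCoef φ F k‖ₑ ≤ ∑' k : ℤℤ, ∫⁻ x, ‖F x‖ₑ * ‖φ (x - intVec k)‖ₑ := by
        refine ENNReal.tsum_le_tsum fun k => ?_
        refine (enorm_integral_le_lintegral_enorm _).trans_eq (lintegral_congr fun x => ?_)
        rw [enorm_mul, RCLike.enorm_conj]
    _ = ∫⁻ x, ∑' k : ℤℤ, ‖F x‖ₑ * ‖φ (x - intVec k)‖ₑ :=
        (lintegral_tsum fun k => hF.1.enorm.mul (hm k).aemeasurable).symm
    _ ≤ ∫⁻ x, M * ‖F x‖ₑ := by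
        refine lintegral_mono fun x => ?_
        simp only []
        rw [ENNReal.tsum_mul_left, mul_comm]
        gcongr
        exact h x
    _ = M * ∫⁻ x, ‖F x‖ₑ := lintegral_const_mul'' _ hF.1.enorm

lemma integrable_mul_conj {φ : 𝕏 → ℂ} (hφ : Measurable φ) {M : ℝ≥0∞} (hM : M ≠ ⊤)
    (h : LatBdd φ M) {F : 𝕏 → ℂ} (hF : Integrable F) (y : 𝕏) :
    Integrable fun x => F x * (starRingEnd ℂ) (φ (x - y)) := by
  refine hF.mul_bdd (c := M.toReal) ?_ ?_
  · exact (Complex.continuous_conj.measurable.comp (hφ.comp (measurable_id.sub_const _))).aestronglyMeasurable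
  · refine ae_of_all _ fun x => ?_
    rw [RCLike.norm_conj, ← toReal_enorm]
    exact ENNReal.toReal_mono hM (h.enorm_le _)

lemma latCoef_sub {φ : 𝕏 → ℂ} (hφ : Measurable φ) {M : ℝ≥0∞} (hM : M ≠ ⊤)
    (h : LatBdd φ M) {F G : 𝕏 → ℂ} (hF : Integrable F) (hG : Integrable G) (k : ℤℤ) :
    latCoef φ (fun x => F x - G x) k = latCoef φ F k - latCoef φ G k := by
  rw [latCoef, latCoef, latCoef, ← integral_sub (integrable_mul_conj hφ hM h hF _)
    (integrable_mul_conj hφ hM h hG _)]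
  simp_rw [sub_mul]

lemma latCoef_shift (φ F : 𝕏 → ℂ) (m n : ℤℤ) :
    latCoef φ F (m - n) = latCoef φ (fun x => F (x - intVec n)) m := by
  rw [latCoef, latCoef, ← integral_sub_right_eq_self _ (intVec n)]
  refine integral_congr_ae (ae_of_all _ fun x => ?_)
  simp [intVec_sub, sub_sub]

lemma tsum_enorm_latCoef_sub_le {φ : 𝕏 → ℂ} (hφ : Measurable φ) {M : ℝ≥0∞} (hM : M ≠ ⊤)
    (h : LatBdd φ M) {F : 𝕏 → ℂ} (hF : Integrable F) (n : ℤℤ) :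
    ∑' m, ‖latCoef φ F (m - n) - latCoef φ F m‖ₑ ≤ M * om F (intVec n) := by
  have := tsum_enorm_latCoef_le hφ h (hF.sub (hF.comp_sub_right (intVec n)))
  refine le_trans (ENNReal.tsum_le_tsum fun m => ?_) this
  rw [latCoef_shift, enorm_sub_rev, ← latCoef_sub hφ hM h hF (hF.comp_sub_right (intVec n))]
  exact le_rfl

/-- The lattice synthesis of sampled coefficients is close to a periodic modulation. -/
theorem lintegral_latSum_latCoef_sub_le {φ : 𝕏 → ℂ} (hφ : Measurable φ) {M : ℝ≥0∞} (hM : M ≠ ⊤)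
    (h : LatBdd φ M) {F v : 𝕏 → ℂ} (hF : Integrable F) (hv : Integrable v) :
    ∫⁻ x, ‖latSum (latCoef φ F) v x - latCoef φ F (cellIndex x) * latPer v x‖ₑ ≤
      ∑' n, M * om F (intVec n) * cellMass v n := by
  have hc : ∑' k, ‖latCoef φ F k‖ₑ ≠ ⊤ :=
    ((tsum_enorm_latCoef_le hφ h hF).trans_lt (ENNReal.mul_lt_top hM.lt_top hF.2)).ne
  refine (lintegral_latSum_sub_le hc hv).trans (ENNReal.tsum_le_tsum fun n => ?_)
  gcongr
  exact tsum_enorm_latCoef_sub_le hφ hM h hF n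

lemma one_add_norm_rpow_le {d : ℕ} {y t : Fin d → ℝ} (ht : ‖t‖ ≤ 1) {r : ℝ} (hr : 0 ≤ r) :
    (1 + ‖y‖) ^ (-r) ≤ 2 ^ r * (1 + ‖y + t‖) ^ (-r) := by
  have h1 : 1 + ‖y + t‖ ≤ 2 * (1 + ‖y‖) := by
    have := norm_add_le y t
    have := norm_nonneg y
    linarith
  have h2 : 0 < 1 + ‖y + t‖ := by positivity
  have h3 : 0 < 1 + ‖y‖ := by positivity
  have := Real.rpow_le_rpow_of_nonpos h2 h1 (neg_nonpos.2 hr)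
  rw [Real.mul_rpow (by norm_num) h3.le] at this
  have h4 : (2:ℝ) ^ r * 2 ^ (-r) = 1 := by
    rw [← Real.rpow_add (by norm_num)]; simp
  calc (1 + ‖y‖) ^ (-r) = 2 ^ r * (2 ^ (-r) * (1 + ‖y‖) ^ (-r)) := by rw [← mul_assoc, h4, one_mul]
    _ ≤ _ := by gcongr

/-- Schwartz functions have uniformly bounded absolute periodization. -/
lemma exists_latBdd (Φ : SchwartzMap (Fin d → ℝ) ℂ) : ∃ M : ℝ≥0∞, M ≠ ⊤ ∧ LatBdd Φ M := by
  set r : ℝ := ((d + 1 : ℕ) : ℝ) with hr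
  have hr0 : 0 ≤ r := by positivity
  obtain ⟨C, hC⟩ : ∃ C : ℝ, ∀ x, ‖Φ x‖ ≤ C * (1 + ‖x‖) ^ (-r) := by
    refine ⟨2 ^ (d + 1) * (Finset.Iic (d + 1, 0)).sup (fun m => SchwartzMap.seminorm ℝ m.1 m.2) Φ, fun x => ?_⟩
    have := SchwartzMap.one_add_le_sup_seminorm_apply (𝕜 := ℝ) (m := (d + 1, 0)) (k := d + 1) (n := 0)
      le_rfl le_rfl Φ x
    rw [norm_iteratedFDeriv_zero] at this
    have hp : 0 < (1 + ‖x‖) := by positivity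
    rw [Real.rpow_neg hp.le, hr, Real.rpow_natCast, ← div_eq_mul_inv, le_div_iff₀ (by positivity), mul_comm]
    exact this
  have hint : Integrable (fun x : 𝕏 => (1 + ‖x‖) ^ (-r)) := by
    refine integrable_one_add_norm ?_
    simp [hr]
  set G : 𝕏 → ℝ≥0∞ := fun x => ENNReal.ofReal (C * 2 ^ r * (1 + ‖x‖) ^ (-r)) with hG
  have hGi : ∫⁻ x, G x ≠ ⊤ := (hint.const_mul (C * 2 ^ r)).lintegral_lt_top.ne
  have hC0 : 0 ≤ C := by
    have := (norm_nonneg _).trans (hC 0)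
    simpa using this
  have hGm : Measurable G := by
    refine ENNReal.measurable_ofReal.comp (Measurable.const_mul ?_ _)
    exact (measurable_norm.const_add 1).pow_const _
  refine ⟨∫⁻ x, G x, hGi, fun x => ?_⟩
  have hGm' : AEMeasurable fun t => G (x + t) := (hGm.comp (measurable_const_add x)).aemeasurable
  have e1 : ∫⁻ t, G t = ∫⁻ t in unitCell d, ∑' k : ℤℤ, G (x + (t - intVec k)) := by
    rw [lintegral_unitCell_tsum hGm', lintegral_add_left_eq_self]
  rw [e1]
  calc ∑' k : ℤℤ, ‖Φ (x - intVec k)‖ₑ = ∫⁻ t in unitCell d, ∑' k : ℤℤ, ‖Φ (x - intVec k)‖ₑ := by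
        rw [setLIntegral_const, volume_unitCell, mul_one]
    _ ≤ _ := by
        refine setLIntegral_mono' measurableSet_unitCell fun t ht => ENNReal.tsum_le_tsum fun k => ?_
        rw [← ofReal_norm, hG]
        refine ENNReal.ofReal_le_ofReal ((hC _).trans ?_)
        rw [mul_assoc]
        gcongr
        have ht1 : ‖t‖ ≤ 1 := by
          rw [pi_norm_le_iff_of_nonneg zero_le_one]
          intro i
          have := ht i (Set.mem_univ i)
          rw [Real.norm_eq_abs, abs_le]
          constructor <;> linarith [this.1, this.2]
        have := one_add_norm_rpow_le (y := x - intVec k) ht1 hr0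
        rw [show x - intVec k + t = x + (t - intVec k) by abel] at this
        exact this

end LatticeStar

section Torus

variable {d : ℕ}

local notation "𝕏" => Fin d → ℝ
local notation "ℤℤ" => Fin d → ℤ

attribute [local instance] instMeasureSpaceUnitAddCircle
attribute [local instance] instIsProbabilityMeasureUnitAddCircleVolume

/-- The character `e^{2πi ξ x}`. -/
def expChar (ξ x : 𝕏) : ℂ := Complex.exp ((2 * Real.pi * dotP ξ x : ℝ) * Complex.I)

lemma mFourier_coe (l : ℤℤ) (x : 𝕏) :
    UnitAddTorus.mFourier l (fun i => (x i : UnitAddCircle)) = expChar (intVec l) x := by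
  simp only [UnitAddTorus.mFourier, ContinuousMap.coe_mk, fourier_coe_apply, expChar, dotP, intVec]
  rw [← Complex.exp_sum]
  congr 1
  push_cast
  rw [Finset.mul_sum, Finset.sum_mul]
  refine Finset.sum_congr rfl fun i _ => ?_
  ring

/-- The function on the torus with given values on the unit cell. -/
def toTorus (F : 𝕏 → ℂ) (t : UnitAddTorus (Fin d)) : ℂ :=
  F (UnitAddTorus.measurableEquivPiIoc (0 : 𝕏) t).1

lemma setOf_eq_unitCell :
    {x : 𝕏 | ∀ i, x i ∈ Set.Ioc ((0 : 𝕏) i) ((0 : 𝕏) i + 1)} = unitCell d := by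
  ext x; simp [unitCell]

lemma toTorus_coe (F : 𝕏 → ℂ) {x : 𝕏} (hx : x ∈ unitCell d) :
    toTorus F (fun i => (x i : UnitAddCircle)) = F x := by
  have hx' : ∀ i, x i ∈ Set.Ioc ((0 : 𝕏) i) ((0 : 𝕏) i + 1) := by
    rwa [← setOf_eq_unitCell] at hx
  have := (UnitAddTorus.measurableEquivPiIoc (0 : 𝕏)).apply_symm_apply ⟨x, hx'⟩
  rw [UnitAddTorus.coe_symm_measurableEquivPiIoc_apply] at this
  rw [toTorus, this]

lemma lintegral_torus (G : UnitAddTorus (Fin d) → ℝ≥0∞) :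
    ∫⁻ t, G t = ∫⁻ x in unitCell d, G (fun i => (x i : UnitAddCircle)) := by
  rw [UnitAddTorus.lintegral_preimage G 0, setOf_eq_unitCell]

lemma integral_torus (G : UnitAddTorus (Fin d) → ℂ) :
    ∫ t, G t = ∫ x in unitCell d, G (fun i => (x i : UnitAddCircle)) := by
  rw [UnitAddTorus.integral_preimage G 0, setOf_eq_unitCell]

lemma integrable_toTorus {F : 𝕏 → ℂ} (hF : IntegrableOn F (unitCell d)) :
    Integrable (toTorus F) := by
  rw [← setOf_eq_unitCell] at hF
  have hms : MeasurableSet {x : 𝕏 | ∀ i, x i ∈ Set.Ioc ((0 : 𝕏) i) ((0 : 𝕏) i + 1)} := by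
    rw [setOf_eq_unitCell]; exact measurableSet_unitCell
  exact (UnitAddTorus.measurePreserving_equivPiIoc (0 : 𝕏)).integrable_comp_of_integrable
    ((integrableOn_iff_comap_subtypeVal hms).1 hF)

/-- Uniqueness of Fourier coefficients of integrable functions on the unit cell. -/
theorem ae_eq_zero_of_coeff {F : 𝕏 → ℂ} (hF : IntegrableOn F (unitCell d))
    (h : ∀ l : ℤℤ, ∫ x in unitCell d, expChar (intVec l) x * F x = 0) :
    ∀ᵐ x ∂(volume.restrict (unitCell d)), F x = 0 := by
  set G := toTorus F with hGdef
  have hG : Integrable G := integrable_toTorus hF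
  have hcoe : ∀ l : ℤℤ, ∫ t, UnitAddTorus.mFourier l t * G t = 0 := by
    intro l
    rw [integral_torus, ← h l]
    refine setIntegral_congr_fun measurableSet_unitCell fun x hx => ?_
    rw [mFourier_coe, hGdef, toTorus_coe F hx]
  have hint : ∀ g : C(UnitAddTorus (Fin d), ℂ), Integrable fun t => g t * G t := fun g =>
    hG.bdd_mul (c := ‖g‖) g.continuous.aestronglyMeasurable (ae_of_all _ fun t => g.norm_coe_le_norm t)
  let L : C(UnitAddTorus (Fin d), ℂ) →L[ℂ] ℂ := LinearMap.mkContinuous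
    { toFun := fun g => ∫ t, g t * G t
      map_add' := fun g g' => by
        rw [← integral_add (hint g) (hint g')]
        simp [add_mul]
      map_smul' := fun c g => by
        simp only [ContinuousMap.coe_smul, Pi.smul_apply, smul_eq_mul, RingHom.id_apply, mul_assoc]
        exact integral_const_mul _ _ } (∫ t, ‖G t‖) (fun g => by
        rw [mul_comm, ← integral_const_mul]
        refine norm_integral_le_of_norm_le (hG.norm.const_mul _) (ae_of_all _ fun t => ?_)
        rw [norm_mul]
        exact mul_le_mul_of_nonneg_right (g.norm_coe_le_norm t) (norm_nonneg _))
  have hL : ∀ g, L g = ∫ t, g t * G t := fun g => rfl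
  have hker : (Submodule.span ℂ (Set.range (UnitAddTorus.mFourier (d := Fin d)))).topologicalClosure ≤
      L.ker := by
    refine Submodule.topologicalClosure_minimal _ ?_ L.isClosed_ker
    rw [Submodule.span_le]
    rintro _ ⟨l, rfl⟩
    exact hcoe l
  rw [UnitAddTorus.span_mFourier_closure_eq_top] at hker
  have hz : ∀ g : C(UnitAddTorus (Fin d), ℂ), ∫ t, g t * G t = 0 := fun g => hker (Submodule.mem_top (x := g))
  have hG0 : G =ᵐ[volume] 0 := by
    refine ae_eq_zero_of_forall_setIntegral_isClosed_eq_zero hG fun s hs => ?_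
    have h1 : Tendsto (fun n => ∫ t, ((hs.apprSeq n t : ℝ) : ℂ) * G t) atTop
        (𝓝 (∫ t, s.indicator G t)) := by
      refine tendsto_integral_of_dominated_convergence (fun t => ‖G t‖) (fun n => ?_) hG.norm
        (fun n => ae_of_all _ fun t => ?_) (ae_of_all _ fun t => ?_)
      · refine (Continuous.aestronglyMeasurable ?_).mul hG.1
        exact Complex.continuous_ofReal.comp (NNReal.continuous_coe.comp (hs.apprSeq n).continuous)
      · rw [norm_mul, Complex.norm_real]
        refine mul_le_of_le_one_left (norm_nonneg _) ?_
        rw [Real.norm_of_nonneg NNReal.zero_le_coe]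
        exact_mod_cast HasOuterApproxClosed.apprSeq_apply_le_one hs n t
      · have h2 := tendsto_pi_nhds.1 (HasOuterApproxClosed.tendsto_apprSeq hs) t
        have h3 : Tendsto (fun n => ((hs.apprSeq n t : ℝ) : ℂ) * G t) atTop
            (𝓝 ((NNReal.toReal (s.indicator (fun _ => (1 : ℝ≥0)) t) : ℂ) * G t)) :=
          (((Complex.continuous_ofReal.comp NNReal.continuous_coe).tendsto _).comp h2).mul_const (G t)
        convert h3 using 2
        by_cases ht : t ∈ s <;> simp [ht]
    rw [integral_indicator hs.measurableSet] at h1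
    refine tendsto_nhds_unique h1 ?_
    have : ∀ n, ∫ t, ((hs.apprSeq n t : ℝ) : ℂ) * G t = 0 := fun n =>
      hz ⟨fun t => ((hs.apprSeq n t : ℝ) : ℂ),
        Complex.continuous_ofReal.comp (NNReal.continuous_coe.comp (hs.apprSeq n).continuous)⟩
    simp_rw [this]
    exact tendsto_const_nhds
  have h4 : ∫⁻ x in unitCell d, ‖F x‖ₑ = 0 := by
    have : ∫⁻ x in unitCell d, ‖F x‖ₑ = ∫⁻ t, ‖G t‖ₑ := by
      rw [lintegral_torus]
      refine setLIntegral_congr_fun measurableSet_unitCell fun x hx => ?_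
      rw [hGdef, toTorus_coe F hx]
    rw [this, lintegral_congr_ae (g := fun _ => 0)]
    · simp
    · filter_upwards [hG0] with t ht
      simp [ht]
  rw [lintegral_eq_zero_iff' hF.1.enorm] at h4
  filter_upwards [h4] with x hx
  simpa using hx

/-- Trigonometric polynomials are dense in `L¹` of the unit cell. -/
theorem exists_trigPoly {F : 𝕏 → ℂ} (hF : IntegrableOn F (unitCell d)) {ε : ℝ≥0∞} (hε : 0 < ε) :
    ∃ a : ℤℤ →₀ ℂ, ∫⁻ x in unitCell d, ‖F x - a.sum fun l z => z * expChar (intVec l) x‖ₑ < ε := by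
  set G := toTorus F with hGdef
  have hG : Integrable G := integrable_toTorus hF
  have hGL : MemLp G 1 := memLp_one_iff_integrable.2 hG
  have hden := UnitAddTorus.span_mFourierLp_closure_eq_top (d := Fin d) (p := 1) ENNReal.one_ne_top
  have hmem : hGL.toLp G ∈ closure (Submodule.span ℂ
      (Set.range (UnitAddTorus.mFourierLp (d := Fin d) 1)) : Set (Lp ℂ 1 volume)) := by
    rw [← Submodule.topologicalClosure_coe, hden]
    trivial
  obtain ⟨p, hp, hpe⟩ := EMetric.mem_closure_iff.1 hmem ε hε
  obtain ⟨a, rfl⟩ := (Finsupp.mem_span_range_iff_exists_finsupp).1 hp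
  refine ⟨a, ?_⟩
  have hae : ((a.sum fun i z => z • UnitAddTorus.mFourierLp 1 i : Lp ℂ 1 volume) :
      UnitAddTorus (Fin d) → ℂ) =ᵐ[volume] fun t => a.sum fun l z => z * UnitAddTorus.mFourier l t := by
    have h1 : ∀ S : Finset ℤℤ, ((∑ i ∈ S, a i • UnitAddTorus.mFourierLp 1 i : Lp ℂ 1 volume) :
        UnitAddTorus (Fin d) → ℂ) =ᵐ[volume] fun t => ∑ i ∈ S, a i * UnitAddTorus.mFourier i t := by
      classical
      intro S
      induction S using Finset.induction_on with
      | empty =>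
        filter_upwards [Lp.coeFn_zero ℂ 1 (volume : Measure (UnitAddTorus (Fin d)))] with t ht
        simpa using ht
      | insert i S hi ih =>
        rw [Finset.sum_insert hi]
        filter_upwards [Lp.coeFn_add (a i • UnitAddTorus.mFourierLp (d := Fin d) 1 i)
          (∑ i ∈ S, a i • UnitAddTorus.mFourierLp 1 i), ih,
          Lp.coeFn_smul (a i) (UnitAddTorus.mFourierLp (d := Fin d) 1 i),
          UnitAddTorus.coeFn_mFourierLp 1 i] with t h1 h2 h3 h4
        rw [h1, Pi.add_apply, h2, h3, Pi.smul_apply, h4, smul_eq_mul, Finset.sum_insert hi]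
    exact h1 a.support
  rw [Lp.edist_def, eLpNorm_one_eq_lintegral_enorm] at hpe
  refine lt_of_eq_of_lt ?_ hpe
  have h5 : ∫⁻ t, ‖(⇑(hGL.toLp G) - ⇑(a.sum fun i z => z • UnitAddTorus.mFourierLp (d := Fin d) 1 i)) t‖ₑ =
      ∫⁻ t, ‖G t - a.sum fun l z => z * UnitAddTorus.mFourier l t‖ₑ := by
    refine lintegral_congr_ae ?_
    filter_upwards [hGL.coeFn_toLp, hae] with t h1 h2
    rw [Pi.sub_apply, h1, h2]
  rw [h5, lintegral_torus]
  refine setLIntegral_congr_fun measurableSet_unitCell fun x hx => ?_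
  rw [hGdef, toTorus_coe F hx]
  simp_rw [mFourier_coe]

end Torus

section Shannon

variable {d : ℕ}

local notation "𝕏" => Fin d → ℝ
local notation "ℤℤ" => Fin d → ℤ

lemma ft_eq_expChar (f : 𝕏 → ℂ) (ξ : 𝕏) : ft f ξ = ∫ x, expChar (-ξ) x * f x := by
  rw [ft]
  refine integral_congr_ae (ae_of_all _ fun x => ?_)
  simp [expChar, dotP]

lemma norm_expChar (ξ x : 𝕏) : ‖expChar ξ x‖ = 1 := Complex.norm_exp_ofReal_mul_I _

lemma enorm_expChar (ξ x : 𝕏) : ‖expChar ξ x‖ₑ = 1 := by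
  rw [← ofReal_norm, norm_expChar, ENNReal.ofReal_one]

lemma expChar_add (ξ x y : 𝕏) : expChar ξ (x + y) = expChar ξ x * expChar ξ y := by
  rw [expChar, expChar, expChar, ← Complex.exp_add]
  simp only [dotP, Pi.add_apply, mul_add, Finset.sum_add_distrib]
  congr 1; push_cast; ring

lemma expChar_add_left (ξ η x : 𝕏) : expChar (ξ + η) x = expChar ξ x * expChar η x := by
  rw [expChar, expChar, expChar, ← Complex.exp_add]
  simp only [dotP, Pi.add_apply, add_mul, Finset.sum_add_distrib]
  congr 1; push_cast; ring

lemma expChar_zero_left (x : 𝕏) : expChar 0 x = 1 := by simp [expChar, dotP]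

lemma expChar_neg (ξ x : 𝕏) : expChar ξ (-x) = expChar (-ξ) x := by simp [expChar, dotP]

lemma expChar_smul (ξ x : 𝕏) (a : ℝ) : expChar ξ (a • x) = expChar (a • ξ) x := by
  rw [expChar, expChar]
  congr 4
  simp only [dotP, Pi.smul_apply, smul_eq_mul]
  exact Finset.sum_congr rfl fun i _ => by ring

lemma conj_expChar (ξ x : 𝕏) : (starRingEnd ℂ) (expChar ξ x) = expChar (-ξ) x := by
  rw [expChar, expChar, ← Complex.exp_conj, map_mul, Complex.conj_ofReal, Complex.conj_I]
  simp [dotP]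

lemma expChar_intVec (l k : ℤℤ) : expChar (intVec l) (intVec k) = 1 := by
  rw [expChar, Complex.exp_eq_one_iff]
  refine ⟨∑ i, l i * k i, ?_⟩
  simp only [dotP, intVec]
  push_cast
  ring

lemma expChar_intVec_sub (l k : ℤℤ) (x : 𝕏) :
    expChar (intVec l) (x - intVec k) = expChar (intVec l) x := by
  rw [sub_eq_add_neg, expChar_add, ← intVec_neg, expChar_intVec, mul_one]

lemma continuous_expChar (ξ : 𝕏) : Continuous (expChar ξ) := by
  unfold expChar dotP
  fun_prop

lemma integrable_expChar_mul {f : 𝕏 → ℂ} (hf : Integrable f) (ξ : 𝕏) :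
    Integrable fun x => expChar ξ x * f x :=
  hf.bdd_mul (c := 1) (continuous_expChar ξ).aestronglyMeasurable
    (ae_of_all _ fun x => (norm_expChar ξ x).le)

/-- Tiling of a Bochner integral by lattice cells. -/
lemma setIntegral_unitCell_latPer {v : 𝕏 → ℂ} (hv : Integrable v) :
    ∫ x in unitCell d, latPer v x = ∫ x, v x := by
  have e1 : ∀ k : ℤℤ, ∫ x in unitCell d, v (x - intVec k) =
      ∫ x, (unitCell d).indicator (fun _ => v x) (x + intVec k) := by
    intro k
    rw [← integral_indicator measurableSet_unitCell, ← integral_sub_right_eq_self (fun x => (unitCell d).indicator (fun _ => v x) (x + intVec k)) (intVec k)]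
    refine integral_congr_ae (ae_of_all _ fun x => ?_)
    simp only [sub_add_cancel]
    rfl
  have hm : ∀ k : ℤℤ, AEStronglyMeasurable (fun x => (unitCell d).indicator (fun _ => v x) (x + intVec k)) volume := by
    intro k
    have : (fun x : 𝕏 => (unitCell d).indicator (fun _ => v x) (x + intVec k)) =
        ((fun x => x + intVec k) ⁻¹' unitCell d).indicator v := by
      ext x; simp only [Set.indicator]; rfl
    rw [this]
    exact hv.1.indicator (measurableSet_unitCell.preimage (measurable_id.add_const _))
  have ind : ∀ x : 𝕏, ∀ a : ℂ, ∀ k : ℤℤ, (unitCell d).indicator (fun _ => a) (x + intVec k) =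
      if k = -cellIndex x then a else 0 := by
    intro x a k
    have := sub_intVec_mem_unitCell (x := x) (k := -k)
    rw [intVec_neg, sub_neg_eq_add, neg_eq_iff_eq_neg] at this
    simp only [Set.indicator, this]
  simp only [latPer]
  rw [integral_tsum]
  · simp_rw [e1]
    rw [← integral_tsum hm]
    · refine integral_congr_ae (ae_of_all _ fun x => ?_)
      simp only [ind, tsum_ite_eq]
    · have : ∀ k : ℤℤ, ∫⁻ x, ‖(unitCell d).indicator (fun _ => v x) (x + intVec k)‖ₑ =
          ∫⁻ x in unitCell d, ‖v (x + intVec (-k))‖ₑ := by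
        intro k
        rw [← lintegral_indicator measurableSet_unitCell, ← lintegral_sub_right_eq_self (fun x => ‖(unitCell d).indicator (fun _ => v x) (x + intVec k)‖ₑ) (intVec k)]
        refine lintegral_congr fun x => ?_
        simp only [sub_add_cancel, intVec_neg, ← sub_eq_add_neg]
        by_cases hx : x ∈ unitCell d <;> simp [hx]
      simp_rw [this]
      have h2 := (Equiv.neg ℤℤ).tsum_eq (fun k => ∫⁻ x in unitCell d, ‖v (x + intVec k)‖ₑ)
      simp only [Equiv.neg_apply] at h2
      rw [h2, ← lintegral_eq_tsum_unitCell hv.1.enorm]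
      exact hv.2.ne
  · exact fun k => (hv.comp_sub_right _).1.restrict
  · rw [← lintegral_tsum fun k => (aemeasurable_comp_sub hv.1.enorm (intVec k)).restrict,
      lintegral_unitCell_tsum hv.1.enorm]
    exact hv.2.ne

lemma setIntegral_expChar_mul_latPer {v : 𝕏 → ℂ} (hv : Integrable v) (l : ℤℤ) :
    ∫ x in unitCell d, expChar (intVec l) x * latPer v x = ft v (-intVec l) := by
  rw [ft_eq_expChar, neg_neg, ← setIntegral_unitCell_latPer (integrable_expChar_mul hv _)]
  refine setIntegral_congr_fun measurableSet_unitCell fun x _ => ?_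
  simp only [latPer, ← tsum_mul_left, expChar_intVec_sub]

lemma integrableOn_latPer {v : 𝕏 → ℂ} (hv : Integrable v) : IntegrableOn (latPer v) (unitCell d) :=
  ⟨(aestronglyMeasurable_latPer hv).restrict, (lintegral_latPer_le hv).trans_lt hv.2⟩

attribute [local instance] instMeasureSpaceUnitAddCircle
attribute [local instance] instIsProbabilityMeasureUnitAddCircleVolume

lemma setIntegral_expChar {l : ℤℤ} (hl : l ≠ 0) : ∫ x in unitCell d, expChar (intVec l) x = 0 := by
  have h := (UnitAddTorus.orthonormal_mFourier (d := Fin d)).2 (i := 0) (j := l) (Ne.symm hl)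
  simp only [ContinuousMap.inner_toLp, UnitAddTorus.mFourier_zero] at h
  simp only [ContinuousMap.one_apply, map_one, mul_one] at h
  rw [integral_torus] at h
  rw [← h]
  refine setIntegral_congr_fun measurableSet_unitCell fun x _ => ?_
  simp only [mFourier_coe]

lemma intVec_ne_zero {l : ℤℤ} (hl : l ≠ 0) : intVec l ≠ 0 := by
  contrapose hl
  ext i
  have := congrFun hl i
  simpa [intVec] using this

/-- The periodization of `v` is constant when `v̂` vanishes at the nonzero lattice points. -/
theorem latPer_ae_eq {v : 𝕏 → ℂ} (hv : Integrable v) (h : ∀ l : ℤℤ, l ≠ 0 → ft v (intVec l) = 0) :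
    ∀ᵐ x, latPer v x = ft v 0 := by
  have hfin : IsFiniteMeasure (volume.restrict (unitCell d)) :=
    ⟨by rw [Measure.restrict_apply_univ, volume_unitCell]; exact ENNReal.one_lt_top⟩
  refine ae_of_ae_unitCell (fun k x => by rw [latPer_add]) ?_
  have hc : IntegrableOn (fun _ : 𝕏 => ft v 0) (unitCell d) := integrable_const _
  have := ae_eq_zero_of_coeff (F := fun x => latPer v x - ft v 0)
    ((integrableOn_latPer hv).sub hc) ?_
  · filter_upwards [this] with x hx
    exact sub_eq_zero.1 hx
  · intro l
    have hb : ∀ {F : 𝕏 → ℂ}, IntegrableOn F (unitCell d) →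
        IntegrableOn (fun x => expChar (intVec l) x * F x) (unitCell d) := fun hF =>
      hF.bdd_mul (c := 1) (continuous_expChar _).aestronglyMeasurable
        (ae_of_all _ fun x => (norm_expChar _ x).le)
    simp_rw [mul_sub]
    rw [integral_sub (hb (integrableOn_latPer hv)) (hb hc), setIntegral_expChar_mul_latPer hv,
      integral_mul_const]
    by_cases hl : l = 0
    · subst hl
      simp [intVec_zero, expChar_zero_left, Measure.real, volume_unitCell]
    · rw [setIntegral_expChar hl, ← intVec_neg, h _ (neg_ne_zero.2 hl)]
      simp

lemma ft_intVec_eq_zero {v : 𝕏 → ℂ} (hv : Integrable v) {c : ℂ} (h : ∀ᵐ x, latPer v x = c)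
    {l : ℤℤ} (hl : l ≠ 0) : ft v (intVec l) = 0 := by
  have h1 := setIntegral_expChar_mul_latPer hv (-l)
  rw [intVec_neg, neg_neg] at h1
  rw [← h1]
  have : ∫ x in unitCell d, expChar (-intVec l) x * latPer v x =
      ∫ x in unitCell d, expChar (intVec (-l)) x * c := by
    refine integral_congr_ae ?_
    filter_upwards [ae_restrict_of_ae h] with x hx
    rw [hx, intVec_neg]
  rw [this, integral_mul_const, setIntegral_expChar (neg_ne_zero.2 hl), zero_mul]

/-- The symbol of a coefficient sequence. -/
def latSymbol (c : ℤℤ → ℂ) (η : 𝕏) : ℂ := ∑' k, c k * expChar (-η) (intVec k)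

lemma ft_latSum {c : ℤℤ → ℂ} (hc : ∑' k, ‖c k‖ₑ ≠ ⊤) {v : 𝕏 → ℂ} (hv : Integrable v) (η : 𝕏) :
    ft (latSum c v) η = latSymbol c η * ft v η := by
  rw [ft_eq_expChar]
  simp only [latSum, ← tsum_mul_left]
  rw [integral_tsum, latSymbol, ← tsum_mul_right]
  · refine tsum_congr fun k => ?_
    rw [ft_eq_expChar, mul_assoc, ← integral_const_mul, ← integral_const_mul,
      ← integral_sub_right_eq_self
        (fun x => c k * (expChar (-η) (intVec k) * (expChar (-η) x * v x))) (intVec k)]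
    refine integral_congr_ae (ae_of_all _ fun x => ?_)
    simp only []
    rw [← mul_assoc (expChar (-η) (intVec k)), ← expChar_add, add_sub_cancel]
    ring
  · exact fun k => (integrable_expChar_mul ((hv.comp_sub_right _).const_mul _) _).1
  · simp_rw [enorm_mul, enorm_expChar, one_mul]
    have := lintegral_tsum_mul (fun k => ‖c k‖ₑ) hv.1.enorm
    rw [lintegral_tsum fun k => (aemeasurable_comp_sub hv.1.enorm _).const_mul _] at this
    rw [this]
    exact ENNReal.mul_ne_top hc hv.2.ne

/-- Shannon sampling for the coefficient symbol. -/
theorem latSymbol_latCoef {φ : 𝕏 → ℂ} (hφ : Measurable φ) (hφi : Integrable φ) {M : ℝ≥0∞}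
    (hM : M ≠ ⊤) (h : LatBdd φ M) (hsupp : Function.support (ft φ) ⊆ centeredCube d)
    {F : 𝕏 → ℂ} (hF : Integrable F) {η : 𝕏} (hη : ft φ η ≠ 0) :
    latSymbol (latCoef φ F) η = (starRingEnd ℂ) (ft φ η) * ft F η := by
  set w : 𝕏 → ℂ := fun z => (starRingEnd ℂ) (φ z) * expChar η z with hw
  have hconj : Integrable fun z => (starRingEnd ℂ) (φ z) :=
    (Complex.conjLIE.toContinuousLinearEquiv.toContinuousLinearMap.restrictScalars ℝ).integrable_comp hφi
  have hwi : Integrable w := by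
    have := integrable_expChar_mul hconj η
    simpa only [hw, mul_comm] using this
  have hft : ∀ ξ, ft w ξ = (starRingEnd ℂ) (ft φ (η - ξ)) := by
    intro ξ
    rw [ft_eq_expChar, ft_eq_expChar, ← integral_conj]
    refine integral_congr_ae (ae_of_all _ fun x => ?_)
    simp only [hw, map_mul, conj_expChar]
    rw [neg_neg, sub_eq_add_neg, expChar_add_left]
    ring
  have hηc : η ∈ centeredCube d := hsupp hη
  have hz : ∀ l : ℤℤ, l ≠ 0 → ft w (intVec l) = 0 := by
    intro l hl
    rw [hft, map_eq_zero]
    by_contra hne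
    have h2 : η - intVec l ∈ centeredCube d := hsupp hne
    refine hl (funext fun i => ?_)
    have h3 := hηc i (Set.mem_univ i)
    have h4 := h2 i (Set.mem_univ i)
    simp only [Set.mem_Ioo, Pi.sub_apply, intVec] at h3 h4
    have h5 : (l i : ℝ) < 1 := by linarith [h3.2, h4.1]
    have h6 : (-1 : ℝ) < l i := by linarith [h3.1, h4.2]
    have h7 : l i < 1 := by exact_mod_cast h5
    have h8 : -1 < l i := by exact_mod_cast h6
    simp only [Pi.zero_apply]
    omega
  have hper := latPer_ae_eq hwi hz
  rw [hft, sub_zero] at hper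
  rw [latSymbol]
  have e1 : ∀ k : ℤℤ, latCoef φ F k * expChar (-η) (intVec k) =
      ∫ x, expChar (-η) x * F x * w (x - intVec k) := by
    intro k
    rw [latCoef, ← integral_mul_const]
    refine integral_congr_ae (ae_of_all _ fun x => ?_)
    simp only [hw]
    have : expChar (-η) (intVec k) = expChar (-η) x * expChar η (x - intVec k) := by
      rw [← neg_sub (intVec k) x, expChar_neg, ← expChar_add, add_sub_cancel]
    rw [this]
    ring
  simp_rw [e1]
  rw [← integral_tsum]
  · simp_rw [tsum_mul_left]
    rw [ft_eq_expChar F, ← integral_const_mul]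
    refine integral_congr_ae ?_
    filter_upwards [hper] with x hx
    rw [latPer] at hx
    rw [hx, mul_comm]
  · intro k
    exact (integrable_expChar_mul hF _).1.mul (hwi.comp_sub_right _).1
  · have hMw : LatBdd w M := fun x => by
      have := h x
      simpa only [hw, enorm_mul, enorm_expChar, mul_one, RCLike.enorm_conj] using this
    have hm : ∀ k : ℤℤ, AEMeasurable (fun x : 𝕏 => ‖F x‖ₑ * ‖w (x - intVec k)‖ₑ) := fun k =>
      hF.1.enorm.mul (aemeasurable_comp_sub hwi.1.enorm _)
    simp_rw [enorm_mul, enorm_expChar, one_mul]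
    rw [← lintegral_tsum hm]
    refine (lt_of_le_of_lt (b := ∫⁻ x, M * ‖F x‖ₑ) (lintegral_mono fun x => ?_) ?_).ne
    · simp only []
      rw [ENNReal.tsum_mul_left, mul_comm]
      gcongr
      exact hMw x
    · rw [lintegral_const_mul'' _ hF.1.enorm]
      exact ENNReal.mul_lt_top hM.lt_top hF.2

lemma conv_eq_convolution (f g : 𝕏 → ℂ) :
    conv f g = MeasureTheory.convolution f g (ContinuousLinearMap.mul ℂ ℂ) volume := rfl

lemma integrable_conv {f g : 𝕏 → ℂ} (hf : Integrable f) (hg : Integrable g) :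
    Integrable (conv f g) := by
  rw [conv_eq_convolution]
  exact hf.integrable_convolution _ hg

lemma ft_conv {f g : 𝕏 → ℂ} (hf : Integrable f) (hg : Integrable g) (ξ : 𝕏) :
    ft (conv f g) ξ = ft f ξ * ft g ξ := by
  have hI := hf.convolution_integrand (ContinuousLinearMap.mul ℂ ℂ) hg
  have hI2 : Integrable (fun p : 𝕏 × 𝕏 => expChar (-ξ) p.1 * (f p.2 * g (p.1 - p.2)))
      (volume.prod volume) :=
    hI.bdd_mul (c := 1) ((continuous_expChar _).comp continuous_fst).aestronglyMeasurable
      (ae_of_all _ fun x => (norm_expChar _ _).le)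
  rw [ft_eq_expChar, ft_eq_expChar, ft_eq_expChar, ← integral_mul_const]
  simp only [conv, ← integral_const_mul]
  rw [integral_integral_swap hI2]
  refine integral_congr_ae (ae_of_all _ fun y => ?_)
  simp only []
  rw [← integral_add_right_eq_self (fun x => expChar (-ξ) x * (f y * g (x - y))) y]
  refine integral_congr_ae (ae_of_all _ fun x => ?_)
  simp only [add_sub_cancel_right, expChar_add]
  ring

/-- Sampling followed by synthesis is a convolution, for band-limited synthesizers. -/
theorem latSum_latCoef_ae_eq {φ : 𝕏 → ℂ} (hφ : Measurable φ) (hφi : Integrable φ) {M : ℝ≥0∞}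
    (hM : M ≠ ⊤) (h : LatBdd φ M) (hsupp : Function.support (ft φ) ⊆ centeredCube d)
    {F v K : 𝕏 → ℂ} (hF : Integrable F) (hv : Integrable v) (hK : Integrable K)
    (hv0 : ∀ η, ft φ η = 0 → ft v η = 0)
    (hKv : ∀ η, ft K η = ft v η * (starRingEnd ℂ) (ft φ η)) :
    latSum (latCoef φ F) v =ᵐ[volume] conv F K := by
  have hc : ∑' k, ‖latCoef φ F k‖ₑ ≠ ⊤ :=
    ((tsum_enorm_latCoef_le hφ h hF).trans_lt (ENNReal.mul_lt_top hM.lt_top hF.2)).ne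
  refine ae_eq_of_ft_eq (integrable_latSum hc hv) (integrable_conv hF hK) (funext fun η => ?_)
  rw [ft_latSum hc hv, ft_conv hF hK, hKv]
  by_cases h0 : ft φ η = 0
  · simp [hv0 η h0]
  · rw [latSymbol_latCoef hφ hφi hM h hsupp hF h0]
    ring

end Shannon

section Modulus

variable {d : ℕ}

local notation "𝕏" => Fin d → ℝ
local notation "ℤℤ" => Fin d → ℤ

lemma om_le {f : 𝕏 → ℂ} (hf : Integrable f) (y : 𝕏) : om f y ≤ 2 * ∫⁻ x, ‖f x‖ₑ := by
  have h1 : om f y ≤ ∫⁻ x, (‖f x‖ₑ + ‖f (x - y)‖ₑ) :=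
    lintegral_mono fun x => enorm_sub_le
  rw [lintegral_add_left' hf.1.enorm, lintegral_sub_right_eq_self (fun x => ‖f x‖ₑ)] at h1
  rwa [two_mul]

lemma om_congr {f g : 𝕏 → ℂ} (h : f =ᵐ[volume] g) (y : 𝕏) : om f y = om g y := by
  refine lintegral_congr_ae ?_
  have h2 := (measurePreserving_sub_right (volume : Measure 𝕏) y).quasiMeasurePreserving.ae h
  filter_upwards [h, h2] with x h1 h2
  rw [h1, h2]

lemma measurable_om {f : 𝕏 → ℂ} (hf : Integrable f) : Measurable (om f) := by
  have : om f = om (hf.1.mk f) := funext fun y => om_congr hf.1.ae_eq_mk y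
  rw [this]
  have hm : Measurable (hf.1.mk f) := hf.1.stronglyMeasurable_mk.measurable
  unfold om
  exact Measurable.lintegral_prod_right'
    (f := fun p : 𝕏 × 𝕏 => ‖hf.1.mk f p.2 - hf.1.mk f (p.2 - p.1)‖ₑ)
    ((hm.comp measurable_snd).sub (hm.comp (measurable_snd.sub measurable_fst))).enorm

/-- Continuity of translation in `L¹`. -/
theorem tendsto_om {f : 𝕏 → ℂ} (hf : Integrable f) : Tendsto (om f) (𝓝 0) (𝓝 0) := by
  have hL : MemLp f 1 (volume : Measure 𝕏) := memLp_one_iff_integrable.2 hf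
  have hmp : ∀ y : 𝕏, MeasurePreserving (fun x : 𝕏 => x - y) volume volume := fun y =>
    measurePreserving_sub_right volume y
  have key : Tendsto (fun y : 𝕏 => Lp.compMeasurePreserving (fun x : 𝕏 => x - y) (hmp y) hL.toLp)
      (𝓝 0) (𝓝 (Lp.compMeasurePreserving (fun x : 𝕏 => x - 0) (hmp 0) hL.toLp)) := by
    refine Filter.Tendsto.compMeasurePreservingLp (X := 𝕏) (Y := 𝕏)
      (g := fun y => (⟨fun x : 𝕏 => x - y, by fun_prop⟩ : C(𝕏, 𝕏)))
      (g₀ := ⟨fun x : 𝕏 => x - 0, by fun_prop⟩) (l := 𝓝 0) (f := fun _ => hL.toLp)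
      (f₀ := hL.toLp) tendsto_const_nhds ?_ (fun y => hmp y) (hmp 0) (by simp)
    have hc : Continuous fun y : 𝕏 => (⟨fun x : 𝕏 => x - y, by fun_prop⟩ : C(𝕏, 𝕏)) :=
      ContinuousMap.continuous_of_continuous_uncurry _
        (show Continuous fun p : 𝕏 × 𝕏 => p.2 - p.1 by fun_prop)
    exact hc.tendsto 0
  simp_rw [Lp.toLp_compMeasurePreserving] at key
  rw [Lp.tendsto_Lp_iff_tendsto_eLpNorm''] at key
  refine key.congr fun y => ?_
  rw [eLpNorm_one_eq_lintegral_enorm]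
  refine lintegral_congr fun x => ?_
  simp [enorm_sub_rev]

end Modulus

section Dil

variable {d : ℕ}

local notation "𝕏" => Fin d → ℝ
local notation "ℤℤ" => Fin d → ℤ

/-- The `L¹`-normalized dilation. -/
def dil (a : ℝ) (f : 𝕏 → ℂ) (x : 𝕏) : ℂ := ((|a| ^ d : ℝ) : ℂ) * f (a • x)

lemma measurePreserving_smul_aux {a : ℝ} (ha : a ≠ 0) (F : 𝕏 → ℝ≥0∞) :
    ENNReal.ofReal (|a| ^ d) * ∫⁻ x : 𝕏, F (a • x) = ∫⁻ x, F x := by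
  have h1 := lintegral_map_equiv F (Homeomorph.smulOfNeZero (α := 𝕏) a ha).toMeasurableEquiv
    (μ := volume)
  have h2 := Measure.map_addHaar_smul (volume : Measure 𝕏) ha
  have h3 : (Homeomorph.smulOfNeZero (α := 𝕏) a ha).toMeasurableEquiv = ((a • ·) : 𝕏 → 𝕏) := rfl
  rw [h3, h2] at h1
  simp only [lintegral_smul_measure, Module.finrank_fin_fun, smul_eq_mul] at h1
  rw [← h1, ← mul_assoc, ← ENNReal.ofReal_mul (by positivity), abs_inv, abs_pow,
    mul_inv_cancel₀ (pow_ne_zero _ (abs_ne_zero.2 ha)), ENNReal.ofReal_one, one_mul]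

lemma quasiMeasurePreserving_smul {a : ℝ} (ha : a ≠ 0) :
    Measure.QuasiMeasurePreserving (fun x : 𝕏 => a • x) volume volume := by
  refine ⟨measurable_const_smul a, ?_⟩
  rw [Measure.map_addHaar_smul (volume : Measure 𝕏) ha]
  exact Measure.smul_absolutelyContinuous

lemma lintegral_dil {a : ℝ} (ha : a ≠ 0) (f : 𝕏 → ℂ) :
    ∫⁻ x, ‖dil a f x‖ₑ = ∫⁻ x, ‖f x‖ₑ := by
  rw [← measurePreserving_smul_aux ha (fun x => ‖f x‖ₑ)]
  simp only [dil, enorm_mul]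
  rw [lintegral_const_mul' _ _ enorm_ne_top]
  congr 1
  rw [← ofReal_norm, Complex.norm_real, Real.norm_of_nonneg (by positivity)]

lemma integrable_dil {a : ℝ} (ha : a ≠ 0) {f : 𝕏 → ℂ} (hf : Integrable f) :
    Integrable (dil a f) :=
  (hf.comp_smul ha).const_mul _

lemma dil_dil_inv {a : ℝ} (ha : a ≠ 0) (f : 𝕏 → ℂ) : dil a (dil a⁻¹ f) = f := by
  ext x
  simp only [dil]
  rw [smul_smul, inv_mul_cancel₀ ha, one_smul, ← mul_assoc, ← Complex.ofReal_mul, ← mul_pow,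
    ← abs_mul, mul_inv_cancel₀ ha]
  simp

lemma dil_congr_ae {a : ℝ} (ha : a ≠ 0) {f g : 𝕏 → ℂ} (h : f =ᵐ[volume] g) :
    dil a f =ᵐ[volume] dil a g := by
  filter_upwards [(quasiMeasurePreserving_smul ha).ae h] with x hx
  rw [dil, dil, hx]

lemma om_dil {a : ℝ} (ha : a ≠ 0) (f : 𝕏 → ℂ) (y : 𝕏) : om (dil a f) y = om f (a • y) := by
  rw [om, om, ← lintegral_dil ha (fun x => f x - f (x - a • y))]
  refine lintegral_congr fun x => ?_
  simp only [dil, smul_sub, mul_sub]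

lemma integral_dil {a : ℝ} (ha : a ≠ 0) (f : 𝕏 → ℂ) : ∫ x, dil a f x = ∫ x, f x := by
  simp only [dil]
  rw [integral_const_mul, Measure.integral_comp_smul, Module.finrank_fin_fun, Complex.real_smul,
    ← mul_assoc, ← Complex.ofReal_mul, abs_inv, abs_pow,
    mul_inv_cancel₀ (pow_ne_zero _ (abs_ne_zero.2 ha))]
  simp

lemma ft_dil {a : ℝ} (ha : a ≠ 0) (f : 𝕏 → ℂ) (ξ : 𝕏) : ft (dil a f) ξ = ft f (a⁻¹ • ξ) := by
  rw [ft_eq_expChar, ft_eq_expChar,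
    ← integral_dil ha (fun x => expChar (-(a⁻¹ • ξ)) x * f x)]
  refine integral_congr_ae (ae_of_all _ fun x => ?_)
  simp only [dil]
  rw [expChar_smul, smul_neg, smul_smul, mul_inv_cancel₀ ha, one_smul]
  ring

lemma RieszPair.dil {i : Fin d} {f g : 𝕏 → ℂ} (h : RieszPair i f g) {a : ℝ} (ha : a ≠ 0) :
    RieszPair i (dil a f) (fun x => ((SignType.sign a : ℝ) : ℂ) * AffinePaper.dil a g x) := by
  intro ξ
  rw [ft_const_mul, ft_dil ha, ft_dil ha]
  have h1 := h (a⁻¹ • ξ)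
  rw [eucNorm_smul, Pi.smul_apply, smul_eq_mul] at h1
  have h2 : ((|a⁻¹| : ℝ) : ℂ) = ((SignType.sign a : ℝ) : ℂ) * ((a⁻¹ : ℝ) : ℂ) := by
    rw [← Complex.ofReal_mul]
    congr 1
    rcases lt_or_gt_of_ne ha with h | h
    · rw [sign_neg h, abs_of_neg (inv_lt_zero.2 h)]; simp
    · rw [sign_pos h, abs_of_pos (inv_pos.2 h)]; simp
  have h4 : ((SignType.sign a : ℝ) : ℂ) * ((SignType.sign a : ℝ) : ℂ) = 1 := by
    rcases lt_or_gt_of_ne ha with h | h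
    · rw [sign_neg h]; simp
    · rw [sign_pos h]; simp
  have h3 : ((a⁻¹ : ℝ) : ℂ) ≠ 0 := Complex.ofReal_ne_zero.2 (inv_ne_zero ha)
  push_cast at h1 h2 h3
  rw [h2] at h1
  refine mul_left_cancel₀ h3 ?_
  linear_combination h1

lemma conv_dil {a : ℝ} (ha : a ≠ 0) (f g : 𝕏 → ℂ) :
    conv (dil a f) (dil a g) = dil a (conv f g) := by
  ext x
  rw [dil, conv, conv, ← integral_dil ha (fun y => f y * g (a • x - y)), ← integral_const_mul]
  refine integral_congr_ae (ae_of_all _ fun y => ?_)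
  simp only [dil, smul_sub]
  ring

lemma conv_apply (f K : 𝕏 → ℂ) (x : 𝕏) : conv f K x = ∫ y, f (x - y) * K y := by
  rw [conv, ← integral_sub_left_eq_self _ volume x]
  simp

lemma lintegral_conv_sub_le {f K : 𝕏 → ℂ} (hf : Integrable f) (hK : Integrable K) :
    ∫⁻ x, ‖conv f K x - (∫ y, K y) * f x‖ₑ ≤ ∫⁻ y, ‖K y‖ₑ * om f y := by
  have hI := hK.convolution_integrand (ContinuousLinearMap.mul ℂ ℂ) hf
  have h1 := hI.prod_right_ae
  have hm : AEMeasurable (fun p : 𝕏 × 𝕏 => ‖K p.2‖ₑ * ‖f p.1 - f (p.1 - p.2)‖ₑ)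
      (volume.prod volume) := by
    have a1 : AEStronglyMeasurable (fun p : 𝕏 × 𝕏 => f (p.1 - p.2)) (volume.prod volume) :=
      hf.1.comp_quasiMeasurePreserving (quasiMeasurePreserving_sub_of_right_invariant volume volume)
    exact hK.1.comp_snd.enorm.mul (hf.1.comp_fst.sub a1).enorm
  calc _ ≤ ∫⁻ x, ∫⁻ y, ‖K y‖ₑ * ‖f x - f (x - y)‖ₑ := by
        refine lintegral_mono_ae ?_
        filter_upwards [h1] with x hx
        simp only [ContinuousLinearMap.mul_apply'] at hx
        rw [conv_apply, ← integral_mul_const, ← integral_sub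
          (by simpa only [mul_comm] using hx) (hK.mul_const _)]
        refine (enorm_integral_le_lintegral_enorm _).trans_eq (lintegral_congr fun y => ?_)
        rw [← enorm_mul, ← enorm_neg]
        congr 1
        ring
    _ = ∫⁻ y, ∫⁻ x, ‖K y‖ₑ * ‖f x - f (x - y)‖ₑ := lintegral_lintegral_swap hm
    _ = _ := by
        refine lintegral_congr fun y => ?_
        rw [lintegral_const_mul' _ _ enorm_ne_top, om]

lemma tendsto_om_smul {f : 𝕏 → ℂ} (hf : Integrable f) {α : ℕ → ℝ}
    (hα : Tendsto (fun j => (α j)⁻¹) atTop (𝓝 0)) (y : 𝕏) :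
    Tendsto (fun j => om f ((α j)⁻¹ • y)) atTop (𝓝 0) := by
  refine (tendsto_om hf).comp ?_
  simpa using hα.smul_const y

/-- Approximate identities converge in `L¹`. -/
theorem tendsto_conv_dil {f K : 𝕏 → ℂ} (hf : Integrable f) (hK : Integrable K) {α : ℕ → ℝ}
    (hα0 : ∀ j, α j ≠ 0) (hα : Tendsto (fun j => (α j)⁻¹) atTop (𝓝 0)) :
    Tendsto (fun j => ∫⁻ x, ‖conv f (dil (α j) K) x - (∫ y, K y) * f x‖ₑ) atTop (𝓝 0) := by
  have h1 : Tendsto (fun j => ∫⁻ y, ‖K y‖ₑ * om f ((α j)⁻¹ • y)) atTop (𝓝 0) := by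
    have := tendsto_lintegral_filter_of_dominated_convergence' (l := atTop)
      (F := fun j y => ‖K y‖ₑ * om f ((α j)⁻¹ • y)) (f := fun _ => 0) (μ := volume)
      (fun y => ‖K y‖ₑ * (2 * ∫⁻ x, ‖f x‖ₑ))
      (Eventually.of_forall fun j => hK.1.enorm.mul
        ((measurable_om hf).comp (measurable_const_smul _)).aemeasurable)
      (Eventually.of_forall fun j => ae_of_all _ fun y => by gcongr; exact om_le hf _) ?_
      (ae_of_all _ fun y => ?_)
    · simpa using this
    · rw [lintegral_mul_const'' _ hK.1.enorm]
      exact ENNReal.mul_ne_top hK.2.ne (ENNReal.mul_ne_top (by simp) hf.2.ne)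
    · have := ENNReal.Tendsto.const_mul (tendsto_om_smul hf hα y) (a := ‖K y‖ₑ) (Or.inr enorm_ne_top)
      simpa using this
  refine tendsto_of_tendsto_of_tendsto_of_le_of_le tendsto_const_nhds h1 (fun _ => zero_le)
    fun j => ?_
  have h2 := lintegral_conv_sub_le hf (integrable_dil (hα0 j) hK)
  rw [integral_dil (hα0 j)] at h2
  refine h2.trans_eq ?_
  rw [← measurePreserving_smul_aux (hα0 j) (fun y => ‖K y‖ₑ * om f ((α j)⁻¹ • y)),
    ← lintegral_const_mul' _ _ ENNReal.ofReal_ne_top]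
  refine lintegral_congr fun y => ?_
  rw [smul_smul, inv_mul_cancel₀ (hα0 j), one_smul, dil, enorm_mul, ← mul_assoc]
  congr 2
  rw [← ofReal_norm, Complex.norm_real, Real.norm_of_nonneg (by positivity)]

lemma tendsto_tsum_om {f v : 𝕏 → ℂ} (hf : Integrable f) (hv : Integrable v) {α : ℕ → ℝ}
    (hα : Tendsto (fun j => (α j)⁻¹) atTop (𝓝 0)) {M : ℝ≥0∞} (hM : M ≠ ⊤) :
    Tendsto (fun j => ∑' n : ℤℤ, M * om f ((α j)⁻¹ • intVec n) * cellMass v n) atTop (𝓝 0) := by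
  have hcm : ∑' n, cellMass v n ≠ ⊤ := by rw [tsum_cellMass hv]; exact hv.2.ne
  simp_rw [← lintegral_count]
  have := tendsto_lintegral_filter_of_dominated_convergence (l := atTop)
      (F := fun j (n : ℤℤ) => M * om f ((α j)⁻¹ • intVec n) * cellMass v n) (f := fun _ => 0)
      (μ := Measure.count)
      (fun n => M * (2 * ∫⁻ x, ‖f x‖ₑ) * cellMass v n)
      (Eventually.of_forall fun j => Measurable.of_discrete)
      (Eventually.of_forall fun j => ae_of_all _ fun y => by gcongr; exact om_le hf _) ?_
      (ae_of_all _ fun y => ?_)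
  · simpa using this
  · rw [lintegral_count, ENNReal.tsum_mul_left]
    exact ENNReal.mul_ne_top (ENNReal.mul_ne_top hM (ENNReal.mul_ne_top (by simp) hf.2.ne)) hcm
  · have := ENNReal.Tendsto.mul_const (ENNReal.Tendsto.const_mul
      (tendsto_om_smul hf hα (intVec y)) (a := M) (Or.inr hM)) (b := cellMass v y)
      (Or.inr (ENNReal.ne_top_of_tsum_ne_top hcm y))
    simpa using this

end Dil

section Samp

variable {d : ℕ}

local notation "𝕏" => Fin d → ℝ
local notation "ℤℤ" => Fin d → ℤ

/-- A band-limited analyzer with unit mean and bounded absolute periodization. -/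
structure IsWindow (φ : (Fin d → ℝ) → ℂ) : Prop where
  meas : Measurable φ
  int : Integrable φ volume
  bdd : ∃ M : ℝ≥0∞, M ≠ ⊤ ∧ LatBdd φ M
  supp : Function.support (ft φ) ⊆ centeredCube d
  one : ft φ 0 = 1

/-- Analysis with `φ` followed by synthesis with `v`, at dilation `a`. -/
def samp (a : ℝ) (φ f v : 𝕏 → ℂ) : 𝕏 → ℂ := dil a (latSum (latCoef φ (dil a⁻¹ f)) v)

/-- The step function carrying the sampled values of `f` at dilation `a`. -/
def stepFn (a : ℝ) (φ f : 𝕏 → ℂ) : 𝕏 → ℂ := dil a fun u => latCoef φ (dil a⁻¹ f) (cellIndex u)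

lemma IsWindow.summable {φ : 𝕏 → ℂ} (hφ : IsWindow φ) {f : 𝕏 → ℂ} (hf : Integrable f) :
    ∑' k, ‖latCoef φ f k‖ₑ ≠ ⊤ := by
  obtain ⟨M, hM, h⟩ := hφ.bdd
  exact ((tsum_enorm_latCoef_le hφ.meas h hf).trans_lt (ENNReal.mul_lt_top hM.lt_top hf.2)).ne

lemma integrable_samp {φ : 𝕏 → ℂ} (hφ : IsWindow φ) {a : ℝ} (ha : a ≠ 0) {f v : 𝕏 → ℂ}
    (hf : Integrable f) (hv : Integrable v) : Integrable (samp a φ f v) :=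
  integrable_dil ha (integrable_latSum (hφ.summable (integrable_dil (inv_ne_zero ha) hf)) hv)

lemma lintegral_samp_sub_le {φ : 𝕏 → ℂ} (hφ : IsWindow φ) {M : ℝ≥0∞} (hM : M ≠ ⊤)
    (h : LatBdd φ M) {a : ℝ} (ha : a ≠ 0) {f v : 𝕏 → ℂ} (hf : Integrable f) (hv : Integrable v) :
    ∫⁻ x, ‖samp a φ f v x - stepFn a φ f x * latPer v (a • x)‖ₑ ≤
      ∑' n : ℤℤ, M * om f (a⁻¹ • intVec n) * cellMass v n := by
  have := lintegral_latSum_latCoef_sub_le hφ.meas hM h (integrable_dil (inv_ne_zero ha) hf) hv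
  simp_rw [om_dil (inv_ne_zero ha)] at this
  rw [← lintegral_dil ha] at this
  refine le_trans (lintegral_mono fun x => ?_) this
  simp only [samp, stepFn, dil]
  rw [mul_sub, mul_assoc]

lemma tendsto_samp_sub {φ : 𝕏 → ℂ} (hφ : IsWindow φ) {f v : 𝕏 → ℂ} (hf : Integrable f)
    (hv : Integrable v) {α : ℕ → ℝ} (hα0 : ∀ j, α j ≠ 0)
    (hα : Tendsto (fun j => (α j)⁻¹) atTop (𝓝 0)) :
    Tendsto (fun j => ∫⁻ x, ‖samp (α j) φ f v x - stepFn (α j) φ f x * latPer v (α j • x)‖ₑ)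
      atTop (𝓝 0) := by
  obtain ⟨M, hM, h⟩ := hφ.bdd
  exact tendsto_of_tendsto_of_tendsto_of_le_of_le tendsto_const_nhds
    (tendsto_tsum_om hf hv hα hM) (fun _ => zero_le)
    fun j => lintegral_samp_sub_le hφ hM h (hα0 j) hf hv

/-- Synthesizers with vanishing periodization have asymptotically trivial sampling operators. -/
theorem tendsto_samp_zero {φ : 𝕏 → ℂ} (hφ : IsWindow φ) {f v : 𝕏 → ℂ} (hf : Integrable f)
    (hv : Integrable v) (hv0 : ∀ᵐ x, latPer v x = 0) {α : ℕ → ℝ} (hα0 : ∀ j, α j ≠ 0)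
    (hα : Tendsto (fun j => (α j)⁻¹) atTop (𝓝 0)) :
    Tendsto (fun j => ∫⁻ x, ‖samp (α j) φ f v x‖ₑ) atTop (𝓝 0) := by
  refine (tendsto_samp_sub hφ hf hv hα0 hα).congr fun j => lintegral_congr_ae ?_
  filter_upwards [(quasiMeasurePreserving_smul (hα0 j)).ae hv0] with x hx
  rw [hx, mul_zero, sub_zero]

/-- The reflected conjugate of `φ`. -/
def adj (φ : 𝕏 → ℂ) (x : 𝕏) : ℂ := (starRingEnd ℂ) (φ (-x))

lemma integrable_conj {φ : 𝕏 → ℂ} (h : Integrable φ) :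
    Integrable fun z => (starRingEnd ℂ) (φ z) :=
  (Complex.conjLIE.toContinuousLinearEquiv.toContinuousLinearMap.restrictScalars ℝ).integrable_comp h

lemma integrable_adj {φ : 𝕏 → ℂ} (h : Integrable φ) : Integrable (adj φ) :=
  (integrable_conj h).comp_neg

lemma ft_adj (φ : 𝕏 → ℂ) (ξ : 𝕏) : ft (adj φ) ξ = (starRingEnd ℂ) (ft φ ξ) := by
  rw [ft_eq_expChar, ft_eq_expChar, ← integral_conj, ← integral_neg_eq_self]
  refine integral_congr_ae (ae_of_all _ fun x => ?_)
  simp [adj, conj_expChar, expChar_neg]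

/-- Sampling is a convolution for band-limited synthesizers. -/
lemma samp_conv_ae_eq {φ : 𝕏 → ℂ} (hφ : IsWindow φ) {a : ℝ} (ha : a ≠ 0) {f v : 𝕏 → ℂ}
    (hf : Integrable f) (hv : Integrable v) (hv0 : ∀ η, ft φ η = 0 → ft v η = 0) :
    samp a φ f v =ᵐ[volume] conv f (dil a (conv v (adj φ))) := by
  obtain ⟨M, hM, h⟩ := hφ.bdd
  have := latSum_latCoef_ae_eq hφ.meas hφ.int hM h hφ.supp (integrable_dil (inv_ne_zero ha) hf) hv
    (integrable_conv hv (integrable_adj hφ.int)) hv0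
    (fun η => by rw [ft_conv hv (integrable_adj hφ.int), ft_adj])
  refine (dil_congr_ae ha this).trans ?_
  rw [← conv_dil ha, dil_dil_inv ha]

lemma IsWindow.latPer_eq {φ : 𝕏 → ℂ} (hφ : IsWindow φ) : ∀ᵐ x, latPer φ x = 1 := by
  rw [← hφ.one]
  refine latPer_ae_eq hφ.int fun l hl => ?_
  by_contra hne
  have h1 := hφ.supp hne
  refine hl (funext fun i => ?_)
  have h3 := h1 i (Set.mem_univ i)
  simp only [Set.mem_Ioo, intVec] at h3
  have h5 : (l i : ℝ) < 1 := by linarith [h3.2]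
  have h6 : (-1 : ℝ) < l i := by linarith [h3.1]
  have h7 : l i < 1 := by exact_mod_cast h5
  have h8 : -1 < l i := by exact_mod_cast h6
  simp only [Pi.zero_apply]
  omega

lemma aestronglyMeasurable_stepFn (a : ℝ) (φ f : 𝕏 → ℂ) :
    AEStronglyMeasurable (stepFn a φ f) volume := by
  have : Measurable fun u : 𝕏 => latCoef φ (dil a⁻¹ f) (cellIndex u) :=
    (Measurable.of_discrete (f := latCoef φ (dil a⁻¹ f))).comp measurable_cellIndex
  exact ((this.comp (measurable_const_smul a)).const_mul _).aestronglyMeasurable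

/-- The step functions approximate `f` in `L¹`. -/
theorem tendsto_stepFn {φ : 𝕏 → ℂ} (hφ : IsWindow φ) {f : 𝕏 → ℂ} (hf : Integrable f)
    {α : ℕ → ℝ} (hα0 : ∀ j, α j ≠ 0) (hα : Tendsto (fun j => (α j)⁻¹) atTop (𝓝 0)) :
    Tendsto (fun j => ∫⁻ x, ‖stepFn (α j) φ f x - f x‖ₑ) atTop (𝓝 0) := by
  have h1 := tendsto_samp_sub hφ hf hφ.int hα0 hα
  have hK := integrable_conv hφ.int (integrable_adj hφ.int)
  have h2 := tendsto_conv_dil hf hK hα0 hα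
  have hone : ∫ y, conv φ (adj φ) y = 1 := by
    rw [← ft_zero_eq, ft_conv hφ.int (integrable_adj hφ.int), ft_adj, hφ.one]; simp
  rw [hone] at h2
  have h3 := h1.add h2
  rw [add_zero] at h3
  refine tendsto_of_tendsto_of_tendsto_of_le_of_le tendsto_const_nhds h3 (fun _ => zero_le)
    fun j => ?_
  have hper := (quasiMeasurePreserving_smul (hα0 j)).ae hφ.latPer_eq
  have heq := samp_conv_ae_eq hφ (hα0 j) hf hφ.int fun _ h => h
  have hm := (integrable_samp hφ (hα0 j) hf hφ.int).1.sub
    ((aestronglyMeasurable_stepFn (α j) φ f).mul ((aestronglyMeasurable_latPer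
      hφ.int).comp_quasiMeasurePreserving (quasiMeasurePreserving_smul (hα0 j))))
  refine (lintegral_mono_ae ?_).trans_eq (lintegral_add_left' hm.enorm _)
  filter_upwards [hper, heq] with x h4 h5
  simp only [Pi.sub_apply, Pi.mul_apply, Function.comp_apply]
  rw [h4, ← h5, enorm_sub_rev (samp (α j) φ f φ x)]
  refine le_trans (le_of_eq ?_) (enorm_add_le _ _)
  congr 1
  ring

lemma lintegral_stepFn_mul_le {φ : 𝕏 → ℂ} (hφ : IsWindow φ) {M : ℝ≥0∞}
    (h : LatBdd φ M) {a : ℝ} (ha : a ≠ 0) {f : 𝕏 → ℂ} (hf : Integrable f)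
    {q : 𝕏 → ℂ} (hq : AEStronglyMeasurable q volume) (hper : ∀ (k : ℤℤ) x, q (x + intVec k) = q x) :
    ∫⁻ x, ‖stepFn a φ f x * q (a • x)‖ₑ ≤ (M * ∫⁻ x, ‖f x‖ₑ) * ∫⁻ x in unitCell d, ‖q x‖ₑ := by
  set c := latCoef φ (dil a⁻¹ f) with hc
  have hcm : Measurable fun u : 𝕏 => c (cellIndex u) :=
    (Measurable.of_discrete (f := c)).comp measurable_cellIndex
  have e1 : ∫⁻ x, ‖stepFn a φ f x * q (a • x)‖ₑ = ∫⁻ u, ‖c (cellIndex u) * q u‖ₑ := by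
    rw [← lintegral_dil ha (fun u => c (cellIndex u) * q u)]
    refine lintegral_congr fun x => ?_
    simp only [stepFn, dil, hc, mul_assoc]
  have e2 : ∫⁻ u, ‖c (cellIndex u) * q u‖ₑ = ∑' k, ‖c k‖ₑ * ∫⁻ x in unitCell d, ‖q x‖ₑ := by
    rw [lintegral_eq_tsum_unitCell (F := fun u => ‖c (cellIndex u) * q u‖ₑ)
      (hcm.aestronglyMeasurable.mul hq).enorm]
    refine tsum_congr fun k => ?_
    rw [← lintegral_const_mul' _ _ enorm_ne_top]
    refine setLIntegral_congr_fun measurableSet_unitCell fun x hx => ?_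
    rw [cellIndex_add hx, hper, enorm_mul]
  rw [e1, e2, ENNReal.tsum_mul_right]
  gcongr
  have := tsum_enorm_latCoef_le hφ.meas h (integrable_dil (inv_ne_zero ha) hf)
  rwa [lintegral_dil (inv_ne_zero ha)] at this

end Samp

section Lacunary

lemma tendsto_cesaro_enn {u : ℕ → ℝ≥0∞} (hu : ∀ j, u j ≠ ⊤) (h : Tendsto u atTop (𝓝 0)) :
    Tendsto (fun J : ℕ => (J : ℝ≥0∞)⁻¹ * ∑ j ∈ Finset.range J, u j) atTop (𝓝 0) := by
  have h1 : Tendsto (fun j => (u j).toReal) atTop (𝓝 0) := by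
    rw [← ENNReal.toReal_zero]
    exact (ENNReal.tendsto_toReal ENNReal.zero_ne_top).comp h
  have h2 := ENNReal.tendsto_ofReal h1.cesaro
  rw [ENNReal.ofReal_zero] at h2
  refine h2.congr' ?_
  filter_upwards [eventually_gt_atTop 0] with J hJ
  rw [ENNReal.ofReal_mul (by positivity), ENNReal.ofReal_inv_of_pos (by exact_mod_cast hJ),
    ENNReal.ofReal_natCast, ENNReal.ofReal_sum_of_nonneg fun _ _ => ENNReal.toReal_nonneg]
  congr 1
  exact Finset.sum_congr rfl fun j _ => ENNReal.ofReal_toReal (hu j)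

/-- Mean ergodic estimate for asymptotically orthogonal unimodular sequences. -/
theorem tendsto_mean_of_asymp_orthogonal {X : Type*} [MeasurableSpace X] (μ : Measure X)
    [IsFiniteMeasure μ] {e : ℕ → X → ℂ} (he : ∀ j, AEStronglyMeasurable (e j) μ)
    (he1 : ∀ j x, ‖e j x‖ ≤ 1)
    (hG : ∀ ε : ℝ, 0 < ε → ∃ N, ∀ n, N ≤ n → ∀ j, j < n →
      ‖∫ x, e n x * (starRingEnd ℂ) (e j x) ∂μ‖ ≤ ε) :
    Tendsto (fun J : ℕ => (J : ℝ)⁻¹ * ∫ x, ‖∑ j ∈ Finset.range J, e j x‖ ∂μ) atTop (𝓝 0) := by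
  set B := μ.real univ with hB
  have hB0 : 0 ≤ B := measureReal_nonneg
  set S : ℕ → X → ℂ := fun J x => ∑ j ∈ Finset.range J, e j x with hS
  have hSm : ∀ J, AEStronglyMeasurable (S J) μ := fun J =>
    Finset.aestronglyMeasurable_fun_sum _ fun j _ => he j
  have hSb : ∀ J x, ‖S J x‖ ≤ J := fun J x => by
    refine (norm_sum_le _ _).trans ((Finset.sum_le_sum fun j _ => he1 j x).trans ?_)
    simp
  have hSi : ∀ J, Integrable (S J) μ := fun J =>
    (integrable_const (J : ℝ)).mono' (hSm J) (ae_of_all _ (hSb J))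
  have hSi2 : ∀ J, Integrable (fun x => ‖S J x‖ ^ 2) μ := fun J =>
    (integrable_const ((J : ℝ) ^ 2)).mono' ((hSm J).norm.pow 2) (ae_of_all _ fun x => by
      rw [Real.norm_of_nonneg (by positivity)]
      exact pow_le_pow_left₀ (norm_nonneg _) (hSb J x) 2)
  have hei : ∀ n j, Integrable (fun x => e n x * (starRingEnd ℂ) (e j x)) μ := fun n j =>
    (integrable_const (1 : ℝ)).mono' ((he n).mul (Complex.continuous_conj.comp_aestronglyMeasurable (he j)))
      (ae_of_all _ fun x => by
        rw [norm_mul, RCLike.norm_conj]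
        exact mul_le_one₀ (he1 n x) (norm_nonneg _) (he1 j x))
  set G : ℕ → ℕ → ℝ := fun n j => ‖∫ x, e n x * (starRingEnd ℂ) (e j x) ∂μ‖ with hGdef
  set r : ℕ → ℝ := fun n => (n : ℝ)⁻¹ * ∑ j ∈ Finset.range n, G n j with hr
  have hr0 : ∀ n, 0 ≤ r n := fun n => by positivity
  have hrn : ∀ n, ∑ j ∈ Finset.range n, G n j = n * r n := by
    intro n
    rcases Nat.eq_zero_or_pos n with h | h
    · simp [h]
    · rw [hr]; field_simp
  have hrlim : Tendsto r atTop (𝓝 0) := by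
    refine Metric.tendsto_atTop.2 fun ε hε => ?_
    obtain ⟨N, hN⟩ := hG (ε / 2) (by positivity)
    refine ⟨N, fun n hn => ?_⟩
    rw [Real.dist_eq, sub_zero, abs_of_nonneg (hr0 n)]
    have : ∑ j ∈ Finset.range n, G n j ≤ n * (ε / 2) := by
      refine (Finset.sum_le_sum fun j hj => hN n hn j (Finset.mem_range.1 hj)).trans ?_
      simp
    rcases Nat.eq_zero_or_pos n with h | h
    · simp [hr, h, hε]
    · have hn' : (0 : ℝ) < n := by exact_mod_cast h
      rw [hrn] at this
      have := le_of_mul_le_mul_left this hn'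
      linarith
  have step : ∀ J, ∫ x, ‖S (J + 1) x‖ ^ 2 ∂μ ≤ ∫ x, ‖S J x‖ ^ 2 ∂μ + B + 2 * (J * r J) := by
    intro J
    have hci : Integrable (fun x => (e J x * (starRingEnd ℂ) (S J x)).re) μ := by
      have : (fun x => e J x * (starRingEnd ℂ) (S J x)) =
          fun x => ∑ j ∈ Finset.range J, e J x * (starRingEnd ℂ) (e j x) := by
        ext x; simp only [hS, map_sum, Finset.mul_sum]
      have h2 : Integrable (fun x => e J x * (starRingEnd ℂ) (S J x)) μ := by
        rw [this]; exact integrable_finsetSum _ fun j _ => hei J j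
      exact h2.re
    have hcross : ∫ x, (e J x * (starRingEnd ℂ) (S J x)).re ∂μ ≤ J * r J := by
      rw [← hrn]
      have : ∀ x, (e J x * (starRingEnd ℂ) (S J x)).re =
          ∑ j ∈ Finset.range J, (e J x * (starRingEnd ℂ) (e j x)).re := by
        intro x; simp only [hS, map_sum, Finset.mul_sum, Complex.re_sum]
      simp_rw [this]
      have hre : ∀ j ∈ Finset.range J,
          Integrable (fun x => (e J x * (starRingEnd ℂ) (e j x)).re) μ := fun j _ => (hei J j).re
      rw [integral_finsetSum _ hre]
      refine Finset.sum_le_sum fun j _ => ?_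
      have h3 : ∫ x, (e J x * (starRingEnd ℂ) (e j x)).re ∂μ =
        (∫ x, e J x * (starRingEnd ℂ) (e j x) ∂μ).re := integral_re (hei J j)
      rw [h3]
      exact Complex.re_le_norm _
    have hpt : ∀ x, ‖S (J + 1) x‖ ^ 2 ≤
        ‖S J x‖ ^ 2 + 1 + 2 * (e J x * (starRingEnd ℂ) (S J x)).re := by
      intro x
      have h1 : S (J + 1) x = S J x + e J x := Finset.sum_range_succ _ _
      have h2 : ‖e J x‖ ^ 2 ≤ 1 := pow_le_one₀ (norm_nonneg _) (he1 J x)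
      rw [h1, ← Complex.normSq_eq_norm_sq, Complex.normSq_add, Complex.normSq_eq_norm_sq,
        Complex.normSq_eq_norm_sq, mul_comm (e J x)]
      have h3 : (S J x * (starRingEnd ℂ) (e J x)).re = ((starRingEnd ℂ) (S J x) * e J x).re := by
        simp
      rw [h3]
      linarith
    calc _ ≤ ∫ x, (‖S J x‖ ^ 2 + 1 + 2 * (e J x * (starRingEnd ℂ) (S J x)).re) ∂μ :=
          integral_mono (hSi2 _) (((hSi2 J).add (integrable_const 1)).add (hci.const_mul 2)) hpt
      _ = ∫ x, ‖S J x‖ ^ 2 ∂μ + B + 2 * ∫ x, (e J x * (starRingEnd ℂ) (S J x)).re ∂μ := by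
          have hi1 : Integrable (fun x => ‖S J x‖ ^ 2 + 1) μ := (hSi2 J).add (integrable_const 1)
          rw [integral_add hi1 (hci.const_mul 2),
            integral_add (hSi2 J) (integrable_const 1), integral_const_mul, integral_const]
          simp [hB]
      _ ≤ _ := by linarith
  have hA : ∀ J : ℕ, ∫ x, ‖S J x‖ ^ 2 ∂μ ≤ J * B + 2 * (J * ∑ n ∈ Finset.range J, r n) := by
    intro J
    induction J with
    | zero => simp [hS]
    | succ J ih =>
      refine (step J).trans ?_
      rw [Finset.sum_range_succ]
      push_cast
      have : 0 ≤ ∑ n ∈ Finset.range J, r n := Finset.sum_nonneg fun n _ => hr0 n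
      nlinarith [hr0 J]
  have hlim : Tendsto (fun J : ℕ => B * (J : ℝ)⁻¹ + 2 * ((J : ℝ)⁻¹ * ∑ n ∈ Finset.range J, r n))
      atTop (𝓝 0) := by
    have h1 := (tendsto_inv_atTop_nhds_zero_nat (𝕜 := ℝ)).const_mul B
    have h2 := (hrlim.cesaro).const_mul 2
    simpa using h1.add h2
  refine Metric.tendsto_atTop.2 fun ε hε => ?_
  set η := ε / (B + 1) with hη
  have hη0 : 0 < η := by positivity
  obtain ⟨N, hN⟩ := Metric.tendsto_atTop.1 hlim (ε * η / 2) (by positivity)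
  refine ⟨N + 1, fun J hJ => ?_⟩
  have hJ0 : (0 : ℝ) < J := by exact_mod_cast (by omega : 0 < J)
  have h1 := (le_abs_self _).trans_lt (by simpa [Real.dist_eq] using hN J (by omega))
  rw [Real.dist_eq, sub_zero, abs_of_nonneg (by positivity)]
  have h2 : ∫ x, ‖S J x‖ ∂μ ≤ ∫ x, (η * J / 2 + (2 * η * J)⁻¹ * ‖S J x‖ ^ 2) ∂μ := by
    refine integral_mono (hSi J).norm ((integrable_const _).add ((hSi2 J).const_mul _)) fun x => ?_
    have : 0 ≤ (2 * η * J)⁻¹ * (‖S J x‖ - η * J) ^ 2 := by positivity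
    have e : (2 * η * J)⁻¹ * (‖S J x‖ - η * J) ^ 2 =
        η * J / 2 + (2 * η * J)⁻¹ * ‖S J x‖ ^ 2 - ‖S J x‖ := by
      field_simp; ring
    simp only []
    linarith
  rw [integral_add (integrable_const _) ((hSi2 J).const_mul _), integral_const_mul,
    integral_const, smul_eq_mul] at h2
  have h3 : (J : ℝ)⁻¹ * ((2 * η * J)⁻¹ * ∫ x, ‖S J x‖ ^ 2 ∂μ) ≤ (2 * η)⁻¹ *
      (B * (J : ℝ)⁻¹ + 2 * ((J : ℝ)⁻¹ * ∑ n ∈ Finset.range J, r n)) := by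
    have := mul_le_mul_of_nonneg_left (hA J) (by positivity : 0 ≤ (J : ℝ)⁻¹ * (2 * η * J)⁻¹)
    rw [← mul_assoc]
    refine this.trans_eq ?_
    field_simp
  have h4 : (2 * η)⁻¹ * (B * (J : ℝ)⁻¹ + 2 * ((J : ℝ)⁻¹ * ∑ n ∈ Finset.range J, r n)) <
      (2 * η)⁻¹ * (ε * η / 2) := by
    gcongr
  have h5 : (2 * η)⁻¹ * (ε * η / 2) = ε / 4 := by field_simp; norm_num
  have h6 : B * η ≤ ε := by rw [hη]; rw [← mul_div_assoc, div_le_iff₀ (by positivity)]; nlinarith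
  have h7 := mul_le_mul_of_nonneg_left h2 (inv_nonneg.2 hJ0.le)
  rw [mul_add] at h7
  have h8 : (J : ℝ)⁻¹ * (B * (η * J / 2)) = B * η / 2 := by field_simp
  change (J : ℝ)⁻¹ * ∫ x, ‖S J x‖ ∂μ < ε
  linarith

end Lacunary

section LacunarySampling

variable {d : ℕ}

local notation "𝕏" => Fin d → ℝ
local notation "ℤℤ" => Fin d → ℤ

/-- The Riemann–Lebesgue lemma. -/
lemma exists_norm_ft_le (f : 𝕏 → ℂ) {ε : ℝ} (hε : 0 < ε) :
    ∃ R : ℝ, ∀ ξ : 𝕏, R ≤ eucNorm ξ → ‖ft f ξ‖ ≤ ε := by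
  have h := tendsto_integral_exp_inner_smul_cocompact (E := ℂ)
    (fun x : EuclideanSpace ℝ (Fin d) => f (WithLp.ofLp x))
  have h2 := (Metric.tendsto_nhds.1 h) ε hε
  rw [← Metric.cobounded_eq_cocompact, ← comap_norm_atTop, eventually_comap] at h2
  obtain ⟨R, hR⟩ := eventually_atTop.1 h2
  refine ⟨R, fun ξ hξ => ?_⟩
  have h3 := hR (eucNorm ξ) hξ (WithLp.toLp 2 ξ) (norm_toLp_eq_eucNorm ξ)
  rw [dist_zero_right] at h3
  rw [ft_eq_fourier]
  exact h3.le

/-- A lacunary sequence of dilations. -/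
def Lacunary (α : ℕ → ℝ) : Prop := ∃ δ : ℝ, 0 < δ ∧ δ < 1 ∧ ∀ j : ℕ, |α j| ≤ δ * |α (j + 1)|

lemma Lacunary.sub_le {α : ℕ → ℝ} {δ : ℝ} (h0 : 0 < δ) (h1 : δ < 1)
    (h : ∀ j : ℕ, |α j| ≤ δ * |α (j + 1)|) {j n : ℕ} (hjn : j < n) :
    (1 - δ) * |α n| ≤ |α n - α j| := by
  have hj : |α j| ≤ δ * |α n| := by
    induction n, hjn using Nat.le_induction with
    | base => exact h j
    | succ n hn ih =>
      refine ih.trans ?_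
      have h3 := h n
      have h4 := abs_nonneg (α (n + 1))
      exact mul_le_mul_of_nonneg_left (h3.trans (by nlinarith)) h0.le
  have := abs_sub_abs_le_abs_sub (α n) (α j)
  linarith

/-- Modulations along a lacunary sequence average out in `L¹`. -/
theorem tendsto_mean_char {f : 𝕏 → ℂ} (hf : Integrable f) {α : ℕ → ℝ} (hl : Lacunary α)
    (hα : Tendsto (fun j => |α j|) atTop atTop) {σ : ℕ → ℂ} (hσ : ∀ j, ‖σ j‖ ≤ 1) {ξ : 𝕏}
    (hξ : ξ ≠ 0) :
    Tendsto (fun J : ℕ => (J : ℝ≥0∞)⁻¹ *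
      ∫⁻ x, ‖∑ j ∈ Finset.range J, σ j * (f x * expChar ξ (α j • x))‖ₑ) atTop (𝓝 0) := by
  obtain ⟨δ, h0, h1, h⟩ := hl
  set μ : Measure 𝕏 := volume.withDensity fun x => ‖f x‖ₑ with hμ
  have : IsFiniteMeasure μ := isFiniteMeasure_withDensity hf.2.ne
  have hc : ∀ j, Continuous fun x : 𝕏 => σ j * expChar ξ (α j • x) := fun j =>
    continuous_const.mul ((continuous_expChar ξ).comp (continuous_const_smul _))
  have key := tendsto_mean_of_asymp_orthogonal μ (e := fun j x => σ j * expChar ξ (α j • x))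
    (fun j => (hc j).aestronglyMeasurable)
    (fun j x => by simp only [norm_mul, norm_expChar, mul_one]; exact hσ j) (fun ε hε => ?_)
  · have k2 := ENNReal.tendsto_ofReal key
    rw [ENNReal.ofReal_zero] at k2
    refine k2.congr' ?_
    filter_upwards [eventually_gt_atTop 0] with J hJ
    have hcs : Continuous fun x : 𝕏 => ∑ j ∈ Finset.range J, σ j * expChar ξ (α j • x) :=
      continuous_finsetSum _ fun j _ => hc j
    rw [ENNReal.ofReal_mul (by positivity), ENNReal.ofReal_inv_of_pos (by exact_mod_cast hJ),
      ENNReal.ofReal_natCast, ofReal_integral_norm_eq_lintegral_enorm]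
    · congr 1
      rw [hμ, lintegral_withDensity_eq_lintegral_mul₀ hf.1.enorm
        hcs.aestronglyMeasurable.enorm]
      refine lintegral_congr fun x => ?_
      rw [Pi.mul_apply, ← enorm_mul, Finset.mul_sum]
      congr 1
      exact Finset.sum_congr rfl fun j _ => by ring
    · refine (integrable_const (J : ℝ)).mono' hcs.aestronglyMeasurable (ae_of_all _ fun x => ?_)
      refine (norm_sum_le _ _).trans ((Finset.sum_le_sum (g := fun _ => (1 : ℝ)) fun j _ => ?_).trans ?_)
      · rw [norm_mul, norm_expChar, mul_one]; exact hσ j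
      · simp
  · obtain ⟨R, hR⟩ := exists_norm_ft_le (fun x : 𝕏 => ((‖f x‖ : ℝ) : ℂ)) hε
    have hξ0 := eucNorm_pos hξ
    obtain ⟨N, hN⟩ := eventually_atTop.1
      ((tendsto_atTop.1 hα) (R / eucNorm ξ / (1 - δ)))
    refine ⟨N, fun n hn j hj => ?_⟩
    have e : ∫ x, σ n * expChar ξ (α n • x) * (starRingEnd ℂ) (σ j * expChar ξ (α j • x)) ∂μ =
        σ n * (starRingEnd ℂ) (σ j) * ft (fun x : 𝕏 => ((‖f x‖ : ℝ) : ℂ)) ((α j - α n) • ξ) := by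
      rw [hμ, integral_withDensity_eq_integral_toReal_smul₀ hf.1.enorm
        (ae_of_all _ fun x => enorm_lt_top), ft_eq_expChar, ← integral_const_mul]
      refine integral_congr_ae (ae_of_all _ fun x => ?_)
      simp only [toReal_enorm, map_mul, conj_expChar, Complex.real_smul]
      have : expChar (-((α j - α n) • ξ)) x = expChar ξ (α n • x) * expChar (-ξ) (α j • x) := by
        rw [expChar_smul, expChar_smul, ← expChar_add_left]
        congr 1
        module
      rw [this]
      ring
    rw [e, norm_mul, norm_mul, RCLike.norm_conj]
    have h2 : R ≤ eucNorm ((α j - α n) • ξ) := by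
      rw [eucNorm_smul, abs_sub_comm]
      have h3 := Lacunary.sub_le h0 h1 h hj
      have h4 := hN n hn
      have h5 : 0 < 1 - δ := by linarith
      rw [div_le_iff₀ h5, div_le_iff₀ hξ0] at h4
      nlinarith
    have h3 := hR _ h2
    have h4 : ‖σ n‖ * ‖σ j‖ ≤ 1 := mul_le_one₀ (hσ n) (norm_nonneg _) (hσ j)
    have := norm_nonneg (ft (fun x : 𝕏 => ((‖f x‖ : ℝ) : ℂ)) ((α j - α n) • ξ))
    nlinarith [norm_nonneg (σ n), norm_nonneg (σ j)]

/-- Approximation of a mean-zero periodization by trigonometric polynomials without constant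
term. -/
lemma exists_trigPoly_latPer {v : 𝕏 → ℂ} (hv : Integrable v) (h0 : ft v 0 = 0) {τ : ℝ≥0∞}
    (hτ : 0 < τ) : ∃ (s : Finset ℤℤ) (a : ℤℤ → ℂ), 0 ∉ s ∧
      ∫⁻ x in unitCell d, ‖latPer v x - ∑ l ∈ s, a l * expChar (intVec l) x‖ₑ ≤ 2 * τ := by
  have hfin : IsFiniteMeasure (volume.restrict (unitCell d)) :=
    ⟨by rw [Measure.restrict_apply_univ, volume_unitCell]; exact ENNReal.one_lt_top⟩
  obtain ⟨a, ha⟩ := exists_trigPoly (integrableOn_latPer hv) hτ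
  refine ⟨a.support.erase 0, a, Finset.notMem_erase _ _, ?_⟩
  have hP : ∀ x : 𝕏, (a.sum fun l z => z * expChar (intVec l) x) =
      a 0 + ∑ l ∈ a.support.erase 0, a l * expChar (intVec l) x := by
    intro x
    rw [Finsupp.sum]
    by_cases h : (0 : ℤℤ) ∈ a.support
    · rw [← Finset.add_sum_erase _ _ h, intVec_zero, expChar_zero_left, mul_one]
    · rw [Finset.erase_eq_of_notMem h, Finsupp.notMem_support_iff.1 h, zero_add]
  have hci : ∀ l : ℤℤ, IntegrableOn (fun x : 𝕏 => a l * expChar (intVec l) x) (unitCell d) :=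
    fun l => ((integrable_const (1 : ℝ)).mono' (continuous_expChar _).aestronglyMeasurable
      (ae_of_all _ fun x => (norm_expChar _ x).le)).const_mul _
  have hsi : IntegrableOn (fun x : 𝕏 => ∑ l ∈ a.support.erase 0, a l * expChar (intVec l) x)
      (unitCell d) := integrable_finsetSum _ fun l _ => hci l
  have h1 : ∫ x in unitCell d, (a.sum fun l z => z * expChar (intVec l) x) = a 0 := by
    simp_rw [hP]
    rw [integral_add (integrable_const _) hsi, integral_finsetSum _ fun l _ => hci l,
      Finset.sum_eq_zero fun l hl => ?_]
    · simp [Measure.real, volume_unitCell]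
    · rw [integral_const_mul, setIntegral_expChar (Finset.ne_of_mem_erase hl), mul_zero]
  have hPi : IntegrableOn (fun x : 𝕏 => a.sum fun l z => z * expChar (intVec l) x)
      (unitCell d) := by
    simp_rw [hP]
    exact (integrable_const _).add hsi
  have h2 : ‖a 0‖ₑ ≤ τ := by
    have h3 : ∫ x in unitCell d, (latPer v x - a.sum fun l z => z * expChar (intVec l) x) = -a 0 := by
      rw [integral_sub (integrableOn_latPer hv) hPi, h1, setIntegral_unitCell_latPer hv,
        ← ft_zero_eq, h0, zero_sub]
    rw [← enorm_neg, ← h3]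
    exact (enorm_integral_le_lintegral_enorm _).trans ha.le
  calc _ ≤ ∫⁻ x in unitCell d,
        (‖latPer v x - a.sum fun l z => z * expChar (intVec l) x‖ₑ + ‖a 0‖ₑ) := by
        refine lintegral_mono fun x => ?_
        refine le_trans (le_of_eq ?_) (enorm_add_le _ _)
        rw [hP]
        congr 1
        ring
    _ ≤ τ + τ := by
        rw [lintegral_add_right _ measurable_const, lintegral_const, Measure.restrict_apply_univ,
          volume_unitCell, mul_one]
        exact add_le_add ha.le h2
    _ = _ := (two_mul τ).symm

end LacunarySampling

section MeanSampling

variable {d : ℕ}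

local notation "𝕏" => Fin d → ℝ
local notation "ℤℤ" => Fin d → ℤ

/-- The `L¹` size of the arithmetic means of a sequence of functions. -/
def meanSize (u : ℕ → (Fin d → ℝ) → ℂ) (J : ℕ) : ℝ≥0∞ :=
  (J : ℝ≥0∞)⁻¹ * ∫⁻ x, ‖∑ j ∈ Finset.range J, u j x‖ₑ

lemma meanSize_le {u : ℕ → 𝕏 → ℂ} (hu : ∀ j, AEStronglyMeasurable (u j) volume) (J : ℕ) :
    meanSize u J ≤ (J : ℝ≥0∞)⁻¹ * ∑ j ∈ Finset.range J, ∫⁻ x, ‖u j x‖ₑ := by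
  unfold meanSize
  rw [← lintegral_finsetSum' _ fun j _ => (hu j).enorm]
  gcongr
  exact enorm_sum_le _ _

lemma meanSize_add_le {u : ℕ → 𝕏 → ℂ} (hu : ∀ j, AEStronglyMeasurable (u j) volume)
    (v : ℕ → 𝕏 → ℂ) (J : ℕ) :
    meanSize (fun j x => u j x + v j x) J ≤ meanSize u J + meanSize v J := by
  unfold meanSize
  rw [← mul_add, ← lintegral_add_left'
    (Finset.aestronglyMeasurable_fun_sum (Finset.range J) fun j _ => hu j).enorm]
  gcongr
  rw [Finset.sum_add_distrib]
  exact enorm_add_le _ _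

lemma meanSize_le_of_le {u : ℕ → 𝕏 → ℂ} (hu : ∀ j, AEStronglyMeasurable (u j) volume)
    {κ : ℝ≥0∞} (h : ∀ j, ∫⁻ x, ‖u j x‖ₑ ≤ κ) (J : ℕ) : meanSize u J ≤ κ := by
  refine (meanSize_le hu J).trans ?_
  calc _ ≤ (J : ℝ≥0∞)⁻¹ * ∑ j ∈ Finset.range J, κ := by gcongr with j; exact h j
    _ = ((J : ℝ≥0∞)⁻¹ * J) * κ := by rw [Finset.sum_const, Finset.card_range, nsmul_eq_mul, mul_assoc]
    _ ≤ 1 * κ := by gcongr; exact ENNReal.inv_mul_le_one _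
    _ = κ := one_mul κ

lemma tendsto_meanSize {u : ℕ → 𝕏 → ℂ} (hu : ∀ j, Integrable (u j))
    (h : Tendsto (fun j => ∫⁻ x, ‖u j x‖ₑ) atTop (𝓝 0)) :
    Tendsto (meanSize u) atTop (𝓝 0) :=
  tendsto_of_tendsto_of_tendsto_of_le_of_le tendsto_const_nhds
    (tendsto_cesaro_enn (fun j => (hu j).2.ne) h) (fun _ => zero_le)
    fun J => meanSize_le (fun j => (hu j).1) J

lemma integrable_stepFn_mul {φ : 𝕏 → ℂ} (hφ : IsWindow φ) {a : ℝ} (ha : a ≠ 0) {f : 𝕏 → ℂ}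
    (hf : Integrable f) {q : 𝕏 → ℂ} (hq : AEStronglyMeasurable q volume)
    (hper : ∀ (k : ℤℤ) x, q (x + intVec k) = q x) (hqi : IntegrableOn q (unitCell d)) :
    Integrable fun x => stepFn a φ f x * q (a • x) := by
  obtain ⟨M, hM, h⟩ := hφ.bdd
  refine ⟨(aestronglyMeasurable_stepFn a φ f).mul
    (hq.comp_quasiMeasurePreserving (quasiMeasurePreserving_smul ha)), ?_⟩
  exact (lintegral_stepFn_mul_le hφ h ha hf hq hper).trans_lt
    (ENNReal.mul_lt_top (ENNReal.mul_lt_top hM.lt_top hf.2) hqi.2)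

set_option maxHeartbeats 1000000 in
/-- Synthesizers of mean zero have sampling operators that average out along lacunary dilations. -/
theorem tendsto_mean_samp {φ : 𝕏 → ℂ} (hφ : IsWindow φ) {f v : 𝕏 → ℂ} (hf : Integrable f)
    (hv : Integrable v) (h0 : ft v 0 = 0) {α : ℕ → ℝ} (hl : Lacunary α) (hα0 : ∀ j, α j ≠ 0)
    (hα : Tendsto (fun j => |α j|) atTop atTop) (hα' : Tendsto (fun j => (α j)⁻¹) atTop (𝓝 0))
    {σ : ℕ → ℂ} (hσ : ∀ j, ‖σ j‖ ≤ 1) :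
    Tendsto (meanSize fun j x => σ j * samp (α j) φ f v x) atTop (𝓝 0) := by
  obtain ⟨M, hM, h⟩ := hφ.bdd
  have hσe : ∀ j, ‖σ j‖ₑ ≤ 1 := fun j => by
    rw [← ofReal_norm]; exact ENNReal.ofReal_le_one.2 (hσ j)
  have hmul : ∀ (u : ℕ → 𝕏 → ℂ) j, ∫⁻ x, ‖σ j * u j x‖ₑ ≤ ∫⁻ x, ‖u j x‖ₑ := fun u j => by
    refine lintegral_mono fun x => ?_
    rw [enorm_mul]
    exact mul_le_of_le_one_left' (hσe j)
  have hfin : M * ∫⁻ x, ‖f x‖ₑ ≠ ⊤ := (ENNReal.mul_lt_top hM.lt_top hf.2).ne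
  refine ENNReal.tendsto_nhds_zero.2 fun ε hε => ?_
  obtain ⟨τ, hτ, hτε⟩ : ∃ τ : ℝ≥0, 0 < τ ∧ τ * (2 * (M * ∫⁻ x, ‖f x‖ₑ)) < ε / 2 :=
    ENNReal.exists_nnreal_pos_mul_lt (ENNReal.mul_ne_top ENNReal.ofNat_ne_top hfin)
      (ENNReal.half_pos hε.ne').ne'
  obtain ⟨s, a, hs, hsa⟩ := exists_trigPoly_latPer hv h0 (τ := τ) (by exact_mod_cast hτ)
  set p : 𝕏 → ℂ := fun x => ∑ l ∈ s, a l * expChar (intVec l) x with hp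
  have hpc : Continuous p := continuous_finsetSum _ fun l _ =>
    continuous_const.mul (continuous_expChar _)
  set q : 𝕏 → ℂ := fun x => latPer v x - p x with hq
  have hqm : AEStronglyMeasurable q volume :=
    (aestronglyMeasurable_latPer hv).sub hpc.aestronglyMeasurable
  have hqper : ∀ (k : ℤℤ) x, q (x + intVec k) = q x := by
    intro k x
    simp only [hq, hp, latPer_add, expChar_add, expChar_intVec, mul_one]
  set C : ℝ := ∑ l ∈ s, ‖a l‖ with hC
  have hpC : ∀ x, ‖p x‖ ≤ C := fun x => by
    refine (norm_sum_le _ _).trans (le_of_eq (Finset.sum_congr rfl fun l _ => ?_))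
    rw [norm_mul, norm_expChar, mul_one]
  have hpe : ∀ x, ‖p x‖ₑ ≤ ENNReal.ofReal C := fun x => by
    rw [← ofReal_norm]; exact ENNReal.ofReal_le_ofReal (hpC x)
  have hpcj : ∀ j, Continuous fun x => p (α j • x) := fun j => hpc.comp (continuous_const_smul _)
  have hsm := fun j => aestronglyMeasurable_stepFn (α j) φ f
  have hsi : ∀ j, Integrable fun x => stepFn (α j) φ f x - f x := fun j => by
    have h2 := integrable_stepFn_mul hφ (hα0 j) hf (q := fun _ => 1)
      aestronglyMeasurable_const (fun _ _ => rfl)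
      (integrableOn_const (by rw [volume_unitCell]; exact ENNReal.one_ne_top))
    simp only [mul_one] at h2
    exact h2.sub hf
  set X : ℕ → 𝕏 → ℂ := fun j x =>
    σ j * (samp (α j) φ f v x - stepFn (α j) φ f x * latPer v (α j • x)) with hX
  set Y : ℕ → 𝕏 → ℂ := fun j x => σ j * (stepFn (α j) φ f x * q (α j • x)) with hY
  set Z : ℕ → 𝕏 → ℂ := fun j x => σ j * ((stepFn (α j) φ f x - f x) * p (α j • x)) with hZ
  set W : ℕ → 𝕏 → ℂ := fun j x => σ j * (f x * p (α j • x)) with hW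
  have hYm : ∀ j, AEStronglyMeasurable (Y j) volume := fun j =>
    ((hsm j).mul (hqm.comp_quasiMeasurePreserving
      (quasiMeasurePreserving_smul (hα0 j)))).const_mul _
  have hYle : ∀ j, ∫⁻ x, ‖Y j x‖ₑ ≤ ε / 2 := fun j => by
    refine (hmul (fun j x => stepFn (α j) φ f x * q (α j • x)) j).trans ((lintegral_stepFn_mul_le hφ h (hα0 j) hf hqm hqper).trans ?_)
    refine le_trans ?_ hτε.le
    calc _ ≤ (M * ∫⁻ x, ‖f x‖ₑ) * (2 * τ) := by gcongr
      _ = _ := by ring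
  have hZi : ∀ j, Integrable (Z j) := fun j =>
    (((hsi j).mul_bdd (c := C) (hpcj j).aestronglyMeasurable
      (ae_of_all _ fun x => hpC _))).const_mul _
  have hXi : ∀ j, Integrable (X j) := fun j =>
    ((integrable_samp hφ (hα0 j) hf hv).sub (integrable_stepFn_mul hφ (hα0 j) hf
      (aestronglyMeasurable_latPer hv) (fun k x => latPer_add v x k)
      (integrableOn_latPer hv))).const_mul _
  have hX0 : Tendsto (meanSize X) atTop (𝓝 0) := tendsto_meanSize hXi
    (tendsto_of_tendsto_of_tendsto_of_le_of_le tendsto_const_nhds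
      (tendsto_samp_sub hφ hf hv hα0 hα') (fun _ => zero_le) fun j => hmul
      (fun j x => samp (α j) φ f v x - stepFn (α j) φ f x * latPer v (α j • x)) j)
  have hZ0 : Tendsto (meanSize Z) atTop (𝓝 0) := by
    refine tendsto_meanSize hZi ?_
    have h2 := ENNReal.Tendsto.mul_const (b := ENNReal.ofReal C) (tendsto_stepFn hφ hf hα0 hα')
      (Or.inr ENNReal.ofReal_ne_top)
    rw [zero_mul] at h2
    refine tendsto_of_tendsto_of_tendsto_of_le_of_le tendsto_const_nhds h2 (fun _ => zero_le)
      fun j =>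
        (hmul (fun j x => (stepFn (α j) φ f x - f x) * p (α j • x)) j).trans ?_
    rw [← lintegral_mul_const' _ _ ENNReal.ofReal_ne_top]
    refine lintegral_mono fun x => ?_
    rw [enorm_mul]
    gcongr
    exact hpe _
  have hW0 : Tendsto (meanSize W) atTop (𝓝 0) := by
    have h2 : Tendsto (fun J => ∑ l ∈ s, ‖a l‖ₑ *
        meanSize (fun j x => σ j * (f x * expChar (intVec l) (α j • x))) J) atTop (𝓝 0) := by
      rw [← Finset.sum_const_zero (s := s)]
      refine tendsto_finsetSum _ fun l hl' => ?_
      have h3 := ENNReal.Tendsto.const_mul (a := ‖a l‖ₑ) (tendsto_mean_char hf hl hα hσ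
        (intVec_ne_zero (ne_of_mem_of_not_mem hl' hs))) (Or.inr enorm_ne_top)
      rwa [mul_zero] at h3
    refine tendsto_of_tendsto_of_tendsto_of_le_of_le tendsto_const_nhds h2 (fun _ => zero_le)
      fun J => ?_
    simp only [meanSize]
    calc _ ≤ (J : ℝ≥0∞)⁻¹ * ∫⁻ x, ∑ l ∈ s, ‖a l‖ₑ *
          ‖∑ j ∈ Finset.range J, σ j * (f x * expChar (intVec l) (α j • x))‖ₑ := by
          gcongr with x
          simp_rw [← enorm_mul]
          refine le_trans (le_of_eq ?_) (enorm_sum_le _ _)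
          congr 1
          simp_rw [hW, hp, Finset.mul_sum]
          rw [Finset.sum_comm]
          refine Finset.sum_congr rfl fun l _ => Finset.sum_congr rfl fun j _ => ?_
          ring
      _ = _ := by
          rw [lintegral_finsetSum' _ fun l _ => ?_, Finset.mul_sum]
          · refine Finset.sum_congr rfl fun l _ => ?_
            rw [lintegral_const_mul' _ _ enorm_ne_top]
            ring
          · refine (AEStronglyMeasurable.enorm ?_).const_mul _
            exact Finset.aestronglyMeasurable_fun_sum _ fun j _ => (hf.1.mul
              ((continuous_expChar _).comp (continuous_const_smul _)).aestronglyMeasurable).const_mul _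
  have hdec : (fun j x => σ j * samp (α j) φ f v x) =
      fun j x => Y j x + (X j x + (Z j x + W j x)) := by
    funext j x
    simp only [hX, hY, hZ, hW, hq]
    ring
  have h3 := hX0.add (hZ0.add hW0)
  rw [add_zero, add_zero] at h3
  filter_upwards [ENNReal.tendsto_nhds_zero.1 h3 (ε / 2) (ENNReal.half_pos hε.ne')] with J hJ
  rw [hdec]
  calc _ ≤ meanSize Y J + meanSize (fun j x => X j x + (Z j x + W j x)) J := meanSize_add_le hYm _ J
    _ ≤ meanSize Y J + (meanSize X J + (meanSize Z J + meanSize W J)) := by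
        gcongr
        refine (meanSize_add_le (fun j => (hXi j).1) _ J).trans ?_
        gcongr
        exact meanSize_add_le (fun j => (hZi j).1) _ J
    _ ≤ ε / 2 + ε / 2 := by
        gcongr
        exact meanSize_le_of_le hYm hYle J
    _ = ε := ENNReal.add_halves ε

end MeanSampling

section LinearChange

variable {d : ℕ}

local notation "𝕏" => Fin d → ℝ
local notation "ℤℤ" => Fin d → ℤ

/-- An invertible matrix as a continuous linear equivalence. -/
def matEquiv (b : Matrix (Fin d) (Fin d) ℝ) (hb : b.det ≠ 0) : (Fin d → ℝ) ≃L[ℝ] (Fin d → ℝ) :=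
  (Matrix.toLin'OfInv (M := b⁻¹) (M' := b)
    (Matrix.nonsing_inv_mul b (isUnit_iff_ne_zero.2 hb))
    (Matrix.mul_nonsing_inv b (isUnit_iff_ne_zero.2 hb))).toContinuousLinearEquiv

lemma matEquiv_apply {b : Matrix (Fin d) (Fin d) ℝ} (hb : b.det ≠ 0) (u : 𝕏) :
    matEquiv b hb u = b *ᵥ u := by
  simp [matEquiv, Matrix.toLin'OfInv]

lemma det_inv_ne_zero {b : Matrix (Fin d) (Fin d) ℝ} (hb : b.det ≠ 0) : b⁻¹.det ≠ 0 := by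
  rw [Matrix.det_nonsing_inv, Ring.inverse_eq_inv']
  exact inv_ne_zero hb

/-- The `L¹`-normalized linear change of variables. -/
def lin (b : Matrix (Fin d) (Fin d) ℝ) (f : (Fin d → ℝ) → ℂ) (u : Fin d → ℝ) : ℂ :=
  ((|b.det| : ℝ) : ℂ) * f (b *ᵥ u)

lemma map_mulVec_volume {b : Matrix (Fin d) (Fin d) ℝ} (hb : b.det ≠ 0) :
    Measure.map (fun u : 𝕏 => b *ᵥ u) volume = ENNReal.ofReal |b.det⁻¹| • volume :=
  Real.map_matrix_volume_pi_eq_smul_volume_pi hb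

lemma ofReal_mul_ofReal_det_inv {b : Matrix (Fin d) (Fin d) ℝ} (hb : b.det ≠ 0) :
    ENNReal.ofReal |b.det| * ENNReal.ofReal |b.det⁻¹| = 1 := by
  rw [← ENNReal.ofReal_mul (abs_nonneg _), ← abs_mul, mul_inv_cancel₀ hb]
  simp

lemma measurableEmbedding_mulVec {b : Matrix (Fin d) (Fin d) ℝ} (hb : b.det ≠ 0) :
    MeasurableEmbedding fun u : 𝕏 => b *ᵥ u := by
  have h := (matEquiv b hb).toHomeomorph.measurableEmbedding
  have e : ⇑(matEquiv b hb).toHomeomorph = fun u : 𝕏 => b *ᵥ u := funext (matEquiv_apply hb)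
  rwa [e] at h

lemma quasiMeasurePreserving_mulVec {b : Matrix (Fin d) (Fin d) ℝ} (hb : b.det ≠ 0) :
    Measure.QuasiMeasurePreserving (fun u : 𝕏 => b *ᵥ u) volume volume := by
  refine ⟨(measurableEmbedding_mulVec hb).measurable, ?_⟩
  rw [map_mulVec_volume hb]
  exact Measure.smul_absolutelyContinuous

lemma lintegral_lin {b : Matrix (Fin d) (Fin d) ℝ} (hb : b.det ≠ 0) (f : 𝕏 → ℂ) :
    ∫⁻ u, ‖lin b f u‖ₑ = ∫⁻ x, ‖f x‖ₑ := by
  have h1 := (measurableEmbedding_mulVec hb).lintegral_map (μ := volume) fun x => ‖f x‖ₑ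
  rw [map_mulVec_volume hb, lintegral_smul_measure] at h1
  simp only [lin, enorm_mul]
  rw [lintegral_const_mul' _ _ enorm_ne_top, ← h1, smul_eq_mul, ← mul_assoc, ← ofReal_norm,
    Complex.norm_real, Real.norm_eq_abs, abs_abs, ofReal_mul_ofReal_det_inv hb, one_mul]

lemma integral_lin {b : Matrix (Fin d) (Fin d) ℝ} (hb : b.det ≠ 0) (f : 𝕏 → ℂ) :
    ∫ u, lin b f u = ∫ x, f x := by
  have h1 := (measurableEmbedding_mulVec hb).integral_map (μ := volume) f
  rw [map_mulVec_volume hb, integral_smul_measure] at h1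
  simp only [lin]
  rw [integral_const_mul, ← h1, ENNReal.toReal_ofReal (abs_nonneg _), Complex.real_smul,
    ← mul_assoc, ← Complex.ofReal_mul, ← abs_mul, mul_inv_cancel₀ hb]
  simp

lemma integrable_lin {b : Matrix (Fin d) (Fin d) ℝ} (hb : b.det ≠ 0) {f : 𝕏 → ℂ}
    (hf : Integrable f) : Integrable (lin b f) := by
  refine ⟨(hf.1.comp_quasiMeasurePreserving (quasiMeasurePreserving_mulVec hb)).const_mul _, ?_⟩
  rw [HasFiniteIntegral, lintegral_lin hb]
  exact hf.2

lemma lin_lin_inv {b : Matrix (Fin d) (Fin d) ℝ} (hb : b.det ≠ 0) (f : 𝕏 → ℂ) :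
    lin b (lin b⁻¹ f) = f := by
  ext x
  simp only [lin]
  rw [Matrix.mulVec_mulVec, Matrix.nonsing_inv_mul b (isUnit_iff_ne_zero.2 hb), Matrix.one_mulVec,
    ← mul_assoc, ← Complex.ofReal_mul, ← abs_mul, Matrix.det_nonsing_inv, Ring.inverse_eq_inv',
    mul_inv_cancel₀ hb]
  simp

lemma lin_inv_lin {b : Matrix (Fin d) (Fin d) ℝ} (hb : b.det ≠ 0) (f : 𝕏 → ℂ) :
    lin b⁻¹ (lin b f) = f := by
  have := lin_lin_inv (det_inv_ne_zero hb) f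
  rwa [Matrix.nonsing_inv_nonsing_inv b (isUnit_iff_ne_zero.2 hb)] at this

lemma lin_congr_ae {b : Matrix (Fin d) (Fin d) ℝ} (hb : b.det ≠ 0) {f g : 𝕏 → ℂ}
    (h : f =ᵐ[volume] g) : lin b f =ᵐ[volume] lin b g := by
  filter_upwards [(quasiMeasurePreserving_mulVec hb).ae h] with x hx
  rw [lin, lin, hx]

lemma dotP_mulVec (b : Matrix (Fin d) (Fin d) ℝ) (ξ u : 𝕏) :
    dotP ξ (b *ᵥ u) = dotP (ξ ᵥ* b) u :=
  Matrix.dotProduct_mulVec ξ b u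

lemma expChar_mulVec (b : Matrix (Fin d) (Fin d) ℝ) (ξ u : 𝕏) :
    expChar ξ (b *ᵥ u) = expChar (ξ ᵥ* b) u := by
  rw [expChar, expChar, dotP_mulVec]

lemma ft_lin {b : Matrix (Fin d) (Fin d) ℝ} (hb : b.det ≠ 0) (f : 𝕏 → ℂ) (ξ : 𝕏) :
    ft (lin b f) (ξ ᵥ* b) = ft f ξ := by
  rw [ft_eq_expChar, ft_eq_expChar, ← integral_lin hb (fun x => expChar (-ξ) x * f x)]
  refine integral_congr_ae (ae_of_all _ fun x => ?_)
  simp only [lin, expChar_mulVec, Matrix.neg_vecMul]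
  ring

lemma conv_lin {b : Matrix (Fin d) (Fin d) ℝ} (hb : b.det ≠ 0) (f g : 𝕏 → ℂ) :
    conv (lin b f) (lin b g) = lin b (conv f g) := by
  ext x
  rw [lin, conv, conv, ← integral_lin hb (fun y => f y * g (b *ᵥ x - y)), ← integral_const_mul]
  refine integral_congr_ae (ae_of_all _ fun y => ?_)
  simp only [lin, Matrix.mulVec_sub]
  ring

lemma adj_lin (b : Matrix (Fin d) (Fin d) ℝ) (φ : 𝕏 → ℂ) : adj (lin b φ) = lin b (adj φ) := by
  ext x
  simp [adj, lin, Matrix.mulVec_neg]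

lemma dil_lin (a : ℝ) (b : Matrix (Fin d) (Fin d) ℝ) (f : 𝕏 → ℂ) :
    dil a (lin b f) = lin b (dil a f) := by
  ext x
  simp only [dil, lin, Matrix.mulVec_smul]
  ring

/-- Band-limited Schwartz functions are windows after normalizing the lattice. -/
lemma isWindow_lin {b : Matrix (Fin d) (Fin d) ℝ} (hb : b.det ≠ 0) {φ : 𝕏 → ℂ}
    (hφ : IsSchwartz φ)
    (hsupp : Function.support (ft φ) ⊆ {ξ : Fin d → ℝ | ξ ᵥ* b ∈ centeredCube d})
    (hint : ∫ x, φ x = 1) : IsWindow (lin b φ) := by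
  obtain ⟨Φ, hΦ⟩ := hφ
  set Ψ : SchwartzMap (Fin d → ℝ) ℂ :=
    ((|b.det| : ℝ) : ℂ) • SchwartzMap.compCLMOfContinuousLinearEquiv ℂ (matEquiv b hb) Φ with hΨ
  have e : lin b φ = Ψ := by
    ext u
    rw [lin, hΦ, ← matEquiv_apply hb]
    rfl
  refine ⟨?_, ?_, ?_, fun η hη => ?_, ?_⟩
  · rw [e]; exact Ψ.continuous.measurable
  · rw [e]; exact Ψ.integrable
  · rw [e]; exact exists_latBdd Ψ
  · have h1 : (η ᵥ* b⁻¹) ᵥ* b = η := by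
      rw [Matrix.vecMul_vecMul, Matrix.nonsing_inv_mul b (isUnit_iff_ne_zero.2 hb),
        Matrix.vecMul_one]
    have h2 : ft φ (η ᵥ* b⁻¹) ≠ 0 := by
      rw [← ft_lin hb, h1]
      exact hη
    have h3 := hsupp h2
    rwa [Set.mem_ofPred_eq, h1] at h3
  · rw [ft_zero_eq, integral_lin hb, hint]

/-- Analysis followed by synthesis at dilation `a`, for the lattice generated by `b`. -/
def bsamp (b : Matrix (Fin d) (Fin d) ℝ) (a : ℝ) (φ f v : (Fin d → ℝ) → ℂ) :
    (Fin d → ℝ) → ℂ := lin b⁻¹ (samp a (lin b φ) (lin b f) (lin b v))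

lemma lin_bsamp {b : Matrix (Fin d) (Fin d) ℝ} (hb : b.det ≠ 0) (a : ℝ) (φ f v : 𝕏 → ℂ) :
    lin b (bsamp b a φ f v) = samp a (lin b φ) (lin b f) (lin b v) := lin_lin_inv hb _

lemma latCoef_lin {α : ℕ → ℝ} {j : ℕ} (hα : α j ≠ 0) {b : Matrix (Fin d) (Fin d) ℝ}
    (hb : b.det ≠ 0) (φ f : 𝕏 → ℂ) (k : ℤℤ) :
    latCoef (lin b φ) (dil (α j)⁻¹ (lin b f)) k = TjH α b φ f j k := by
  rw [latCoef, TjH, ← integral_const_mul,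
    ← integral_lin hb (fun x => ((|b.det| : ℝ) : ℂ) * (f x * (starRingEnd ℂ) (φ (α j • x - b *ᵥ intVec k)))),
    ← integral_dil (inv_ne_zero hα) (lin b _)]
  refine integral_congr_ae (ae_of_all _ fun y => ?_)
  simp only [lin, dil, Matrix.mulVec_sub, Matrix.mulVec_smul, map_mul, Complex.conj_ofReal,
    smul_smul, mul_inv_cancel₀ hα, one_smul]
  ring

lemma bsamp_eq {α : ℕ → ℝ} {j : ℕ} (hα : α j ≠ 0) {b : Matrix (Fin d) (Fin d) ℝ}
    (hb : b.det ≠ 0) (φ f ψ : 𝕏 → ℂ) :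
    (fun x => ∑' k : ℤℤ, TjH α b φ f j k * rescH α b ψ j k x) = bsamp b (α j) φ f ψ := by
  rw [bsamp, ← lin_inv_lin hb (fun x => ∑' k : ℤℤ, TjH α b φ f j k * rescH α b ψ j k x)]
  congr 1
  ext u
  simp only [samp, dil, latSum]
  rw [lin, ← tsum_mul_left, ← tsum_mul_left]
  refine tsum_congr fun k => ?_
  have := latCoef_lin hα hb φ f k
  rw [this, rescH]
  simp only [lin, Matrix.mulVec_sub, Matrix.mulVec_smul]
  ring

variable {b : Matrix (Fin d) (Fin d) ℝ} {φ f : (Fin d → ℝ) → ℂ}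

lemma integrable_bsamp (hb : b.det ≠ 0) (hφ : IsWindow (lin b φ)) {a : ℝ} (ha : a ≠ 0)
    (hf : Integrable f) {v : 𝕏 → ℂ} (hv : Integrable v) : Integrable (bsamp b a φ f v) :=
  integrable_lin (det_inv_ne_zero hb)
    (integrable_samp hφ ha (integrable_lin hb hf) (integrable_lin hb hv))

lemma bsamp_conv_ae_eq (hb : b.det ≠ 0) (hφ : IsWindow (lin b φ)) {a : ℝ} (ha : a ≠ 0)
    (hf : Integrable f) {v : 𝕏 → ℂ} (hv : Integrable v) (hv0 : ∀ η, ft φ η = 0 → ft v η = 0) :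
    bsamp b a φ f v =ᵐ[volume] conv f (dil a (conv v (adj φ))) := by
  have h1 : ∀ η, ft (lin b φ) η = 0 → ft (lin b v) η = 0 := by
    intro η
    have e : (η ᵥ* b⁻¹) ᵥ* b = η := by
      rw [Matrix.vecMul_vecMul, Matrix.nonsing_inv_mul b (isUnit_iff_ne_zero.2 hb),
        Matrix.vecMul_one]
    rw [← e, ft_lin hb, ft_lin hb]
    exact hv0 _
  have h2 := lin_congr_ae (det_inv_ne_zero hb)
    (samp_conv_ae_eq hφ ha (integrable_lin hb hf) (integrable_lin hb hv) h1)
  rwa [adj_lin, conv_lin hb, dil_lin, conv_lin hb, lin_inv_lin hb] at h2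

lemma ft_bsamp (hb : b.det ≠ 0) (hφ : IsWindow (lin b φ)) {a : ℝ} (ha : a ≠ 0)
    (hf : Integrable f) (ξ : 𝕏) : ∃ m : ℂ, ∀ v : 𝕏 → ℂ, Integrable v →
      ft (bsamp b a φ f v) ξ = m * ft v (a⁻¹ • ξ) := by
  refine ⟨latSymbol (latCoef (lin b φ) (dil a⁻¹ (lin b f))) ((a⁻¹ • ξ) ᵥ* b), fun v hv => ?_⟩
  rw [← ft_lin hb, lin_bsamp hb, samp, ft_dil ha, ft_latSum (hφ.summable
    (integrable_dil (inv_ne_zero ha) (integrable_lin hb hf))) (integrable_lin hb hv),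
    ← Matrix.smul_vecMul, ft_lin hb]

lemma lintegral_bsamp (hb : b.det ≠ 0) (a : ℝ) (φ f v : 𝕏 → ℂ) :
    ∫⁻ x, ‖bsamp b a φ f v x‖ₑ = ∫⁻ x, ‖samp a (lin b φ) (lin b f) (lin b v) x‖ₑ :=
  lintegral_lin (det_inv_ne_zero hb) _

lemma meanSize_bsamp (hb : b.det ≠ 0) (α : ℕ → ℝ) (σ : ℕ → ℂ) (φ f v : 𝕏 → ℂ) :
    (meanSize fun j x => σ j * bsamp b (α j) φ f v x) =
      meanSize fun j x => σ j * samp (α j) (lin b φ) (lin b f) (lin b v) x := by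
  funext J
  unfold meanSize
  congr 1
  rw [← lintegral_lin (det_inv_ne_zero hb) fun x => ∑ j ∈ Finset.range J,
    σ j * samp (α j) (lin b φ) (lin b f) (lin b v) x]
  refine lintegral_congr fun x => ?_
  simp only [bsamp, lin, Finset.mul_sum]
  congr 1
  refine Finset.sum_congr rfl fun j _ => ?_
  ring

end LinearChange

section Smoothing

variable {d : ℕ}

local notation "𝕏" => Fin d → ℝ
local notation "ℤℤ" => Fin d → ℤ

lemma ft_translate (f : 𝕏 → ℂ) (y ξ : 𝕏) :
    ft (fun x => f (x - y)) ξ = expChar (-ξ) y * ft f ξ := by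
  rw [ft_eq_expChar, ft_eq_expChar, ← integral_const_mul,
    ← integral_sub_right_eq_self (fun x => expChar (-ξ) y * (expChar (-ξ) x * f x)) y]
  refine integral_congr_ae (ae_of_all _ fun x => ?_)
  simp only []
  rw [← mul_assoc, ← expChar_add, add_sub_cancel]

lemma RieszPair.translate {i : Fin d} {f g : 𝕏 → ℂ} (h : RieszPair i f g) (y : 𝕏) :
    RieszPair i (fun x => f (x - y)) (fun x => g (x - y)) := by
  intro ξ
  rw [ft_translate, ft_translate]
  linear_combination (expChar (-ξ) y) * h ξ

/-- The Fourier transform at a point as a functional on `L¹`. -/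
def ftLp (ξ : Fin d → ℝ) : Lp ℂ 1 (volume : Measure (Fin d → ℝ)) →L[ℂ] ℂ :=
  LinearMap.mkContinuous
    { toFun := fun u => ft u ξ
      map_add' := fun u v => by
        rw [ft_congr_ae (Lp.coeFn_add u v)]
        exact ft_add (L1.integrable_coeFn u) (L1.integrable_coeFn v) ξ
      map_smul' := fun c u => by
        rw [ft_congr_ae (Lp.coeFn_smul c u)]
        exact ft_const_mul c u ξ } 1
    fun u => by
      rw [one_mul, L1.norm_eq_integral_norm]
      exact norm_ft_le u ξ

lemma ftLp_apply (ξ : 𝕏) (u : Lp ℂ 1 (volume : Measure 𝕏)) : ftLp ξ u = ft u ξ := rfl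

lemma norm_toL1_eq_integral_norm {f : 𝕏 → ℂ} (hf : Integrable f) :
    ‖hf.toL1 f‖ = ∫ x, ‖f x‖ := by
  rw [L1.norm_eq_integral_norm]
  exact integral_congr_ae (hf.coeFn_toL1.fun_comp norm)

/-- Linear growth of subadditive functions bounded near the origin. -/
lemma le_of_subadditive {E : Type*} [NormedAddCommGroup E] [NormedSpace ℝ E] {N : E → ℝ}
    (h : ∀ x y, N (x + y) ≤ N x + N y) {δ : ℝ} (hδ : 0 < δ) (h1 : ∀ x, ‖x‖ < δ → N x ≤ 1) (x : E) :
    N x ≤ 1 + ‖x‖ / δ := by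
  have h2 : ∀ (n : ℕ) (t : E), N ((n + 1) • t) ≤ (n + 1) * N t := by
    intro n t
    induction n with
    | zero => simp
    | succ n ih =>
      rw [succ_nsmul]
      push_cast
      linarith [h ((n + 1) • t) t]
  set n := ⌊‖x‖ / δ⌋₊ with hn
  have hn1 : ‖x‖ / δ < n + 1 := Nat.lt_floor_add_one _
  have hn2 : (n : ℝ) ≤ ‖x‖ / δ := Nat.floor_le (by positivity)
  have hx : (n + 1) • (((n : ℝ) + 1)⁻¹ • x) = x := by
    rw [← Nat.cast_smul_eq_nsmul ℝ, smul_smul]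
    push_cast
    rw [mul_inv_cancel₀ (by positivity), one_smul]
  have h3 := h2 n (((n : ℝ) + 1)⁻¹ • x)
  rw [hx] at h3
  have h4 : N (((n : ℝ) + 1)⁻¹ • x) ≤ 1 := by
    refine h1 _ ?_
    rw [norm_smul, norm_inv, Real.norm_of_nonneg (by positivity), inv_mul_lt_iff₀ (by positivity)]
    rw [div_lt_iff₀ hδ] at hn1
    linarith
  nlinarith

/-- If differences of `ψ` have small integrable Riesz transforms, then subtracting a mollification
from `ψ` gives a function with an integrable Riesz transform. -/
theorem exists_rieszPair_sub_conv {i : Fin d} {ψ : 𝕏 → ℂ} (hψ : Integrable ψ)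
    (h : ∀ ε : ℝ, 0 < ε → ∃ δ : ℝ, 0 < δ ∧ ∀ y : 𝕏, ‖y‖ < δ → ∃ g : 𝕏 → ℂ, Integrable g ∧
      RieszPair i (fun x => ψ x - ψ (x - y)) g ∧ ∫ x, ‖g x‖ < ε)
    (Φ : SchwartzMap (Fin d → ℝ) ℂ) (hΦ : ∫ x, Φ x = 1) :
    ∃ r : 𝕏 → ℂ, Integrable r ∧ RieszPair i (fun x => ψ x - conv ψ Φ x) r := by
  have hD : ∀ y, Integrable fun x => ψ x - ψ (x - y) := fun y => hψ.sub (hψ.comp_sub_right y)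
  have hsplit : ∀ {y t : 𝕏} {g g' : 𝕏 → ℂ}, Integrable g → Integrable g' →
      RieszPair i (fun x => ψ x - ψ (x - y)) g → RieszPair i (fun x => ψ x - ψ (x - t)) g' →
      RieszPair i (fun x => ψ x - ψ (x - (y + t))) (fun x => g x + g' (x - y)) := by
    intro y t g g' hg hg' h1 h2
    have h3 := h1.add (h2.translate y) (hD y) hg ((hD t).comp_sub_right y) (hg'.comp_sub_right y)
    convert h3 using 2 with x
    simp only [sub_sub]
    ring
  have hex : ∀ y : 𝕏, ∃ g : 𝕏 → ℂ, Integrable g ∧ RieszPair i (fun x => ψ x - ψ (x - y)) g := by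
    obtain ⟨δ, hδ, h1⟩ := h 1 one_pos
    intro y
    have h2 : ∀ (n : ℕ) (t : 𝕏), ‖t‖ < δ →
        ∃ g : 𝕏 → ℂ, Integrable g ∧ RieszPair i (fun x => ψ x - ψ (x - (n + 1) • t)) g := by
      intro n t ht
      obtain ⟨g', hg', hr', -⟩ := h1 t ht
      induction n with
      | zero => exact ⟨g', hg', by simpa using hr'⟩
      | succ n ih =>
        obtain ⟨g, hg, hr⟩ := ih
        refine ⟨_, hg.add (hg'.comp_sub_right ((n + 1) • t)), ?_⟩
        rw [succ_nsmul]
        exact hsplit hg hg' hr hr'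
    obtain ⟨n, hn⟩ := exists_nat_gt (‖y‖ / δ)
    have hx : (n + 1) • (((n : ℝ) + 1)⁻¹ • y) = y := by
      rw [← Nat.cast_smul_eq_nsmul ℝ, smul_smul]
      push_cast
      rw [mul_inv_cancel₀ (by positivity), one_smul]
    rw [← hx]
    refine h2 n _ ?_
    rw [norm_smul, norm_inv, Real.norm_of_nonneg (by positivity), inv_mul_lt_iff₀ (by positivity)]
    rw [div_lt_iff₀ hδ] at hn
    nlinarith
  choose g hg hr using hex
  set G : 𝕏 → Lp ℂ 1 (volume : Measure 𝕏) := fun y => (hg y).toL1 (g y) with hG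
  have hGn : ∀ y, ‖G y‖ = ∫ x, ‖g y x‖ := fun y => by
    rw [hG, norm_toL1_eq_integral_norm]
  have hGadd : ∀ y t, ‖G (y + t) - G y‖ = ‖G t‖ := by
    intro y t
    have h1 := RieszPair.unique (hr (y + t)) (hsplit (hg y) (hg t) (hr y) (hr t)) (hg _)
      ((hg y).add ((hg t).comp_sub_right y))
    rw [hG]
    simp only []
    rw [← Integrable.toL1_sub, norm_toL1_eq_integral_norm,
      norm_toL1_eq_integral_norm,
      ← integral_sub_right_eq_self (fun x => ‖g t x‖) y]
    refine integral_congr_ae ?_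
    filter_upwards [h1] with x hx
    rw [Pi.sub_apply, hx, add_sub_cancel_left]
  have hsmall : ∀ ε : ℝ, 0 < ε → ∃ δ : ℝ, 0 < δ ∧ ∀ y : 𝕏, ‖y‖ < δ → ‖G y‖ < ε := by
    intro ε hε
    obtain ⟨δ, hδ, h1⟩ := h ε hε
    refine ⟨δ, hδ, fun y hy => ?_⟩
    obtain ⟨g', hg', hr', hlt⟩ := h1 y hy
    rw [hGn]
    refine lt_of_eq_of_lt (integral_congr_ae ?_) hlt
    filter_upwards [RieszPair.unique (hr y) hr' (hg y) hg'] with x hx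
    rw [hx]
  have hcont : Continuous G := by
    refine Metric.continuous_iff.2 fun y ε hε => ?_
    obtain ⟨δ, hδ, h1⟩ := hsmall ε hε
    refine ⟨δ, hδ, fun z hz => ?_⟩
    rw [dist_eq_norm] at hz ⊢
    have := hGadd y (z - y)
    rw [add_sub_cancel] at this
    rw [this]
    exact h1 _ hz
  obtain ⟨δ, hδ, hδ1⟩ := hsmall 1 one_pos
  have hgrow : ∀ y, ‖G y‖ ≤ 1 + ‖y‖ / δ := le_of_subadditive (fun y t => by
    have := norm_add_le (G (y + t) - G y) (G y)
    rw [hGadd, sub_add_cancel] at this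
    linarith) hδ fun y hy => (hδ1 y hy).le
  have hint : Integrable fun y => Φ y • G y := by
    have h1 : Integrable fun y : 𝕏 => ‖Φ y‖ + (‖y‖ ^ 1 * ‖Φ y‖) / δ :=
      Φ.integrable.norm.add ((Φ.integrable_pow_mul volume 1).div_const δ)
    refine h1.mono' (Φ.continuous.smul hcont).aestronglyMeasurable (ae_of_all _ fun y => ?_)
    rw [norm_smul]
    have := mul_le_mul_of_nonneg_left (hgrow y) (norm_nonneg (Φ y))
    refine this.trans (le_of_eq ?_)
    ring
  refine ⟨(∫ y, Φ y • G y : Lp ℂ 1 (volume : Measure 𝕏)), L1.integrable_coeFn _, fun ξ => ?_⟩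
  have hΦi := Φ.integrable (μ := volume)
  rw [← ftLp_apply, ← ContinuousLinearMap.integral_comp_comm _ hint,
    ft_sub hψ (integrable_conv hψ hΦi), ft_conv hψ hΦi, ← integral_const_mul]
  have e : ∀ y, (eucNorm ξ : ℂ) * ftLp ξ (Φ y • G y) =
      (-Complex.I * (ξ i : ℂ) * ft ψ ξ) * (Φ y - expChar (-ξ) y * Φ y) := by
    intro y
    have h1 := hr y ξ
    rw [ft_sub hψ (hψ.comp_sub_right y), ft_translate] at h1
    rw [map_smul, ftLp_apply, hG, ft_congr_ae (hg y).coeFn_toL1, smul_eq_mul]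
    linear_combination (Φ y) * h1
  simp_rw [e]
  have hei := integrable_expChar_mul hΦi (-ξ)
  rw [integral_const_mul, integral_sub hΦi hei, hΦ, ← ft_eq_expChar]
  ring

end Smoothing

section Assembly

variable {d : ℕ}

local notation "𝕏" => Fin d → ℝ
local notation "ℤℤ" => Fin d → ℤ

lemma continuous_eucNorm : Continuous (eucNorm : 𝕏 → ℝ) := by
  unfold eucNorm
  fun_prop

lemma RieszPair.congr_ae {i : Fin d} {f f' g : 𝕏 → ℂ} (h : RieszPair i f g)
    (hf : f =ᵐ[volume] f') : RieszPair i f' g := by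
  intro ξ
  rw [← ft_congr_ae hf]
  exact h ξ

lemma RieszPair.sum {i : Fin d} {f g : ℕ → 𝕏 → ℂ} (h : ∀ j, RieszPair i (f j) (g j))
    (hf : ∀ j, Integrable (f j)) (hg : ∀ j, Integrable (g j)) (J : ℕ) :
    RieszPair i (fun x => ∑ j ∈ Finset.range J, f j x) (fun x => ∑ j ∈ Finset.range J, g j x) := by
  induction J with
  | zero => intro ξ; simp [ft]
  | succ J ih =>
    simp_rw [Finset.sum_range_succ]
    exact ih.add (h J) (integrable_finsetSum _ fun j _ => hf j)
      (integrable_finsetSum _ fun j _ => hg j) (hf J) (hg J)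

lemma RieszPair.conv {i : Fin d} {f g K : 𝕏 → ℂ} (h : RieszPair i f g) (hf : Integrable f)
    (hg : Integrable g) (hK : Integrable K) :
    RieszPair i (AffinePaper.conv f K) (AffinePaper.conv g K) := by
  intro ξ
  rw [ft_conv hf hK, ft_conv hg hK]
  linear_combination (ft K ξ) * h ξ

lemma RieszPair.bsamp {i : Fin d} {b : Matrix (Fin d) (Fin d) ℝ} {φ f v r : 𝕏 → ℂ}
    (h : RieszPair i v r) (hb : b.det ≠ 0) (hφ : IsWindow (lin b φ)) {a : ℝ} (ha : a ≠ 0)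
    (hf : Integrable f) (hv : Integrable v) (hr : Integrable r) :
    RieszPair i (AffinePaper.bsamp b a φ f v)
      (fun x => ((SignType.sign a : ℝ) : ℂ) * AffinePaper.bsamp b a φ f r x) := by
  intro ξ
  obtain ⟨m, hm⟩ := ft_bsamp hb hφ ha hf ξ
  have h1 := h.dil ha ξ
  rw [ft_const_mul, ft_dil ha, ft_dil ha] at h1
  rw [ft_const_mul, hm v hv, hm r hr]
  linear_combination m * h1

lemma integrable_pi {G : Fin d → 𝕏 → ℂ} (hG : ∀ i, Integrable (G i)) :
    Integrable fun x i => G i x := Integrable.of_eval hG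

lemma memH1_of_rieszPair {F : 𝕏 → ℂ} {G : Fin d → 𝕏 → ℂ} (hF : Integrable F)
    (hG : ∀ i, Integrable (G i)) (h : ∀ i, RieszPair i F (G i)) : MemH1 F :=
  ⟨hF, _, integrable_pi hG, (hasRiesz_iff hF (integrable_pi hG)).2 h⟩

lemma hardyNorm_le {F : 𝕏 → ℂ} {G : Fin d → 𝕏 → ℂ} (hF : Integrable F)
    (hG : ∀ i, Integrable (G i)) (h : ∀ i, RieszPair i F (G i)) :
    hardyNorm F ≤ (∫⁻ x, ‖F x‖ₑ) + ∑ i, ∫⁻ x, ‖G i x‖ₑ := by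
  unfold hardyNorm
  rw [ofReal_integral_norm_eq_lintegral_enorm hF]
  refine add_le_add le_rfl (sInf_le_of_le
    ⟨_, integrable_pi hG, (hasRiesz_iff hF (integrable_pi hG)).2 h, rfl⟩ ?_)
  rw [ofReal_integral_norm_eq_lintegral_enorm (integrable_pi hG),
    ← lintegral_finsetSum' _ fun i _ => (hG i).1.enorm]
  refine lintegral_mono fun x => ?_
  rw [← ofReal_norm, ← ENNReal.ofReal_toReal (a := ∑ i, ‖G i x‖ₑ)
    (ENNReal.sum_ne_top.2 fun i _ => enorm_ne_top)]
  refine ENNReal.ofReal_le_ofReal ((pi_norm_le_iff_of_nonneg ENNReal.toReal_nonneg).2 fun i => ?_)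
  rw [ENNReal.toReal_sum fun i _ => enorm_ne_top]
  simp only [toReal_enorm]
  exact Finset.single_le_sum (f := fun i => ‖G i x‖) (fun i _ => norm_nonneg _) (Finset.mem_univ i)

/-- The error of approximation by sampling at scale `j`, split into the contribution of a
synthesizer `v` of mean zero and that of an approximate identity `K`. -/
def samplingErr (b : Matrix (Fin d) (Fin d) ℝ) (α : ℕ → ℝ) (σ : ℕ → ℂ)
    (φ f v K g : (Fin d → ℝ) → ℂ) (j : ℕ) (x : Fin d → ℝ) : ℂ :=
  σ j * bsamp b (α j) φ f v x + (conv g (dil (α j) K) x - g x)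

section Err

variable {b : Matrix (Fin d) (Fin d) ℝ} {α : ℕ → ℝ} {σ : ℕ → ℂ} {φ f v K g : (Fin d → ℝ) → ℂ}

lemma integrable_conv_dil_sub (hα0 : ∀ j, α j ≠ 0) (hK : Integrable K) (hg : Integrable g)
    (j : ℕ) : Integrable fun x => conv g (dil (α j) K) x - g x :=
  (integrable_conv hg (integrable_dil (hα0 j) hK)).sub hg

lemma integrable_samplingErr (hb : b.det ≠ 0) (hφ : IsWindow (lin b φ)) (hα0 : ∀ j, α j ≠ 0)
    (hf : Integrable f) (hv : Integrable v) (hK : Integrable K) (hg : Integrable g) (j : ℕ) :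
    Integrable (samplingErr b α σ φ f v K g j) :=
  ((integrable_bsamp hb hφ (hα0 j) hf hv).const_mul _).add (integrable_conv_dil_sub hα0 hK hg j)

lemma enorm_mul_le_of_norm_le_one {c : ℂ} (hc : ‖c‖ ≤ 1) (z : ℂ) : ‖c * z‖ₑ ≤ ‖z‖ₑ := by
  rw [enorm_mul]
  refine mul_le_of_le_one_left' ?_
  rw [← ofReal_norm]
  exact ENNReal.ofReal_le_one.2 hc

lemma tendsto_samplingErr (hb : b.det ≠ 0) (hφ : IsWindow (lin b φ)) (hα0 : ∀ j, α j ≠ 0)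
    (hα : Tendsto (fun j => (α j)⁻¹) atTop (𝓝 0)) (hσ : ∀ j, ‖σ j‖ ≤ 1)
    (hf : Integrable f) (hv : Integrable v) (hK : Integrable K) (hK1 : ∫ x, K x = 1)
    (hg : Integrable g) (hv0 : ∀ᵐ x, latPer (lin b v) x = 0) :
    Tendsto (fun j => ∫⁻ x, ‖samplingErr b α σ φ f v K g j x‖ₑ) atTop (𝓝 0) := by
  have h1 := tendsto_samp_zero hφ (integrable_lin hb hf) (integrable_lin hb hv) hv0 hα0 hα
  have h2 := tendsto_conv_dil hg hK hα0 hα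
  simp only [hK1, one_mul] at h2
  simp_rw [← lintegral_bsamp hb] at h1
  have h3 := h1.add h2
  rw [add_zero] at h3
  refine tendsto_of_tendsto_of_tendsto_of_le_of_le tendsto_const_nhds h3 (fun _ => zero_le)
    fun j => ?_
  simp only []
  rw [← lintegral_add_left' (integrable_bsamp hb hφ (hα0 j) hf hv).1.enorm]
  refine lintegral_mono fun x => (enorm_add_le _ _).trans ?_
  gcongr
  exact enorm_mul_le_of_norm_le_one (hσ j) _

lemma tendsto_meanSize_samplingErr (hb : b.det ≠ 0) (hφ : IsWindow (lin b φ))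
    (hα0 : ∀ j, α j ≠ 0) (hα : Tendsto (fun j => |α j|) atTop atTop)
    (hα' : Tendsto (fun j => (α j)⁻¹) atTop (𝓝 0)) (hl : Lacunary α) (hσ : ∀ j, ‖σ j‖ ≤ 1)
    (hf : Integrable f) (hv : Integrable v) (hK : Integrable K) (hK1 : ∫ x, K x = 1)
    (hg : Integrable g) (hv0 : ft v 0 = 0) :
    Tendsto (meanSize (samplingErr b α σ φ f v K g)) atTop (𝓝 0) := by
  have h0 : ft (lin b v) 0 = 0 := by rw [ft_zero_eq, integral_lin hb, ← ft_zero_eq, hv0]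
  have h1 := tendsto_mean_samp hφ (integrable_lin hb hf) (integrable_lin hb hv) h0 hl hα0 hα hα' hσ
  have h2 := tendsto_conv_dil hg hK hα0 hα'
  simp only [hK1, one_mul] at h2
  rw [← meanSize_bsamp hb] at h1
  have h3 := h1.add (tendsto_meanSize (integrable_conv_dil_sub hα0 hK hg) h2)
  rw [add_zero] at h3
  exact tendsto_of_tendsto_of_tendsto_of_le_of_le tendsto_const_nhds h3 (fun _ => zero_le)
    fun J => meanSize_add_le
      (fun j => ((integrable_bsamp hb hφ (hα0 j) hf hv).const_mul (σ j)).1) _ J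

lemma latPer_lin_ae_eq_zero (hb : b.det ≠ 0) (hv : Integrable v) (h0 : ft v 0 = 0)
    (h : ∀ l : ℤℤ, l ≠ 0 → ft v (intVec l ᵥ* b⁻¹) = 0) : ∀ᵐ x, latPer (lin b v) x = 0 := by
  have h1 := latPer_ae_eq (integrable_lin hb hv) fun l hl => by
    have e : (intVec l ᵥ* b⁻¹) ᵥ* b = intVec l := by
      rw [Matrix.vecMul_vecMul, Matrix.nonsing_inv_mul b (isUnit_iff_ne_zero.2 hb),
        Matrix.vecMul_one]
    rw [← e, ft_lin hb]
    exact h l hl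
  rwa [ft_zero_eq, integral_lin hb, ← ft_zero_eq, h0] at h1

end Err

/-- Sampling with `ψ` splits into sampling with a function `h` having integrable Riesz transforms
and convolution with an approximate identity. -/
theorem exists_sampling_decomposition {b : Matrix (Fin d) (Fin d) ℝ} (hb : b.det ≠ 0)
    {ψ : 𝕏 → ℂ} (hψ : Integrable ψ) (hint : ∫ x, ψ x = 1)
    (hcont : ∀ ε : ℝ, 0 < ε → ∃ δ : ℝ, 0 < δ ∧ ∀ y : Fin d → ℝ, eucNorm y < δ →
      ∃ g : (Fin d → ℝ) → Fin d → ℂ, Integrable g volume ∧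
        HasRiesz (fun x => ψ x - ψ (x - y)) g ∧
        (∫ x : Fin d → ℝ, ‖ψ x - ψ (x - y)‖) + (∫ x : Fin d → ℝ, ‖g x‖) < ε)
    {φ : 𝕏 → ℂ} (hφS : IsSchwartz φ) (hφint : ∫ x, φ x = 1) (hφ : IsWindow (lin b φ)) :
    ∃ (h : 𝕏 → ℂ) (r : Fin d → 𝕏 → ℂ) (K : 𝕏 → ℂ), Integrable h ∧ (∀ i, Integrable (r i)) ∧
      Integrable K ∧ ∫ x, K x = 1 ∧ (∀ i, RieszPair i h (r i)) ∧
      (∀ ξ, ft h ξ = ft ψ ξ * (1 - ft φ ξ)) ∧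
      ∀ (f : 𝕏 → ℂ) (a : ℝ), Integrable f → a ≠ 0 → bsamp b a φ f ψ =ᵐ[volume]
        fun x => bsamp b a φ f h x + conv f (dil a K) x := by
  obtain ⟨Φ, hΦ⟩ := hφS
  obtain rfl : φ = Φ := funext hΦ
  have hΦi := Φ.integrable (μ := volume)
  have hc : ∀ i : Fin d, ∀ ε : ℝ, 0 < ε → ∃ δ : ℝ, 0 < δ ∧ ∀ y : 𝕏, ‖y‖ < δ →
      ∃ g : 𝕏 → ℂ, Integrable g ∧ RieszPair i (fun x => ψ x - ψ (x - y)) g ∧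
        ∫ x, ‖g x‖ < ε := by
    intro i ε hε
    obtain ⟨δ, hδ, h1⟩ := hcont ε hε
    have h2 : Tendsto (eucNorm : 𝕏 → ℝ) (𝓝 0) (𝓝 0) := by
      have := (continuous_eucNorm (d := d)).tendsto 0
      rwa [show eucNorm (0 : 𝕏) = 0 by simp [eucNorm]] at this
    obtain ⟨δ', hδ', h3⟩ := Metric.eventually_nhds_iff.1 (h2.eventually (gt_mem_nhds hδ))
    refine ⟨δ', hδ', fun y hy => ?_⟩
    obtain ⟨g, hg, hr, hlt⟩ := h1 y (h3 (by rwa [dist_zero_right]))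
    refine ⟨fun x => g x i, hg.eval i,
      (hasRiesz_iff (hψ.sub (hψ.comp_sub_right y)) hg).1 hr i, ?_⟩
    have h4 : ∫ x, ‖g x i‖ ≤ ∫ x, ‖g x‖ :=
      integral_mono (hg.eval i).norm hg.norm fun x => norm_le_pi_norm (g x) i
    have h5 : 0 ≤ ∫ x, ‖ψ x - ψ (x - y)‖ := integral_nonneg fun x => norm_nonneg _
    linarith
  choose r hr hrp using fun i => exists_rieszPair_sub_conv hψ (hc i) Φ hφint
  have hv := integrable_conv hψ hΦi
  have hA := integrable_adj hΦi
  have hfth : ∀ ξ, ft (fun x => ψ x - conv ψ Φ x) ξ = ft ψ ξ * (1 - ft Φ ξ) := fun ξ => by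
    rw [ft_sub hψ hv, ft_conv hψ hΦi]
    ring
  refine ⟨fun x => ψ x - conv ψ Φ x, r, conv (conv ψ Φ) (adj Φ), hψ.sub hv, hr, integrable_conv hv hA, ?_, hrp, hfth,
    fun f a hf ha => ?_⟩
  · rw [← ft_zero_eq, ft_conv hv hA, ft_conv hψ hΦi, ft_adj, ft_zero_eq, ft_zero_eq, hint, hφint]
    simp
  · have h1 := bsamp_conv_ae_eq hb hφ ha hf hv fun η hη => by
      rw [ft_conv hψ hΦi, hη, mul_zero]
    have hh : Integrable fun x => ψ x - conv ψ Φ x := hψ.sub hv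
    have i1 := integrable_bsamp hb hφ ha hf hh
    have i2 := integrable_bsamp hb hφ ha hf hv
    have h2 : bsamp b a Φ f ψ =ᵐ[volume]
        fun x => bsamp b a Φ f (fun x => ψ x - conv ψ Φ x) x + bsamp b a Φ f (conv ψ Φ) x := by
      refine ae_eq_of_ft_eq (integrable_bsamp hb hφ ha hf hψ) (i1.add i2) (funext fun ξ => ?_)
      obtain ⟨m, hm⟩ := ft_bsamp hb hφ ha hf ξ
      rw [ft_add i1 i2, hm _ hψ, hm _ hh, hm _ hv, ft_sub hψ hv]
      ring
    filter_upwards [h1, h2] with x e1 e2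
    rw [e2, e1]

end Assembly

/-- Theorem: scale-averaged approximation in `H¹`.
Isotropic expanding dilations `a_j = α_j I`, `|α_j| → ∞`.  Assume `ψ ∈ L¹`, `∫ ψ = 1`,
`‖ψ - ψ(·-y)‖_{H¹} → 0` as `y → 0`; assume `φ` is Schwartz with `φ̂` supported in
`C₀ b⁻¹` and `∫ φ = 1`.  Let `f ∈ H¹`.
(a) If `Pψ = 1` a.e. then `S_j T_j f → f` in `H¹` as `j → ∞`.
(b) If the dilations expand exponentially then `(1/J) Σ_{j<J} S_j T_j f → f` in `H¹`. -/
theorem statement15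
    (d : ℕ) (b : Matrix (Fin d) (Fin d) ℝ) (hb : b.det ≠ 0)
    (α : ℕ → ℝ) (hα : ∀ j, α j ≠ 0) (hαtop : Tendsto (fun j => |α j|) atTop atTop)
    (ψ : (Fin d → ℝ) → ℂ) (hψ : Integrable ψ volume)
    (hint : ∫ x : Fin d → ℝ, ψ x = 1)
    (hcont : ∀ ε : ℝ, 0 < ε → ∃ δ : ℝ, 0 < δ ∧ ∀ y : Fin d → ℝ, eucNorm y < δ →
      ∃ g : (Fin d → ℝ) → Fin d → ℂ, Integrable g volume ∧
        HasRiesz (fun x => ψ x - ψ (x - y)) g ∧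
        (∫ x : Fin d → ℝ, ‖ψ x - ψ (x - y)‖) + (∫ x : Fin d → ℝ, ‖g x‖) < ε)
    (φ : (Fin d → ℝ) → ℂ) (hφS : IsSchwartz φ)
    (hφsupp : Function.support (ft φ) ⊆ {ξ : Fin d → ℝ | ξ ᵥ* b ∈ centeredCube d})
    (hφint : ∫ x : Fin d → ℝ, φ x = 1)
    (f : (Fin d → ℝ) → ℂ) (hf : MemH1 f) :
    ((∀ᵐ x : Fin d → ℝ,
        ((|b.det| : ℝ) : ℂ) * ∑' k : Fin d → ℤ, ψ (x - b *ᵥ intVec k) = 1) →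
      (∀ j : ℕ, MemH1 (fun x =>
          ∑' k : Fin d → ℤ, TjH α b φ f j k * rescH α b ψ j k x)) ∧
      Tendsto (fun j : ℕ => hardyNorm (fun x =>
          (∑' k : Fin d → ℤ, TjH α b φ f j k * rescH α b ψ j k x) - f x))
        atTop (𝓝 0)) ∧
    ((∃ δ : ℝ, 0 < δ ∧ δ < 1 ∧ ∀ j : ℕ, |α j| ≤ δ * |α (j + 1)|) →
      (∀ j : ℕ, MemH1 (fun x =>
          ∑' k : Fin d → ℤ, TjH α b φ f j k * rescH α b ψ j k x)) ∧
      Tendsto (fun J : ℕ => hardyNorm (fun x =>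
          (J : ℂ)⁻¹ * (∑ j ∈ Finset.range J,
            ∑' k : Fin d → ℤ, TjH α b φ f j k * rescH α b ψ j k x) - f x))
        atTop (𝓝 0)) := by
  have hwin := isWindow_lin hb hφS hφsupp hφint
  obtain ⟨h, r, K, hh, hr, hK, hK1, hrp, hfth, hdec⟩ :=
    exists_sampling_decomposition hb hψ hint hcont hφS hφint hwin
  obtain ⟨hfi, g, hg, hfg⟩ := hf
  have hgp := (hasRiesz_iff hfi hg).1 hfg
  have hgi : ∀ i, Integrable fun x => g x i := fun i => hg.eval i
  have hα' : Tendsto (fun j => (α j)⁻¹) atTop (𝓝 0) := by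
    rw [tendsto_zero_iff_abs_tendsto_zero]
    simpa [Function.comp_def, abs_inv] using tendsto_inv_atTop_zero.comp hαtop
  set σ : ℕ → ℂ := fun j => ((SignType.sign (α j) : ℝ) : ℂ) with hσ
  have hσ1 : ∀ j, ‖σ j‖ ≤ 1 := fun j => by
    rcases lt_or_gt_of_ne (hα j) with h | h
    · simp [hσ, sign_neg h]
    · simp [hσ, sign_pos h]
  have h1 : ∀ _ : ℕ, ‖(1 : ℂ)‖ ≤ 1 := fun _ => norm_one.le
  have hh0 : ft h 0 = 0 := by rw [hfth, ft_zero_eq φ, hφint, sub_self, mul_zero]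
  have hr0 : ∀ i, ft (r i) 0 = 0 := fun i => (hrp i).ft_zero hh (hr i) hh0
  have hE : ∀ j, (fun x => ∑' k : Fin d → ℤ, TjH α b φ f j k * rescH α b ψ j k x) =
      bsamp b (α j) φ f ψ := fun j => bsamp_eq (hα j) hb φ f ψ
  have hE' : ∀ j x, ∑' k : Fin d → ℤ, TjH α b φ f j k * rescH α b ψ j k x =
      bsamp b (α j) φ f ψ x := fun j => congrFun (hE j)
  set e := samplingErr b α (fun _ => 1) φ f h K f with he
  set e' := fun i => samplingErr b α σ φ f (r i) K (fun x => g x i) with he'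
  have hei : ∀ j, Integrable (e j) := integrable_samplingErr hb hwin hα hfi hh hK hfi
  have hei' : ∀ i j, Integrable (e' i j) := fun i =>
    integrable_samplingErr hb hwin hα hfi (hr i) hK (hgi i)
  have hEe : ∀ j, bsamp b (α j) φ f ψ =ᵐ[volume] fun x => e j x + f x := fun j => by
    filter_upwards [hdec f (α j) hfi (hα j)] with x hx
    rw [hx, he, samplingErr]
    ring
  have hpair : ∀ i j, RieszPair i (e j) (e' i j) := fun i j => by
    have hKj := integrable_dil (hα j) hK
    have p1 := (hrp i).bsamp hb hwin (hα j) hfi hh (hr i)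
    have p2 := ((hgp i).conv hfi (hgi i) hKj).sub (hgp i) (integrable_conv hfi hKj)
      (integrable_conv (hgi i) hKj) hfi (hgi i)
    have p3 := p1.add p2 (integrable_bsamp hb hwin (hα j) hfi hh)
      ((integrable_bsamp hb hwin (hα j) hfi (hr i)).const_mul _)
      (integrable_conv_dil_sub hα hK hfi j) (integrable_conv_dil_sub hα hK (hgi i) j)
    refine p3.congr_ae (ae_of_all _ fun x => ?_)
    simp only [he, samplingErr, one_mul]
  have hmem : ∀ j : ℕ, MemH1 (fun x =>
      ∑' k : Fin d → ℤ, TjH α b φ f j k * rescH α b ψ j k x) := fun j => by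
    rw [hE]
    exact memH1_of_rieszPair (integrable_bsamp hb hwin (hα j) hfi hψ)
      (fun i => (hei' i j).add (hgi i)) fun i =>
      ((hpair i j).add (hgp i) (hei j) (hei' i j) hfi (hgi i)).congr_ae (hEe j).symm
  refine ⟨fun hper => ⟨hmem, ?_⟩, fun hl => ⟨hmem, ?_⟩⟩
  · have hψ0 : ∀ l : Fin d → ℤ, l ≠ 0 → ft ψ (intVec l ᵥ* b⁻¹) = 0 := fun l hl => by
      rw [← ft_lin hb, Matrix.vecMul_vecMul, Matrix.nonsing_inv_mul b (isUnit_iff_ne_zero.2 hb),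
        Matrix.vecMul_one]
      refine ft_intVec_eq_zero (c := 1) (integrable_lin hb hψ) ?_ hl
      filter_upwards [(quasiMeasurePreserving_mulVec hb).ae hper] with u hu
      rw [← hu, latPer, ← tsum_mul_left]
      simp only [lin, Matrix.mulVec_sub]
    have hh0' : ∀ l : Fin d → ℤ, l ≠ 0 → ft h (intVec l ᵥ* b⁻¹) = 0 := fun l hl => by
      rw [hfth, hψ0 l hl, zero_mul]
    have hne : ∀ l : Fin d → ℤ, l ≠ 0 → intVec l ᵥ* b⁻¹ ≠ 0 := fun l hl h0 => by
      refine intVec_ne_zero hl ?_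
      rw [← Matrix.vecMul_one (intVec l), ← Matrix.nonsing_inv_mul b (isUnit_iff_ne_zero.2 hb),
        ← Matrix.vecMul_vecMul, h0, Matrix.zero_vecMul]
    have t1 : Tendsto (fun j => ∫⁻ x, ‖e j x‖ₑ) atTop (𝓝 0) :=
      tendsto_samplingErr hb hwin hα hα' h1 hfi hh hK hK1 hfi
        (latPer_lin_ae_eq_zero hb hh hh0 hh0')
    have t2 : ∀ i, Tendsto (fun j => ∫⁻ x, ‖e' i j x‖ₑ) atTop (𝓝 0) := fun i =>
      tendsto_samplingErr hb hwin hα hα' hσ1 hfi (hr i) hK hK1 (hgi i)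
        (latPer_lin_ae_eq_zero hb (hr i) (hr0 i) fun l hl =>
          (hrp i).ft_eq_zero (hne l hl) (hh0' l hl))
    have t3 := t1.add (tendsto_finsetSum Finset.univ fun i _ => t2 i)
    rw [Finset.sum_const_zero, add_zero] at t3
    refine tendsto_of_tendsto_of_tendsto_of_le_of_le tendsto_const_nhds t3 (fun _ => zero_le)
      fun j => ?_
    have hae : e j =ᵐ[volume] fun x => bsamp b (α j) φ f ψ x - f x := by
      filter_upwards [hEe j] with x hx
      rw [hx, add_sub_cancel_right]
    simp only [hE']
    refine (hardyNorm_le ((integrable_bsamp hb hwin (hα j) hfi hψ).sub hfi) (fun i => hei' i j)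
      fun i => (hpair i j).congr_ae hae).trans_eq ?_
    congr 1
    exact lintegral_congr_ae (hae.symm.fun_comp enorm)
  · have t1 : Tendsto (meanSize e) atTop (𝓝 0) :=
      tendsto_meanSize_samplingErr hb hwin hα hαtop hα' hl h1 hfi hh hK hK1 hfi hh0
    have t2 : ∀ i, Tendsto (meanSize (e' i)) atTop (𝓝 0) := fun i =>
      tendsto_meanSize_samplingErr hb hwin hα hαtop hα' hl hσ1 hfi (hr i) hK hK1 (hgi i) (hr0 i)
    have t3 := t1.add (tendsto_finsetSum Finset.univ fun i _ => t2 i)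
    rw [Finset.sum_const_zero, add_zero] at t3
    refine tendsto_of_tendsto_of_tendsto_of_le_of_le' tendsto_const_nhds t3
      (Eventually.of_forall fun _ => zero_le) ?_
    filter_upwards [eventually_gt_atTop 0] with J hJ
    have hJ0 : (J : ℂ) ≠ 0 := by exact_mod_cast hJ.ne'
    have hJe : ‖(J : ℂ)⁻¹‖ₑ = (J : ℝ≥0∞)⁻¹ := by
      rw [enorm_inv hJ0]
      simp [enorm_eq_nnnorm]
    have hae : (fun x => (J : ℂ)⁻¹ * ∑ j ∈ Finset.range J, e j x) =ᵐ[volume]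
        fun x => (J : ℂ)⁻¹ * (∑ j ∈ Finset.range J, bsamp b (α j) φ f ψ x) - f x := by
      filter_upwards [ae_all_iff.2 hEe] with x hx
      simp_rw [hx]
      rw [Finset.sum_add_distrib, Finset.sum_const, Finset.card_range, nsmul_eq_mul, mul_add,
        inv_mul_cancel_left₀ hJ0, add_sub_cancel_right]
    have hmean : ∀ u : ℕ → (Fin d → ℝ) → ℂ,
        ∫⁻ x, ‖(J : ℂ)⁻¹ * ∑ j ∈ Finset.range J, u j x‖ₑ = meanSize u J := fun u => by
      simp_rw [enorm_mul]
      rw [lintegral_const_mul' _ _ enorm_ne_top, hJe, meanSize]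
    simp only [hE']
    have hsum : Integrable fun x => (J : ℂ)⁻¹ * ∑ j ∈ Finset.range J, e j x :=
      (integrable_finsetSum _ fun j _ => hei j).const_mul _
    refine (hardyNorm_le (hsum.congr hae)
      (fun i => (integrable_finsetSum _ fun j _ => hei' i j).const_mul (J : ℂ)⁻¹) fun i =>
      ((RieszPair.sum (hpair i) hei (hei' i) J).const_mul (J : ℂ)⁻¹).congr_ae hae).trans_eq ?_
    simp only [hmean]
    congr 1
    rw [← hmean]
    exact lintegral_congr_ae (hae.symm.fun_comp enorm)

end AffinePaper
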